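/- (Corollary of Theorem A: polynomial parametrization.) Let f ∈ ℂ[X,Y] be an irreducible polynomial whose zero set Z(f) ⊆ ℂ² is contractible in the Euclidean topology. Then there exist one-variable polynomials p, q ∈ ℂ[t] such that the map ℂ → ℂ², t ↦ (p(t), q(t)), is a homeomorphism of ℂ onto Z(f) (with its Euclidean subspace topology). In particular, every contractible irreducible algebraic curve in ℂ² is homeomorphic to ℂ. -/

import Mathlib

namespace PlaneCurve
open Polynomial Filter Topology Asymptotics Bornology

theorem sum_eval_eq_zero_of_powerSums {n : ℕ} {b : Fin n → ℂ} {N : ℕ}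
    (h : ∀ m, 1 ≤ m → m ≤ N → ∑ j, b j ^ m = 0) (P : ℂ[X]) (hP : P.natDegree ≤ N)
    (h0 : P.coeff 0 = 0) : ∑ j, P.eval (b j) = 0 := by
  simp_rw [eval_eq_sum_range]
  rw [Finset.sum_comm]
  refine Finset.sum_eq_zero fun m hm => ?_
  rw [← Finset.mul_sum]
  rcases Nat.eq_zero_or_pos m with rfl | hm'
  · simp [h0]
  · rw [h m hm' (by simp at hm; omega), mul_zero]

/-- Vanishing of the first `n` power sums of `n` numbers forces them all to vanish. -/
theorem eq_zero_of_powerSums {n : ℕ} {b : Fin n → ℂ}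
    (h : ∀ m, 1 ≤ m → m ≤ n → ∑ j, b j ^ m = 0) : b = 0 := by
  classical
  by_contra hb
  obtain ⟨i, hi⟩ : ∃ i, b i ≠ 0 := by
    by_contra! H; exact hb (funext H)
  set S : Finset ℂ := (Finset.univ.image b).erase (b i) with hS
  set P : ℂ[X] := X * ∏ v ∈ S, (X - C v) with hP
  have hcard : S.card + 1 ≤ n := by
    rw [hS, Finset.card_erase_of_mem (by simp)]
    have h1 : (Finset.univ.image b).card ≤ n := by
      simpa using Finset.card_image_le (s := Finset.univ) (f := b)
    have h2 : 0 < (Finset.univ.image b).card := Finset.card_pos.2 ⟨b i, by simp⟩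
    omega
  have hdeg : P.natDegree ≤ n := by
    refine (natDegree_mul_le).trans ?_
    rw [natDegree_X, natDegree_finsetProd_X_sub_C_eq_card]
    omega
  have key := sum_eval_eq_zero_of_powerSums h P hdeg (by simp [hP])
  have hz : ∀ j, P.eval (b j) = if b j = b i then P.eval (b i) else 0 := by
    intro j
    split_ifs with hj
    · rw [hj]
    · rw [hP, eval_mul, eval_prod, Finset.prod_eq_zero (i := b j)]
      · simp
      · simp [hS, hj]
      · simp
  rw [Finset.sum_congr rfl fun j _ => hz j] at key
  rw [Finset.sum_ite, Finset.sum_const_zero, add_zero, Finset.sum_const, nsmul_eq_mul,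
    mul_eq_zero] at key
  rcases key with key | key
  · rw [Nat.cast_eq_zero, Finset.card_eq_zero] at key
    have : i ∈ Finset.univ.filter fun j => b j = b i := by simp
    rw [key] at this
    simp at this
  · rw [hP, eval_mul, eval_prod, eval_X, mul_eq_zero] at key
    rcases key with key | key
    · exact hi key
    · rw [Finset.prod_eq_zero_iff] at key
      obtain ⟨v, hv, hv'⟩ := key
      simp only [eval_sub, eval_X, eval_C, sub_eq_zero] at hv'
      rw [← hv', hS] at hv
      simp at hv

/-- Bounded power sums force bounded entries. -/
theorem exists_bound_of_powerSums (n : ℕ) (K : ℝ) :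
    ∃ K' : ℝ, ∀ b : Fin n → ℂ, (∀ m, 1 ≤ m → m ≤ n → ‖∑ j, b j ^ m‖ ≤ K) → ‖b‖ ≤ K' := by
  set φ : (Fin n → ℂ) → ℝ := fun b => ∑ m ∈ Finset.Icc 1 n, ‖∑ j, b j ^ m‖ with hφ
  have hφc : Continuous φ := by fun_prop
  have hK : IsCompact (Metric.sphere (0 : Fin n → ℂ) 1) := isCompact_sphere _ _
  rcases (Metric.sphere (0 : Fin n → ℂ) 1).eq_empty_or_nonempty with he | hne
  · refine ⟨0, fun b _ => ?_⟩
    by_contra! hb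
    have : (‖b‖⁻¹ : ℂ) • b ∈ Metric.sphere (0 : Fin n → ℂ) 1 := by
      simp [norm_smul, hb.ne']
    rw [he] at this
    exact this
  obtain ⟨c, hc, hmin⟩ := hK.exists_isMinOn hne hφc.continuousOn
  have hδ : 0 < φ c := by
    refine lt_of_le_of_ne (Finset.sum_nonneg fun _ _ => norm_nonneg _) fun h => ?_
    have h' := (Finset.sum_eq_zero_iff_of_nonneg (fun _ _ => norm_nonneg _)).1 h.symm
    have : c = 0 := eq_zero_of_powerSums fun m h1 h2 => by
      simpa using h' m (Finset.mem_Icc.2 ⟨h1, h2⟩)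
    simp [this] at hc
  refine ⟨max 1 (n * K / φ c), fun b hb => ?_⟩
  by_contra! hlt
  obtain ⟨h1, h2⟩ := max_lt_iff.1 hlt
  have hb0 : 0 < ‖b‖ := by linarith
  have hmem : (‖b‖⁻¹ : ℂ) • b ∈ Metric.sphere (0 : Fin n → ℂ) 1 := by
    simp [norm_smul, hb0.ne']
  have h3 : φ c ≤ φ ((‖b‖⁻¹ : ℂ) • b) := hmin hmem
  have h4 : φ ((‖b‖⁻¹ : ℂ) • b) ≤ n * (K * ‖b‖⁻¹) := by
    have : ∀ m ∈ Finset.Icc 1 n, ‖∑ j, ((‖b‖⁻¹ : ℂ) • b) j ^ m‖ ≤ K * ‖b‖⁻¹ := by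
      intro m hm
      obtain ⟨hm1, hm2⟩ := Finset.mem_Icc.1 hm
      simp only [Pi.smul_apply, smul_eq_mul, mul_pow, ← Finset.mul_sum, norm_mul, norm_pow,
        norm_inv, Complex.norm_real, norm_norm]
      rw [mul_comm]
      have hK0 : 0 ≤ K := (norm_nonneg _).trans (hb m hm1 hm2)
      refine mul_le_mul (hb m hm1 hm2) ?_ (by positivity) hK0
      exact pow_le_of_le_one (by positivity) (inv_le_one_of_one_le₀ h1.le) (by omega)
    refine (Finset.sum_le_card_nsmul _ _ _ this).trans ?_
    simp
  rw [div_lt_iff₀ hδ] at h2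
  have : φ c * ‖b‖ ≤ n * K := by
    calc φ c * ‖b‖ ≤ n * (K * ‖b‖⁻¹) * ‖b‖ := by gcongr; exact h3.trans h4
      _ = n * K := by field_simp
  linarith

theorem isBigO_of_powerSums {α : Type*} {l : Filter α} {n : ℕ} {U : α → Fin n → ℂ}
    (h : ∀ m, 1 ≤ m → m ≤ n → (fun x => ∑ j, U x j ^ m) =O[l] fun _ => (1 : ℝ)) (j : Fin n) :
    (fun x => U x j) =O[l] fun _ => (1 : ℝ) := by
  have : ∃ K : ℝ, ∀ m ∈ Finset.Icc 1 n, ∀ᶠ x in l, ‖∑ j, U x j ^ m‖ ≤ K := by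
    have h' : ∀ m, ∃ K : ℝ, m ∈ Finset.Icc 1 n → ∀ᶠ x in l, ‖∑ j, U x j ^ m‖ ≤ K := by
      intro m
      by_cases hm : m ∈ Finset.Icc 1 n
      · obtain ⟨K, hK⟩ := (h m (Finset.mem_Icc.1 hm).1 (Finset.mem_Icc.1 hm).2).bound
        exact ⟨K, fun _ => by simpa using hK⟩
      · exact ⟨0, fun h => (hm h).elim⟩
    choose K hK using h'
    refine ⟨∑ m ∈ Finset.Icc 1 n, |K m|, fun m hm => (hK m hm).mono fun x hx => hx.trans ?_⟩
    exact (le_abs_self _).trans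
      (Finset.single_le_sum (f := fun m => |K m|) (fun _ _ => abs_nonneg _) hm)
  obtain ⟨K, hK⟩ := this
  obtain ⟨K', hK'⟩ := exists_bound_of_powerSums n K
  refine IsBigO.of_bound K' ?_
  have := (Filter.eventually_all_finset _).2 hK
  filter_upwards [this] with x hx
  simpa using (norm_le_pi_norm (U x) j).trans
    (hK' (U x) fun m h1 h2 => hx m (Finset.mem_Icc.2 ⟨h1, h2⟩))

/-- `h` has an order along the filter `l` with respect to the parameter `π`. -/
def HasOrd {α : Type*} (l : Filter α) (π h : α → ℂ) : Prop :=
  (∀ᶠ x in l, h x = 0) ∨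
    ∃ (o : ℤ) (c : ℂ), c ≠ 0 ∧ Tendsto (fun x => h x * π x ^ (-o)) l (𝓝 c)

/-- The dominating power sum controls the size of the entries. -/
theorem exists_dominant_powerSum {α : Type*} {l : Filter α} {n : ℕ}
    {U : α → Fin n → ℂ} {π : α → ℂ} (hπ : Tendsto π l (𝓝 0)) (hπ0 : ∀ᶠ x in l, π x ≠ 0)
    (h : ∀ m, 1 ≤ m → m ≤ n → HasOrd l π fun x => ∑ j, U x j ^ m) :
    (∀ᶠ x in l, ∀ j, U x j = 0) ∨
      ∃ (m : ℕ) (N : ℤ) (c : ℂ), 1 ≤ m ∧ m ≤ n ∧ c ≠ 0 ∧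
        Tendsto (fun x => (∑ j, U x j ^ m) * π x ^ N) l (𝓝 c) ∧
        ∀ j, (fun x => U x j ^ m * π x ^ N) =O[l] fun _ => (1 : ℝ) := by
  classical
  set S : Finset ℕ := (Finset.Icc 1 n).filter fun m => ¬ ∀ᶠ x in l, ∑ j, U x j ^ m = 0 with hS
  rcases S.eq_empty_or_nonempty with he | hne
  · left
    have : ∀ m ∈ Finset.Icc 1 n, ∀ᶠ x in l, ∑ j, U x j ^ m = 0 := by
      intro m hm
      by_contra hc
      have : m ∈ S := by rw [hS, Finset.mem_filter]; exact ⟨hm, hc⟩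
      rw [he] at this
      simp at this
    filter_upwards [(Filter.eventually_all_finset _).2 this] with x hx j
    rw [eq_zero_of_powerSums fun m h1 h2 => hx m (Finset.mem_Icc.2 ⟨h1, h2⟩), Pi.zero_apply]
  right
  have hS' : ∀ m, ∃ (o : ℤ) (c : ℂ), m ∈ S →
      c ≠ 0 ∧ Tendsto (fun x => (∑ j, U x j ^ m) * π x ^ (-o)) l (𝓝 c) := by
    intro m
    by_cases hm : m ∈ S
    · have hm2 := (Finset.mem_filter.1 hm)
      rcases h m (Finset.mem_Icc.1 hm2.1).1 (Finset.mem_Icc.1 hm2.1).2 with h0 | ⟨o, c, h1⟩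
      · exact (hm2.2 h0).elim
      · exact ⟨o, c, fun _ => h1⟩
    · exact ⟨0, 0, fun h => (hm h).elim⟩
  choose o c hoc using hS'
  obtain ⟨m, hm, hmin⟩ := S.exists_min_image (fun m => (o m : ℝ) / m) hne
  have hm2 := Finset.mem_Icc.1 (Finset.mem_filter.1 hm).1
  refine ⟨m, -o m, c m, hm2.1, hm2.2, (hoc m hm).1, (hoc m hm).2, fun j => ?_⟩
  set s : ℝ := (o m : ℝ) / m with hs
  set V : α → Fin n → ℂ := fun x j => U x j * ((‖π x‖ ^ (-s) : ℝ) : ℂ) with hV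
  have hπn : Tendsto (fun x => ‖π x‖) l (𝓝 0) := by simpa using hπ.norm
  have hVb : ∀ k, 1 ≤ k → k ≤ n → (fun x => ∑ j, V x j ^ k) =O[l] fun _ => (1 : ℝ) := by
    intro k h1 h2
    have hVk : ∀ x, ∑ j, V x j ^ k = (∑ j, U x j ^ k) * ((‖π x‖ ^ (-s) : ℝ) : ℂ) ^ k := by
      intro x; simp [hV, mul_pow, Finset.sum_mul]
    by_cases hk : k ∈ S
    · have hsk : s * k ≤ o k := by
        have := hmin k hk
        rwa [le_div_iff₀ (by exact_mod_cast h1)] at this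
      refine IsBigO.trans ?_ ((hoc k hk).2.isBigO_one ℝ)
      refine IsBigO.of_bound 1 ?_
      filter_upwards [hπ0, hπn.eventually (gt_mem_nhds zero_lt_one)] with x hx0 hx1
      have hpos : 0 < ‖π x‖ := norm_pos_iff.2 hx0
      rw [hVk, norm_mul, norm_mul, one_mul]
      gcongr
      rw [norm_pow, Complex.norm_real, norm_zpow, Real.norm_of_nonneg (by positivity),
        ← Real.rpow_natCast, ← Real.rpow_mul hpos.le, ← Real.rpow_intCast]
      refine Real.rpow_le_rpow_of_exponent_ge hpos hx1.le ?_
      push_cast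
      linarith
    · have : ∀ᶠ x in l, ∑ j, U x j ^ k = 0 := by
        by_contra hc
        exact hk (Finset.mem_filter.2 ⟨Finset.mem_Icc.2 ⟨h1, h2⟩, hc⟩)
      refine (isBigO_zero _ _).congr' ?_ EventuallyEq.rfl
      filter_upwards [this] with x hx
      rw [hVk, hx, zero_mul]
  have hVj := isBigO_of_powerSums hVb j
  have hVm : (fun x => V x j ^ m) =O[l] fun _ => (1 : ℝ) := by simpa using hVj.pow m
  refine IsBigO.trans (IsBigO.of_bound 1 ?_) hVm
  filter_upwards [hπ0] with x hx0
  have hpos : 0 < ‖π x‖ := norm_pos_iff.2 hx0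
  have hm0 : (m : ℝ) ≠ 0 := by exact_mod_cast (by omega : m ≠ 0)
  simp only [hV, mul_pow, norm_mul, one_mul]
  gcongr
  rw [norm_pow, Complex.norm_real, norm_zpow, Real.norm_of_nonneg (by positivity),
    ← Real.rpow_natCast, ← Real.rpow_mul hpos.le, ← Real.rpow_intCast]
  apply le_of_eq
  congr 1
  rw [hs]; push_cast; field_simp

/-- The monic polynomial vanishing simply on `B`. -/
noncomputable def denom (B : Finset ℂ) : ℂ[X] := ∏ b ∈ B, (X - C b)

theorem denom_eval_ne {B : Finset ℂ} {x : ℂ} (hx : x ∉ B) : (denom B).eval x ≠ 0 := by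
  rw [denom, eval_prod, Finset.prod_ne_zero_iff]
  intro b hb
  simp only [eval_sub, eval_X, eval_C, sub_ne_zero]
  rintro rfl
  exact hx hb

theorem denom_ne_zero (B : Finset ℂ) : denom B ≠ 0 :=
  (monic_prod_of_monic _ _ fun b _ => monic_X_sub_C b).ne_zero

theorem eventually_notMem_nhdsNE (B : Finset ℂ) (b : ℂ) : ∀ᶠ x in 𝓝[≠] b, x ∉ B := by
  have h1 : ∀ᶠ x in 𝓝 b, x ∉ B.erase b :=
    (B.erase b).finite_toSet.isClosed.isOpen_compl.mem_nhds (by simp)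
  filter_upwards [h1.filter_mono nhdsWithin_le_nhds, self_mem_nhdsWithin] with x hx hxb hxB
  exact hx (Finset.mem_erase.2 ⟨hxb, hxB⟩)

theorem eventually_notMem_cobounded (B : Finset ℂ) : ∀ᶠ x in cobounded ℂ, x ∉ B :=
  (isBounded_def.1 B.finite_toSet.isBounded)

theorem eventually_ne_zero_cobounded : ∀ᶠ x in cobounded ℂ, x ≠ 0 := by
  simpa using eventually_notMem_cobounded {0}

/-- Functions on `ℂ` that agree off `B` with a rational function with poles in `B`. -/
noncomputable def Rat (B : Finset ℂ) : Subalgebra ℂ (ℂ → ℂ) where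
  carrier := {h | ∃ (k : ℕ) (r : ℂ[X]), ∀ x ∉ B, h x * (denom B).eval x ^ k = r.eval x}
  mul_mem' := by
    rintro a b ⟨k, r, h⟩ ⟨k', r', h'⟩
    refine ⟨k + k', r * r', fun x hx => ?_⟩
    rw [eval_mul, ← h x hx, ← h' x hx, Pi.mul_apply]; ring
  add_mem' := by
    rintro a b ⟨k, r, h⟩ ⟨k', r', h'⟩
    refine ⟨k + k', r * denom B ^ k' + r' * denom B ^ k, fun x hx => ?_⟩
    rw [eval_add, eval_mul, eval_mul, ← h x hx, ← h' x hx, Pi.add_apply, eval_pow, eval_pow]; ring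
  algebraMap_mem' := fun c => ⟨0, C c, fun x _ => by simp⟩

theorem eval_mem_rat (B : Finset ℂ) (q : ℂ[X]) : (fun x => q.eval x) ∈ Rat B :=
  ⟨0, q, fun x _ => by simp⟩

theorem rat_congr {B : Finset ℂ} {h h' : ℂ → ℂ} (hh : h ∈ Rat B) (e : ∀ x ∉ B, h' x = h x) :
    h' ∈ Rat B := by
  obtain ⟨k, r, hr⟩ := hh
  exact ⟨k, r, fun x hx => by rw [e x hx, hr x hx]⟩

theorem dvd_denom_pow {B : Finset ℂ} {r : ℂ[X]} (hr : ∀ x ∉ B, r.eval x ≠ 0) :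
    ∃ N, r ∣ denom B ^ N := by
  have h0 : r ≠ 0 := by
    rintro rfl
    obtain ⟨x, hx⟩ := Infinite.exists_notMem_finset B
    simpa using hr x hx
  refine ⟨r.roots.card, ?_⟩
  rw [(IsAlgClosed.splits r).dvd_iff_roots_le_roots h0 (pow_ne_zero _ (denom_ne_zero B)),
    roots_pow, denom, roots_prod_X_sub_C, Multiset.le_iff_count]
  intro a
  rw [Multiset.count_nsmul]
  by_cases ha : a ∈ r.roots
  · have : a ∈ B := by
      by_contra h
      exact hr a h ((mem_roots'.1 ha).2)
    rw [show Multiset.count a B.val = 1 from Multiset.count_eq_one_of_mem B.nodup this, mul_one]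
    exact Multiset.count_le_card _ _
  · simp [Multiset.count_eq_zero_of_notMem ha]

theorem inv_mem_rat {B : Finset ℂ} {h : ℂ → ℂ} (hh : h ∈ Rat B) (h0 : ∀ x ∉ B, h x ≠ 0) :
    (fun x => (h x)⁻¹) ∈ Rat B := by
  obtain ⟨k, r, hr⟩ := hh
  have hr0 : ∀ x ∉ B, r.eval x ≠ 0 := fun x hx => by
    rw [← hr x hx]; exact mul_ne_zero (h0 x hx) (pow_ne_zero _ (denom_eval_ne hx))
  obtain ⟨N, s, hs⟩ := dvd_denom_pow hr0
  refine ⟨N, denom B ^ k * s, fun x hx => ?_⟩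
  have := congrArg (eval x) hs
  rw [eval_pow, eval_mul] at this
  rw [this, ← hr x hx, eval_mul, eval_pow]
  field_simp [h0 x hx]

theorem inv_sub_mem_rat {B : Finset ℂ} {b : ℂ} (hb : b ∈ B) :
    (fun x => (x - b)⁻¹) ∈ Rat B := by
  refine inv_mem_rat (h := fun x => x - b) ?_ fun x hx => ?_
  · exact rat_congr (eval_mem_rat B (X - C b)) fun x _ => by simp
  · rw [sub_ne_zero]; rintro rfl; exact hx hb

/-- A rational function with less than simple poles is a polynomial. -/
theorem exists_polynomial_of_rat {B : Finset ℂ} {h : ℂ → ℂ} (hh : h ∈ Rat B)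
    (hb : ∀ b ∈ B, Tendsto (fun x => h x * (x - b)) (𝓝[≠] b) (𝓝 0)) :
    ∃ q : ℂ[X], ∀ x ∉ B, h x = q.eval x := by
  have key : ∀ (d : ℕ) (E r : ℂ[X]), E.natDegree = d → (∀ x ∉ B, E.eval x ≠ 0) →
      (∀ x ∉ B, h x * E.eval x = r.eval x) → ∃ q : ℂ[X], ∀ x ∉ B, h x = q.eval x := by
    intro d
    induction d with
    | zero =>
      intro E r hE hE0 hr
      rw [natDegree_eq_zero] at hE
      obtain ⟨c, rfl⟩ := hE
      refine ⟨C c⁻¹ * r, fun x hx => ?_⟩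
      have := hE0 x hx
      rw [eval_C] at this
      rw [eval_mul, ← hr x hx, eval_C, eval_C]
      field_simp
    | succ d ih =>
      intro E r hE hE0 hr
      obtain ⟨b, hbE⟩ := IsAlgClosed.exists_root E (by
        intro h; rw [natDegree_eq_zero_iff_degree_le_zero.2 h.le] at hE; omega)
      have hbB : b ∈ B := by
        by_contra h; exact hE0 b h hbE
      obtain ⟨E', rfl⟩ := dvd_iff_isRoot.2 hbE
      have hlim : Tendsto (fun x => r.eval x) (𝓝[≠] b) (𝓝 0) := by
        have h1 : Tendsto (fun x => h x * (x - b) * E'.eval x) (𝓝[≠] b) (𝓝 (0 * E'.eval b)) :=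
          (hb b hbB).mul ((E'.continuous.tendsto b).mono_left nhdsWithin_le_nhds)
        rw [zero_mul] at h1
        refine h1.congr' ?_
        filter_upwards [eventually_notMem_nhdsNE B b] with x hx
        rw [← hr x hx, eval_mul, eval_sub, eval_X, eval_C, mul_assoc]
      have hrb : r.IsRoot b :=
        tendsto_nhds_unique ((r.continuous.tendsto b).mono_left nhdsWithin_le_nhds) hlim
      obtain ⟨r', rfl⟩ := dvd_iff_isRoot.2 hrb
      refine ih E' r' ?_ ?_ ?_
      · have hE'0 : E' ≠ 0 := by
          rintro rfl
          simp at hE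
        rw [natDegree_mul (X_sub_C_ne_zero b) hE'0, natDegree_X_sub_C] at hE
        omega
      · intro x hx h0
        exact hE0 x hx (by rw [eval_mul, h0, mul_zero])
      · intro x hx
        have h1 := hr x hx
        have hne : x - b ≠ 0 := by
          rw [sub_ne_zero]; rintro rfl; exact hx hbB
        rw [eval_mul, eval_mul, eval_sub, eval_X, eval_C] at h1
        apply mul_left_cancel₀ hne
        linear_combination h1
  obtain ⟨k, r, hr⟩ := hh
  refine key _ (denom B ^ k) r rfl (fun x hx => ?_) fun x hx => ?_
  · rw [eval_pow]; exact pow_ne_zero _ (denom_eval_ne hx)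
  · rw [eval_pow, hr x hx]

theorem polynomial_ord_nhdsNE {r : ℂ[X]} (hr : r ≠ 0) (b : ℂ) :
    ∃ (o : ℤ) (c : ℂ), c ≠ 0 ∧ Tendsto (fun x => r.eval x * (x - b) ^ (-o)) (𝓝[≠] b) (𝓝 c) := by
  obtain ⟨q, hq, hq0⟩ := exists_eq_pow_rootMultiplicity_mul_and_not_dvd r hr b
  refine ⟨r.rootMultiplicity b, q.eval b, fun h => hq0 (dvd_iff_isRoot.2 h), ?_⟩
  refine ((q.continuous.tendsto b).mono_left nhdsWithin_le_nhds).congr' ?_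
  filter_upwards [self_mem_nhdsWithin] with x hx
  have hne : x - b ≠ 0 := sub_ne_zero.2 hx
  have e : r.eval x = (x - b) ^ r.rootMultiplicity b * q.eval x := by
    conv_lhs => rw [hq]
    simp
  rw [e, zpow_neg, zpow_natCast]
  field_simp

theorem tendsto_eval_div_pow (r : ℂ[X]) :
    Tendsto (fun x => r.eval x / x ^ r.natDegree) (cobounded ℂ) (𝓝 r.leadingCoeff) := by
  have h : r.eval ~[cobounded ℂ] (r.leadingCoeff * · ^ r.natDegree) :=
    isEquivalent_cobounded_leading_monomial
  have h2 : (fun x => r.eval x / x ^ r.natDegree) ~[cobounded ℂ]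
      fun x => (r.leadingCoeff * x ^ r.natDegree) / x ^ r.natDegree :=
    h.div IsEquivalent.refl
  have h3 : (fun x : ℂ => (r.leadingCoeff * x ^ r.natDegree) / x ^ r.natDegree)
      =ᶠ[cobounded ℂ] fun _ => r.leadingCoeff := by
    filter_upwards [eventually_ne_zero_cobounded] with x hx
    field_simp
  exact h2.symm.tendsto_nhds (tendsto_const_nhds.congr' h3.symm)

theorem polynomial_ord_cobounded {r : ℂ[X]} (hr : r ≠ 0) :
    ∃ (o : ℤ) (c : ℂ), c ≠ 0 ∧
      Tendsto (fun x => r.eval x * (x⁻¹) ^ (-o)) (cobounded ℂ) (𝓝 c) := by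
  refine ⟨-r.natDegree, r.leadingCoeff, leadingCoeff_ne_zero.2 hr, ?_⟩
  refine (tendsto_eval_div_pow r).congr fun x => ?_
  rw [neg_neg, zpow_natCast, inv_pow, div_eq_mul_inv]

theorem hasOrd_of_rat {B : Finset ℂ} {h : ℂ → ℂ} (hh : h ∈ Rat B) {l : Filter ℂ} {π : ℂ → ℂ}
    (hB : ∀ᶠ x in l, x ∉ B) (hπ : ∀ᶠ x in l, π x ≠ 0)
    (hl : ∀ r : ℂ[X], r ≠ 0 → ∃ (o : ℤ) (c : ℂ), c ≠ 0 ∧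
      Tendsto (fun x => r.eval x * π x ^ (-o)) l (𝓝 c)) : HasOrd l π h := by
  obtain ⟨k, r, hr⟩ := hh
  by_cases h0 : r = 0
  · left
    filter_upwards [hB] with x hx
    have := hr x hx
    rw [h0, eval_zero, mul_eq_zero] at this
    exact this.resolve_right (pow_ne_zero _ (denom_eval_ne hx))
  right
  obtain ⟨o, c, hc, h1⟩ := hl r h0
  obtain ⟨o', c', hc', h2⟩ := hl _ (pow_ne_zero k (denom_ne_zero B))
  refine ⟨o - o', c / c', div_ne_zero hc hc', (h1.div h2 hc').congr' ?_⟩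
  filter_upwards [hB, hπ] with x hx hx'
  have := denom_eval_ne hx
  rw [Pi.div_apply, ← hr x hx, eval_pow, neg_sub, sub_eq_add_neg, zpow_add₀ hx', zpow_neg, zpow_neg]
  field_simp

theorem hasOrd_nhdsNE_of_rat {B : Finset ℂ} {h : ℂ → ℂ} (hh : h ∈ Rat B) (b : ℂ) :
    HasOrd (𝓝[≠] b) (fun x => x - b) h :=
  hasOrd_of_rat hh (eventually_notMem_nhdsNE B b)
    (by filter_upwards [self_mem_nhdsWithin] with x hx using sub_ne_zero.2 hx)
    fun _ hr => polynomial_ord_nhdsNE hr b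

theorem hasOrd_cobounded_of_rat {B : Finset ℂ} {h : ℂ → ℂ} (hh : h ∈ Rat B) :
    HasOrd (cobounded ℂ) (fun x => x⁻¹) h :=
  hasOrd_of_rat hh (eventually_notMem_cobounded B)
    (by filter_upwards [eventually_ne_zero_cobounded] with x hx using inv_ne_zero hx)
    fun _ hr => polynomial_ord_cobounded hr

theorem natDegree_lt_of_isLittleO {r : ℂ[X]} {e : ℕ} (hr : r ≠ 0)
    (h : (fun x => r.eval x) =o[cobounded ℂ] fun x => x ^ e) : r.natDegree < e := by
  by_contra! hle
  have h1 : (fun x => r.eval x) =o[cobounded ℂ] fun x : ℂ => x ^ r.natDegree :=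
    h.trans_isBigO (isBigO_pow_pow_cobounded_of_le hle)
  have h2 := h1.tendsto_div_nhds_zero
  exact hr (leadingCoeff_eq_zero.1 (tendsto_nhds_unique (tendsto_eval_div_pow r) h2))

theorem natDegree_le_of_isBigO {r : ℂ[X]} {e : ℕ}
    (h : (fun x => r.eval x) =O[cobounded ℂ] fun x => x ^ e) : r.natDegree ≤ e := by
  by_cases hr : r = 0
  · simp [hr]
  · exact Nat.lt_succ_iff.1 (natDegree_lt_of_isLittleO hr
      (h.trans_isLittleO (isLittleO_pow_pow_cobounded_of_lt (Nat.lt_succ_self e))))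

theorem eval_isBigO_cobounded {r : ℂ[X]} {e : ℕ} (h : r.natDegree ≤ e) :
    (fun x => r.eval x) =O[cobounded ℂ] fun x => x ^ e := by
  have : r.degree ≤ (X ^ e : ℂ[X]).degree := by
    rw [degree_X_pow]; exact degree_le_of_natDegree_le h
  simpa using isBigO_cobounded_of_degree_le this

/-- A plane curve `F(x, y) = 0`, monic in `y`, with an enumeration `Y` of the roots over each `x`
and a finite set `B` outside which the roots are distinct. -/
structure Branches (n : ℕ) where
  F : ℂ[X][X]
  monic : F.Monic
  prime : Prime F
  Y : ℂ → Fin n → ℂ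
  map_eq : ∀ x, F.map (evalRingHom x) = ∏ j, (X - C (Y x j))
  B : Finset ℂ
  zero_mem : 0 ∈ B
  inj : ∀ x ∉ B, Function.Injective (Y x)

/-- Sum over the branches. -/
def tr {n : ℕ} (U : ℂ → Fin n → ℂ) (x : ℂ) : ℂ := ∑ j, U x j

namespace Branches
variable {n : ℕ} (S : Branches n)

theorem evalEval_eq_prod (x y : ℂ) : S.F.evalEval x y = ∏ j, (y - S.Y x j) := by
  rw [← map_evalRingHom_eval, S.map_eq, eval_prod]
  simp

theorem evalEval_eq_zero_iff {x y : ℂ} : S.F.evalEval x y = 0 ↔ ∃ j, y = S.Y x j := by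
  rw [evalEval_eq_prod, Finset.prod_eq_zero_iff]
  simp [sub_eq_zero]

theorem evalEval_Y (x : ℂ) (j : Fin n) : S.F.evalEval x (S.Y x j) = 0 :=
  S.evalEval_eq_zero_iff.2 ⟨j, rfl⟩

theorem natDegree_F : S.F.natDegree = n := by
  have := S.monic.natDegree_map (evalRingHom (0 : ℂ))
  rw [S.map_eq, natDegree_finsetProd_X_sub_C_eq_card] at this
  simpa using this.symm

theorem n_pos (S : Branches n) : 0 < n := by
  rcases Nat.eq_zero_or_pos n with h | h
  · have h1 : S.F = 1 := S.monic.natDegree_eq_zero.1 (S.natDegree_F.trans h)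
    exact (S.prime.not_isUnit (by rw [h1]; exact isUnit_one)).elim
  · exact h

theorem exists_powerSum (m : ℕ) : ∃ q : ℂ[X], ∀ x, ∑ j, S.Y x j ^ m = q.eval x := by
  obtain ⟨P, hP⟩ := MvPolynomial.esymmAlgHom_surjective (σ := Fin n) (n := n) (R := ℂ) (by simp)
    ⟨MvPolynomial.psum (Fin n) ℂ m, MvPolynomial.psum_isSymmetric (Fin n) ℂ m⟩
  have hP' := congrArg Subtype.val hP
  rw [MvPolynomial.esymmAlgHom_apply] at hP'
  have he : ∀ i : Fin n, ∃ q : ℂ[X], ∀ x,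
      MvPolynomial.aeval (S.Y x) (MvPolynomial.esymm (Fin n) ℂ (i + 1)) = q.eval x := by
    intro i
    refine ⟨(-1) ^ (i.1 + 1) * S.F.coeff (n - (i + 1)), fun x => ?_⟩
    have h1 := Multiset.prod_X_sub_C_coeff (Finset.univ.val.map (S.Y x)) (k := n - (i + 1))
      (by simp)
    have hi : n - (n - (i.1 + 1)) = i + 1 := by omega
    have h2 : (Multiset.map (fun t => X - C t) (Finset.univ.val.map (S.Y x))).prod
        = S.F.map (evalRingHom x) := by
      rw [S.map_eq, Multiset.map_map]; rfl
    rw [h2, coeff_map, Multiset.card_map, Finset.card_val, Finset.card_univ, Fintype.card_fin,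
      hi] at h1
    rw [MvPolynomial.aeval_esymm_eq_multiset_esymm, eval_mul]
    simp only [coe_evalRingHom] at h1
    rw [h1]
    simp [← mul_assoc, ← mul_pow]
  choose q hq using he
  refine ⟨MvPolynomial.aeval q P, fun x => ?_⟩
  have h3 := congrArg (MvPolynomial.aeval (S.Y x)) hP'
  rw [MvPolynomial.comp_aeval_apply] at h3
  simp only [hq] at h3
  rw [show ∑ j, S.Y x j ^ m = MvPolynomial.aeval (S.Y x) (MvPolynomial.psum (Fin n) ℂ m) by
    simp [MvPolynomial.psum]]
  refine h3.symm.trans ?_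
  have h4 := MvPolynomial.comp_aeval_apply (f := q) (φ := Polynomial.aeval (R := ℂ) x) P
  simpa [Polynomial.coe_aeval_eq_eval] using h4.symm

/-- Functions on the branches agreeing off `B` with a rational function with poles over `B`. -/
noncomputable def Reg : Subalgebra ℂ (ℂ → Fin n → ℂ) where
  carrier := {U | ∃ (k : ℕ) (g : ℂ[X][X]), ∀ x ∉ S.B, ∀ j,
    U x j * (denom S.B).eval x ^ k = g.evalEval x (S.Y x j)}
  mul_mem' := by
    rintro a b ⟨k, r, h⟩ ⟨k', r', h'⟩
    refine ⟨k + k', r * r', fun x hx j => ?_⟩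
    rw [evalEval_mul, ← h x hx, ← h' x hx, Pi.mul_apply, Pi.mul_apply]; ring
  add_mem' := by
    rintro a b ⟨k, r, h⟩ ⟨k', r', h'⟩
    refine ⟨k + k', r * C (denom S.B ^ k') + r' * C (denom S.B ^ k), fun x hx j => ?_⟩
    rw [evalEval_add, evalEval_mul, evalEval_mul, ← h x hx, ← h' x hx, Pi.add_apply,
      Pi.add_apply, evalEval_C, evalEval_C, eval_pow, eval_pow]
    ring
  algebraMap_mem' := fun c => ⟨0, C (C c), fun x _ j => by simp [evalEval_C]⟩

theorem reg_congr {U U' : ℂ → Fin n → ℂ} (hU : U ∈ S.Reg) (e : ∀ x ∉ S.B, ∀ j, U' x j = U x j) :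
    U' ∈ S.Reg := by
  obtain ⟨k, r, hr⟩ := hU
  exact ⟨k, r, fun x hx j => by rw [e x hx, hr x hx]⟩

theorem Y_mem : S.Y ∈ S.Reg := ⟨0, X, fun x _ j => by simp⟩

theorem const_mem {h : ℂ → ℂ} (hh : h ∈ Rat S.B) : (fun x (_ : Fin n) => h x) ∈ S.Reg := by
  obtain ⟨k, r, hr⟩ := hh
  exact ⟨k, C r, fun x hx j => by rw [hr x hx, evalEval_C]⟩

theorem tr_mem {U : ℂ → Fin n → ℂ} (hU : U ∈ S.Reg) : tr U ∈ Rat S.B := by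
  obtain ⟨k, g, hg⟩ := hU
  choose q hq using S.exists_powerSum
  refine ⟨k, ∑ i ∈ Finset.range (g.natDegree + 1), g.coeff i * q i, fun x hx => ?_⟩
  rw [tr, Finset.sum_mul, Finset.sum_congr rfl fun j _ => hg x hx j, eval_finsetSum]
  simp_rw [← map_evalRingHom_eval, eval_mul, ← hq, eval_map, eval₂_eq_sum_range]
  rw [Finset.sum_comm]
  simp [Finset.mul_sum]

theorem dvd_of_evalEval_eq_zero {g : ℂ[X][X]} (hg : ∀ x ∉ S.B, ∀ j, g.evalEval x (S.Y x j) = 0) :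
    S.F ∣ g := by
  rw [← modByMonic_eq_zero_iff_dvd S.monic]
  set r := g %ₘ S.F with hr
  have hdeg : r.natDegree < n := by
    rw [← S.natDegree_F]
    refine natDegree_modByMonic_lt g S.monic ?_
    intro h
    exact S.prime.not_isUnit (by rw [h]; exact isUnit_one)
  have hr0 : ∀ x ∉ S.B, r.map (evalRingHom x) = 0 := by
    intro x hx
    refine eq_zero_of_natDegree_lt_card_of_eval_eq_zero _ (S.inj x hx) (fun j => ?_) ?_
    · have h1 := congrArg (evalEval x (S.Y x j)) (modByMonic_add_div g S.F)
      rw [evalEval_add, evalEval_mul, S.evalEval_Y, zero_mul, add_zero, hg x hx] at h1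
      rw [map_evalRingHom_eval, h1]
    · rw [Fintype.card_fin]
      exact natDegree_map_le.trans_lt hdeg
  ext1 i
  rw [coeff_zero]
  have hinf : (↑S.B : Set ℂ)ᶜ.Infinite := S.B.finite_toSet.infinite_compl
  refine eq_zero_of_infinite_isRoot _ (hinf.mono fun x hx => ?_)
  have := congrArg (fun p => p.coeff i) (hr0 x hx)
  simpa [coeff_map] using this

/-- The ring of regular functions is a domain. -/
theorem reg_domain {U V : ℂ → Fin n → ℂ} (hU : U ∈ S.Reg) (hV : V ∈ S.Reg)
    (h : ∀ x ∉ S.B, ∀ j, U x j * V x j = 0) :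
    (∀ x ∉ S.B, ∀ j, U x j = 0) ∨ ∀ x ∉ S.B, ∀ j, V x j = 0 := by
  obtain ⟨k, g, hg⟩ := hU
  obtain ⟨k', g', hg'⟩ := hV
  have key : S.F ∣ g * g' := S.dvd_of_evalEval_eq_zero fun x hx j => by
    rw [evalEval_mul, ← hg x hx, ← hg' x hx, mul_mul_mul_comm, h x hx, zero_mul]
  have aux : ∀ (W : ℂ → Fin n → ℂ) (k : ℕ) (g : ℂ[X][X]), (∀ x ∉ S.B, ∀ j,
      W x j * (denom S.B).eval x ^ k = g.evalEval x (S.Y x j)) → S.F ∣ g →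
      ∀ x ∉ S.B, ∀ j, W x j = 0 := by
    rintro W k g hW ⟨p, rfl⟩ x hx j
    have := hW x hx j
    rw [evalEval_mul, S.evalEval_Y, zero_mul, mul_eq_zero] at this
    exact this.resolve_right (pow_ne_zero _ (denom_eval_ne hx))
  rcases S.prime.dvd_or_dvd key with h | h
  · exact .inl (aux U k g hg h)
  · exact .inr (aux V k' g' hg' h)

theorem reg_prod_domain {ι : Type*} (s : Finset ι) {U : ι → ℂ → Fin n → ℂ}
    (hU : ∀ i, U i ∈ S.Reg) (h : ∀ x ∉ S.B, ∀ j, ∏ i ∈ s, U i x j = 0) :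
    ∃ i ∈ s, ∀ x ∉ S.B, ∀ j, U i x j = 0 := by
  classical
  induction s using Finset.induction_on with
  | empty =>
    obtain ⟨x, hx⟩ := Infinite.exists_notMem_finset S.B
    simpa using h x hx ⟨0, S.n_pos⟩
  | insert a s ha ih =>
    have hm : (∏ i ∈ s, U i) ∈ S.Reg := prod_mem fun i _ => hU i
    rcases S.reg_domain (hU a) hm fun x hx j => by
        simpa [Finset.prod_insert ha] using h x hx j with h1 | h1
    · exact ⟨a, by simp, h1⟩
    · obtain ⟨i, hi, h2⟩ := ih fun x hx j => by simpa using h1 x hx j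
      exact ⟨i, by simp [hi], h2⟩

/-- A regular function all of whose powers have constant trace is constant. -/
theorem exists_const_of_tr {U : ℂ → Fin n → ℂ} (hU : U ∈ S.Reg)
    (h : ∀ m, 1 ≤ m → ∃ c, ∀ x ∉ S.B, tr (U ^ m) x = c) :
    ∃ c, ∀ x ∉ S.B, ∀ j, U x j = c := by
  obtain ⟨x₁, hx₁⟩ := Infinite.exists_notMem_finset S.B
  have hpoly : ∀ (P : ℂ[X]), ∀ x ∉ S.B, ∑ j, P.eval (U x j) = ∑ j, P.eval (U x₁ j) := by
    intro P x hx
    simp_rw [eval_eq_sum_range]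
    rw [Finset.sum_comm, Finset.sum_comm (s := Finset.univ)]
    refine Finset.sum_congr rfl fun m _ => ?_
    rw [← Finset.mul_sum, ← Finset.mul_sum]
    congr 1
    rcases Nat.eq_zero_or_pos m with rfl | hm
    · simp
    · obtain ⟨c, hc⟩ := h m hm
      exact (hc x hx).trans (hc x₁ hx₁).symm
  have hz : ∀ x ∉ S.B, ∀ j, ∏ k, (U x j - U x₁ k) = 0 := by
    intro x hx j
    have : (fun j => ∏ k, (U x j - U x₁ k)) = 0 := by
      refine eq_zero_of_powerSums fun m h1 _ => ?_
      have := hpoly ((∏ k, (X - C (U x₁ k))) ^ m) x hx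
      simp only [eval_pow, eval_prod, eval_sub, eval_X, eval_C] at this
      rw [this]
      refine Finset.sum_eq_zero fun i _ => ?_
      rw [Finset.prod_eq_zero (Finset.mem_univ i) (sub_self _), zero_pow (by omega)]
    exact congrFun this j
  obtain ⟨k, -, hk⟩ := S.reg_prod_domain Finset.univ
    (U := fun k => U - algebraMap ℂ _ (U x₁ k)) (fun k => sub_mem hU (Subalgebra.algebraMap_mem _ _))
    fun x hx j => by simpa using hz x hx j
  exact ⟨U x₁ k, fun x hx j => by simpa [sub_eq_zero] using hk x hx j⟩

/-- The values of a tuple of functions on the fibre over `x`. -/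
def mat (w : Fin n → ℂ → Fin n → ℂ) (x : ℂ) : Matrix (Fin n) (Fin n) ℂ :=
  Matrix.of fun i j => w i x j

/-- The trace-dual tuple. -/
noncomputable def dual (w : Fin n → ℂ → Fin n → ℂ) (i : Fin n) (x : ℂ) (j : Fin n) : ℂ :=
  (mat w x)⁻¹ j i

theorem tr_dual_mul {w : Fin n → ℂ → Fin n → ℂ} {x : ℂ} (hw : (mat w x).det ≠ 0) (i k : Fin n) :
    tr (dual w i * w k) x = if i = k then 1 else 0 := by
  have := congrFun (congrFun (Matrix.mul_nonsing_inv (mat w x) hw.isUnit) k) i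
  rw [Matrix.mul_apply, Matrix.one_apply] at this
  simp only [tr, Pi.mul_apply, dual]
  simp_rw [eq_comm (a := i), ← this]
  exact Finset.sum_congr rfl fun j _ => mul_comm _ _

theorem sum_dual_mul {w : Fin n → ℂ → Fin n → ℂ} {x : ℂ} (hw : (mat w x).det ≠ 0) (j k : Fin n) :
    ∑ i, dual w i x j * w i x k = if j = k then 1 else 0 := by
  have := congrFun (congrFun (Matrix.nonsing_inv_mul (mat w x) hw.isUnit) j) k
  rwa [Matrix.mul_apply, Matrix.one_apply] at this

theorem expand_basis {w : Fin n → ℂ → Fin n → ℂ} {x : ℂ} (hw : (mat w x).det ≠ 0)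
    (U : ℂ → Fin n → ℂ) (j : Fin n) : U x j = ∑ i, tr (U * dual w i) x * w i x j := by
  simp only [tr, Pi.mul_apply, Finset.sum_mul]
  rw [Finset.sum_comm]
  simp_rw [mul_assoc, ← Finset.mul_sum, sum_dual_mul hw]
  simp

theorem expand_dual {w : Fin n → ℂ → Fin n → ℂ} {x : ℂ} (hw : (mat w x).det ≠ 0)
    (U : ℂ → Fin n → ℂ) (j : Fin n) : U x j = ∑ i, tr (U * w i) x * dual w i x j := by
  simp only [tr, Pi.mul_apply, Finset.sum_mul]
  rw [Finset.sum_comm]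
  simp_rw [mul_assoc, mul_comm (w _ x _), ← Finset.mul_sum, sum_dual_mul hw]
  simp

theorem det_mem_rat {B : Finset ℂ} {M : ℂ → Matrix (Fin n) (Fin n) ℂ}
    (hM : ∀ i j, (fun x => M x i j) ∈ Rat B) : (fun x => (M x).det) ∈ Rat B := by
  have : (fun x => (M x).det) = ∑ σ : Equiv.Perm (Fin n),
      algebraMap ℂ (ℂ → ℂ) ((Equiv.Perm.sign σ : ℤ) : ℂ) * ∏ i, fun x => M x (σ i) i := by
    ext x
    simp [Matrix.det_apply']
  rw [this]
  exact sum_mem fun σ _ => mul_mem (Subalgebra.algebraMap_mem _ _) (prod_mem fun i _ => hM _ _)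

theorem gram_eq (w : Fin n → ℂ → Fin n → ℂ) (x : ℂ) :
    (Matrix.of fun i k => tr (w i * w k) x) = mat w x * (mat w x).transpose := by
  ext i k
  simp [Matrix.mul_apply, mat, tr]

theorem dual_mem {w : Fin n → ℂ → Fin n → ℂ} (hw : ∀ i, w i ∈ S.Reg)
    (hdet : ∀ x ∉ S.B, (mat w x).det ≠ 0) (i : Fin n) : dual w i ∈ S.Reg := by
  set G : ℂ → Matrix (Fin n) (Fin n) ℂ := fun x => Matrix.of fun i k => tr (w i * w k) x with hG
  have hGm : ∀ i k, (fun x => G x i k) ∈ Rat S.B := fun i k => S.tr_mem (mul_mem (hw i) (hw k))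
  have hGdet : ∀ x ∉ S.B, (G x).det ≠ 0 := fun x hx => by
    rw [hG]; simp only [gram_eq]
    rw [Matrix.det_mul, Matrix.det_transpose]
    exact mul_ne_zero (hdet x hx) (hdet x hx)
  have hadj : ∀ k i, (fun x => (G x).adjugate k i) ∈ Rat S.B := by
    intro k i
    simp_rw [Matrix.adjugate_apply]
    refine det_mem_rat fun a b => ?_
    by_cases ha : a = i
    · subst ha
      simp only [Matrix.updateRow_self]
      exact Subalgebra.algebraMap_mem (Rat S.B) ((Pi.single k (1 : ℂ) : Fin n → ℂ) b)
    · simp only [Matrix.updateRow_ne ha]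
      exact hGm a b
  have hinv : ∀ k, (fun x => ((G x).det)⁻¹ * (G x).adjugate k i) ∈ Rat S.B := fun k =>
    mul_mem (inv_mem_rat (det_mem_rat hGm) hGdet) (hadj k i)
  have hsum : (∑ k, w k * fun x (_ : Fin n) => ((G x).det)⁻¹ * (G x).adjugate k i) ∈ S.Reg :=
    sum_mem fun k _ => mul_mem (hw k) (S.const_mem (hinv k))
  refine S.reg_congr hsum fun x hx j => ?_
  have h1 : (mat w x)⁻¹ = (mat w x).transpose * (G x)⁻¹ := by
    apply Matrix.inv_eq_right_inv
    rw [← Matrix.mul_assoc, ← gram_eq]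
    exact Matrix.mul_nonsing_inv _ (hGdet x hx).isUnit
  rw [dual, h1, Matrix.mul_apply]
  simp [Matrix.inv_def, mat, Finset.sum_apply, Ring.inverse_eq_inv']

theorem mem_reg_of_tr {w : Fin n → ℂ → Fin n → ℂ} (hw : ∀ i, w i ∈ S.Reg)
    (hdet : ∀ x ∉ S.B, (mat w x).det ≠ 0) {U : ℂ → Fin n → ℂ}
    (hU : ∀ i, tr (U * w i) ∈ Rat S.B) : U ∈ S.Reg := by
  have hsum : (∑ i, (fun x (_ : Fin n) => tr (U * w i) x) * dual w i) ∈ S.Reg :=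
    sum_mem fun i _ => mul_mem (S.const_mem (hU i)) (S.dual_mem hw hdet i)
  refine S.reg_congr hsum fun x hx j => ?_
  rw [expand_dual (hdet x hx) U j]
  simp [Finset.sum_apply]

/-- The powers `1, y, …, y ^ (n - 1)`. -/
def ypow (S : Branches n) (i : Fin n) (x : ℂ) (j : Fin n) : ℂ := S.Y x j ^ i.1

theorem ypow_mem (i : Fin n) : S.ypow i ∈ S.Reg := pow_mem S.Y_mem i.1

theorem det_ypow (x : ℂ) (hx : x ∉ S.B) : (mat S.ypow x).det ≠ 0 := by
  have : mat S.ypow x = (Matrix.vandermonde (S.Y x)).transpose := by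
    ext i j; simp [mat, ypow]
  rw [this, Matrix.det_transpose, Matrix.det_vandermonde_ne_zero_iff]
  exact S.inj x hx

theorem Y_isBigO_one (b : ℂ) (j : Fin n) :
    (fun x => S.Y x j) =O[𝓝 b] fun _ => (1 : ℝ) := by
  refine isBigO_of_powerSums (fun m _ _ => ?_) j
  obtain ⟨q, hq⟩ := S.exists_powerSum m
  simp_rw [hq]
  exact (q.continuous.tendsto b).isBigO_one ℝ

theorem exists_Y_isBigO : ∃ e : ℕ, ∀ j, (fun x => S.Y x j) =O[cobounded ℂ] fun x => x ^ e := by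
  choose q hq using S.exists_powerSum
  set e := ∑ m ∈ Finset.Icc 1 n, (q m).natDegree with he
  refine ⟨e, fun j => ?_⟩
  have h1 : (fun x => S.Y x j / x ^ e) =O[cobounded ℂ] fun _ => (1 : ℝ) := by
    refine isBigO_of_powerSums (U := fun x j => S.Y x j / x ^ e) (fun m h1 h2 => ?_) j
    simp_rw [div_pow, ← Finset.sum_div, hq]
    have hle : (q m).natDegree ≤ e * m := by
      have h3 : (q m).natDegree ≤ e := Finset.single_le_sum (f := fun m => (q m).natDegree)
        (fun _ _ => Nat.zero_le _) (Finset.mem_Icc.2 ⟨h1, h2⟩)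
      nlinarith
    refine ((eval_isBigO_cobounded hle).mul (isBigO_refl (fun x : ℂ => ((x ^ e) ^ m)⁻¹) _)).trans ?_
    refine IsBigO.of_bound 1 ?_
    filter_upwards [eventually_ne_zero_cobounded] with x hx
    rw [← pow_mul, mul_inv_cancel₀ (pow_ne_zero _ hx)]
    simp
  have h2 := h1.mul (isBigO_refl (fun x : ℂ => x ^ e) (cobounded ℂ)).norm_right
  refine (h2.congr' ?_ ?_).of_norm_right
  · filter_upwards [eventually_ne_zero_cobounded] with x hx
    field_simp
  · exact Eventually.of_forall fun x => by simp

end Branches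

theorem tendsto_zero_of_pow {α : Type*} {l : Filter α} {f : α → ℂ} {m : ℕ}
    (h : Tendsto (fun x => f x ^ m) l (𝓝 0)) : Tendsto f l (𝓝 0) := by
  rcases Nat.eq_zero_or_pos m with rfl | hm
  · simp only [pow_zero] at h
    rcases l.eq_or_neBot with rfl | hl
    · exact tendsto_bot
    · exact absurd (tendsto_nhds_unique h tendsto_const_nhds) (by norm_num)
  rw [tendsto_zero_iff_norm_tendsto_zero] at h ⊢
  simp_rw [norm_pow] at h
  have h1 := h.rpow_const (p := (m : ℝ)⁻¹) (Or.inr (by positivity))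
  rw [Real.zero_rpow (by positivity)] at h1
  refine h1.congr fun x => ?_
  exact Real.pow_rpow_inv_natCast (norm_nonneg _) (by omega)

theorem isBigO_one_of_pow {α : Type*} {l : Filter α} {f : α → ℂ} {m : ℕ} (hm : m ≠ 0)
    (h : (fun x => f x ^ m) =O[l] fun _ => (1 : ℝ)) : f =O[l] fun _ => (1 : ℝ) := by
  have : (fun x => f x ^ m) =O[l] fun x => (1 : ℝ) ^ m := by simpa using h
  exact IsBigO.of_pow hm this

theorem rat_common {B : Finset ℂ} {ι : Type*} [Fintype ι] {h : ι → ℂ → ℂ}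
    (hh : ∀ i, h i ∈ Rat B) : ∃ (k : ℕ) (r : ι → ℂ[X]), ∀ i, ∀ x ∉ B,
      h i x * (denom B).eval x ^ k = (r i).eval x := by
  choose k r hr using hh
  refine ⟨∑ i, k i, fun i => r i * denom B ^ (∑ i, k i - k i), fun i x hx => ?_⟩
  have hle : k i ≤ ∑ i, k i := Finset.single_le_sum (fun _ _ => Nat.zero_le _) (Finset.mem_univ i)
  rw [eval_mul, ← hr i x hx, eval_pow, mul_assoc, ← pow_add]
  congr 2; omega

theorem eval_eq_of_notMem {B : Finset ℂ} {p q : ℂ[X]} (h : ∀ x ∉ B, p.eval x = q.eval x) :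
    p = q :=
  eq_of_infinite_eval_eq p q (B.finite_toSet.infinite_compl.mono fun x hx => h x hx)

namespace Branches
variable {n : ℕ} (S : Branches n)

theorem poly_mem (q : ℂ[X]) : (fun x (_ : Fin n) => q.eval x) ∈ S.Reg :=
  S.const_mem (eval_mem_rat _ q)

/-- Regular functions with less than simple poles with respect to the base coordinate. -/
noncomputable def W : Submodule ℂ (ℂ → Fin n → ℂ) where
  carrier := {U | U ∈ S.Reg ∧ ∀ b ∈ S.B, ∀ j,
    Tendsto (fun x => U x j * (x - b)) (𝓝[≠] b) (𝓝 0)}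
  add_mem' := by
    rintro U V ⟨h1, h2⟩ ⟨h3, h4⟩
    refine ⟨add_mem h1 h3, fun b hb j => ?_⟩
    simpa [add_mul] using (h2 b hb j).add (h4 b hb j)
  zero_mem' := ⟨ZeroMemClass.zero_mem S.Reg, fun b _ j => by simp⟩
  smul_mem' := by
    rintro c U ⟨h1, h2⟩
    refine ⟨Subalgebra.smul_mem _ h1 c, fun b hb j => ?_⟩
    simpa [mul_assoc] using (h2 b hb j).const_mul c

/-- Regular functions that are locally bounded over the base. -/
noncomputable def Lam : Subalgebra ℂ (ℂ → Fin n → ℂ) where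
  carrier := {U | U ∈ S.Reg ∧ ∀ b ∈ S.B, ∀ j,
    (fun x => U x j) =O[𝓝[≠] b] fun _ => (1 : ℝ)}
  add_mem' := by
    rintro U V ⟨h1, h2⟩ ⟨h3, h4⟩
    exact ⟨add_mem h1 h3, fun b hb j => (h2 b hb j).add (h4 b hb j)⟩
  mul_mem' := by
    rintro U V ⟨h1, h2⟩ ⟨h3, h4⟩
    exact ⟨mul_mem h1 h3, fun b hb j => by simpa using (h2 b hb j).mul (h4 b hb j)⟩
  algebraMap_mem' := fun c => ⟨Subalgebra.algebraMap_mem _ c, fun b _ j => by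
    simpa using isBigO_const_const c (one_ne_zero (α := ℝ)) (𝓝[≠] b)⟩

theorem mul_mem_W {w a : ℂ → Fin n → ℂ} (hw : w ∈ S.W) (ha : a ∈ S.Lam) : w * a ∈ S.W := by
  refine ⟨mul_mem hw.1 ha.1, fun b hb j => ?_⟩
  have h1 : (fun x => w x j * (x - b)) =o[𝓝[≠] b] fun _ => (1 : ℝ) :=
    (isLittleO_one_iff ℝ).2 (hw.2 b hb j)
  have h2 := h1.mul_isBigO (ha.2 b hb j)
  simp only [mul_one] at h2
  refine ((isLittleO_one_iff ℝ).1 h2).congr fun x => ?_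
  simp only [Pi.mul_apply]; ring

theorem tendsto_sub_nhdsNE (b : ℂ) : Tendsto (fun x => x - b) (𝓝[≠] b) (𝓝 0) := by
  have : Tendsto (fun x => x - b) (𝓝 b) (𝓝 (b - b)) := (continuous_id.sub continuous_const).tendsto b
  rw [sub_self] at this
  exact this.mono_left nhdsWithin_le_nhds

theorem one_mem_W : (1 : ℂ → Fin n → ℂ) ∈ S.W :=
  ⟨one_mem _, fun b _ j => by simpa using tendsto_sub_nhdsNE b⟩

theorem lam_le_W {a : ℂ → Fin n → ℂ} (ha : a ∈ S.Lam) : a ∈ S.W := by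
  simpa using S.mul_mem_W S.one_mem_W ha

theorem poly_mem_Lam (q : ℂ[X]) : (fun x (_ : Fin n) => q.eval x) ∈ S.Lam :=
  ⟨S.poly_mem q, fun b _ _ => ((q.continuous.tendsto b).mono_left nhdsWithin_le_nhds).isBigO_one ℝ⟩

theorem Y_mem_Lam : S.Y ∈ S.Lam :=
  ⟨S.Y_mem, fun b _ j => (S.Y_isBigO_one b j).mono nhdsWithin_le_nhds⟩

theorem tr_of_mem_W {w : ℂ → Fin n → ℂ} (hw : w ∈ S.W) :
    ∃ q : ℂ[X], ∀ x ∉ S.B, tr w x = q.eval x := by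
  refine exists_polynomial_of_rat (S.tr_mem hw.1) fun b hb => ?_
  simp only [tr, Finset.sum_mul]
  simpa using tendsto_finsetSum Finset.univ fun j _ => hw.2 b hb j

theorem tr_isLittleO {U : ℂ → Fin n → ℂ} {l : Filter ℂ} {g : ℂ → ℂ}
    (h : ∀ j, (fun x => U x j) =o[l] g) : tr U =o[l] g :=
  IsLittleO.fun_sum fun j _ => h j

theorem poly_congr_cobounded {B : Finset ℂ} {h : ℂ → ℂ} {q : ℂ[X]}
    (hq : ∀ x ∉ B, h x = q.eval x) : h =ᶠ[cobounded ℂ] fun x => q.eval x :=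
  (eventually_notMem_cobounded B).mono hq

theorem lam_eq_zero {a : ℂ → Fin n → ℂ} (ha : a ∈ S.Lam)
    (h : ∀ j, Tendsto (fun x => a x j) (cobounded ℂ) (𝓝 0)) : ∀ x ∉ S.B, ∀ j, a x j = 0 := by
  have hm : ∀ m, 1 ≤ m → ∀ x ∉ S.B, tr (a ^ m) x = 0 := by
    intro m hm
    obtain ⟨q, hq⟩ := S.tr_of_mem_W (S.lam_le_W (pow_mem ha m))
    have h1 : tr (a ^ m) =o[cobounded ℂ] fun x => x ^ 0 := by
      refine tr_isLittleO fun j => ?_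
      simp only [pow_zero]
      rw [isLittleO_one_iff]
      simpa [zero_pow (by omega : m ≠ 0)] using (h j).pow m
    have : q = 0 := by
      by_contra hq0
      exact absurd (natDegree_lt_of_isLittleO hq0
        (h1.congr' (poly_congr_cobounded hq) EventuallyEq.rfl)) (by omega)
    intro x hx
    rw [hq x hx, this, eval_zero]
  intro x hx j
  exact congrFun (eq_zero_of_powerSums (b := a x) fun m h1 _ => hm m h1 x hx) j

/-- A tuple in `W` that is a basis over every point off `B`, with growth bounds at infinity. -/
structure IsTuple (w : Fin n → ℂ → Fin n → ℂ) (e : Fin n → ℕ) : Prop where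
  mem : ∀ i, w i ∈ S.W
  growth : ∀ i j, (fun x => w i x j) =O[cobounded ℂ] fun x => x ^ e i
  det_ne : ∀ x ∉ S.B, (mat (w) x).det ≠ 0

theorem exists_discr {w : Fin n → ℂ → Fin n → ℂ} (hw : ∀ i, w i ∈ S.W) :
    ∃ P : ℂ[X], ∀ x ∉ S.B, (denom S.B).eval x ^ n * (mat w x).det ^ 2 = P.eval x := by
  have h1 : ∀ i k, ∃ q : ℂ[X], ∀ x ∉ S.B,
      (denom S.B).eval x * tr (w i * w k) x = q.eval x := by
    intro i k
    refine exists_polynomial_of_rat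
      (mul_mem (eval_mem_rat S.B (denom S.B)) (S.tr_mem (mul_mem (hw i).1 (hw k).1))) fun b hb => ?_
    have h2 : Tendsto (fun x => (∏ b' ∈ S.B.erase b, (X - C b')).eval x *
        ∑ j, (w i x j * (x - b)) * (w k x j * (x - b))) (𝓝[≠] b)
        (𝓝 ((∏ b' ∈ S.B.erase b, (X - C b')).eval b * ∑ _j : Fin n, 0 * 0)) :=
      (((Polynomial.continuous _).tendsto b).mono_left nhdsWithin_le_nhds).mul
        (tendsto_finsetSum _ fun j _ => ((hw i).2 b hb j).mul ((hw k).2 b hb j))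
    simp only [mul_zero, Finset.sum_const_zero] at h2
    refine h2.congr fun x => ?_
    have h3 : (denom S.B).eval x = (x - b) * (∏ b' ∈ S.B.erase b, (X - C b')).eval x := by
      rw [denom, ← Finset.mul_prod_erase _ _ hb]; simp
    rw [h3, tr, Finset.mul_sum, Finset.mul_sum, Finset.sum_mul]
    refine Finset.sum_congr rfl fun j _ => ?_
    simp only [Pi.mul_apply]; ring
  choose q hq using h1
  refine ⟨(Matrix.of q).det, fun x hx => ?_⟩
  have h2 : (Matrix.of q).map (evalRingHom x) =
      (denom S.B).eval x • (mat w x * (mat w x).transpose) := by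
    rw [← gram_eq]
    ext i k
    simp [hq i k x hx]
  rw [← coe_evalRingHom, RingHom.map_det, RingHom.mapMatrix_apply, h2, Matrix.det_smul,
    Matrix.det_mul, Matrix.det_transpose, Fintype.card_fin, sq, coe_evalRingHom]

/-- Complexity bound of a tuple: discriminant degree plus growth exponents. -/
def HasSize (w : Fin n → ℂ → Fin n → ℂ) (e : Fin n → ℕ) (m : ℕ) : Prop :=
  S.IsTuple w e ∧ ∃ P : ℂ[X], (∀ x ∉ S.B, (denom S.B).eval x ^ n * (mat w x).det ^ 2 = P.eval x) ∧
    m = P.natDegree + ∑ i, e i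

theorem exists_tuple : ∃ w e, S.IsTuple w e := by
  obtain ⟨e, he⟩ := S.exists_Y_isBigO
  refine ⟨S.ypow, fun i => e * i.1, fun i => ?_, fun i j => ?_, fun x hx => S.det_ypow x hx⟩
  · exact S.lam_le_W (pow_mem S.Y_mem_Lam i.1)
  · simpa only [pow_mul, ypow] using (he j).pow i.1

theorem exists_minimal : ∃ w e m, S.HasSize w e m ∧ ∀ w' e' m', S.HasSize w' e' m' → m ≤ m' := by
  classical
  have h : ∃ m, ∃ w e, S.HasSize w e m := by
    obtain ⟨w, e, h⟩ := S.exists_tuple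
    obtain ⟨P, hP⟩ := S.exists_discr h.mem
    exact ⟨_, w, e, h, P, hP, rfl⟩
  obtain ⟨w, e, hw⟩ := Nat.find_spec h
  exact ⟨w, e, _, hw, fun w' e' m' h' => Nat.find_min' h ⟨w', e', h'⟩⟩

/-- A tuple of minimal complexity. -/
def IsMin (w : Fin n → ℂ → Fin n → ℂ) (e : Fin n → ℕ) : Prop :=
  ∃ m, S.HasSize w e m ∧ ∀ w' e' m', S.HasSize w' e' m' → m ≤ m'

theorem mat_update (w : Fin n → ℂ → Fin n → ℂ) (i : Fin n) (v : ℂ → Fin n → ℂ) (x : ℂ) :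
    mat (Function.update w i v) x = (mat w x).updateRow i (v x) := by
  ext k j
  by_cases hk : k = i
  · subst hk; simp [mat]
  · simp [mat, hk]

theorem det_mat_update {w : Fin n → ℂ → Fin n → ℂ} {i : Fin n} {v : ℂ → Fin n → ℂ} {x : ℂ}
    {c : Fin n → ℂ} (hv : ∀ j, v x j = ∑ k, c k * w k x j) :
    (mat (Function.update w i v) x).det = c i * (mat w x).det := by
  rw [mat_update]
  have : v x = ∑ k, c k • mat w x k := by
    ext j; simp [hv, mat, Finset.sum_apply]
  rw [this, Matrix.det_updateRow_sum, smul_eq_mul]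

theorem IsMin.no_pole_exchange {S : Branches n} {w e} (h : S.IsMin w e) {b : ℂ} (hb : b ∈ S.B)
    {γ : Fin n → ℂ} (hv : (fun x j => (x - b)⁻¹ * ∑ i, γ i * w i x j) ∈ S.W) : γ = 0 := by
  classical
  obtain ⟨m, ⟨ht, P, hP, hm⟩, hmin⟩ := h
  by_contra hγ
  have hne : (Finset.univ.filter fun i => γ i ≠ 0).Nonempty := by
    by_contra h0
    apply hγ
    ext i
    by_contra hi
    exact h0 ⟨i, by simpa using hi⟩
  obtain ⟨i, hi, hmax⟩ := Finset.exists_max_image _ e hne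
  simp only [Finset.mem_filter, Finset.mem_univ, true_and] at hi hmax
  set v : ℂ → Fin n → ℂ := fun x j => (x - b)⁻¹ * ∑ i, γ i * w i x j with hvdef
  have hdet : ∀ x, (mat (Function.update w i v) x).det = ((x - b)⁻¹ * γ i) * (mat w x).det := by
    intro x
    refine det_mat_update (c := fun k => (x - b)⁻¹ * γ k) fun j => ?_
    simp [hvdef, Finset.mul_sum, mul_assoc]
  have hsub : ∀ x ∉ S.B, x - b ≠ 0 := fun x hx => by
    rw [sub_ne_zero]; rintro rfl; exact hx hb
  have ht' : S.IsTuple (Function.update w i v) e := by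
    refine ⟨fun k => ?_, fun k j => ?_, fun x hx => ?_⟩
    · by_cases hk : k = i
      · subst hk; simpa using hv
      · simpa [hk] using ht.mem k
    · by_cases hk : k = i
      · subst hk
        simp only [Function.update_self, hvdef]
        have h1 : (fun x => ∑ i, γ i * w i x j) =O[cobounded ℂ] fun x => x ^ e k := by
          refine IsBigO.fun_sum fun i _ => ?_
          by_cases hγi : γ i = 0
          · simp [hγi, isBigO_zero]
          · exact ((ht.growth i j).trans
              (isBigO_pow_pow_cobounded_of_le (hmax i hγi))).const_mul_left _
        have h2 : (fun x : ℂ => (x - b)⁻¹) =O[cobounded ℂ] fun _ => (1 : ℂ) := by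
          have h3 : Tendsto (fun x : ℂ => x - b) (cobounded ℂ) (cobounded ℂ) := by
            simp [sub_eq_add_neg]
          exact (tendsto_inv₀_cobounded.comp h3).isBigO_one ℂ
        simpa using h2.mul h1
      · simpa [hk] using ht.growth k j
    · rw [hdet]
      exact mul_ne_zero (mul_ne_zero (inv_ne_zero (hsub x hx)) hi) (ht.det_ne x hx)
  obtain ⟨P', hP'⟩ := S.exists_discr ht'.mem
  have hPP' : (X - C b) ^ 2 * P' = C (γ i ^ 2) * P := by
    refine eval_eq_of_notMem (B := S.B) fun x hx => ?_
    have := hsub x hx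
    rw [eval_mul, ← hP' x hx, eval_mul, ← hP x hx, hdet]
    simp only [eval_pow, eval_sub, eval_X, eval_C]
    field_simp
  have hP0 : P ≠ 0 := by
    rintro rfl
    obtain ⟨x, hx⟩ := Infinite.exists_notMem_finset S.B
    have := hP x hx
    rw [eval_zero, mul_eq_zero] at this
    rcases this with h | h
    · exact pow_ne_zero _ (denom_eval_ne hx) h
    · exact pow_ne_zero _ (ht.det_ne x hx) h
  have hP'0 : P' ≠ 0 := by
    rintro rfl
    rw [mul_zero] at hPP'
    exact mul_ne_zero (C_ne_zero.2 (pow_ne_zero 2 hi)) hP0 hPP'.symm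
  have hdeg := congrArg natDegree hPP'
  rw [natDegree_mul (pow_ne_zero _ (X_sub_C_ne_zero b)) hP'0, natDegree_pow, natDegree_X_sub_C,
    natDegree_C_mul (pow_ne_zero 2 hi)] at hdeg
  have := hmin _ _ _ ⟨ht', P', hP', rfl⟩
  omega

theorem IsMin.no_growth_exchange {S : Branches n} {w e} (h : S.IsMin w e)
    (hW : ∀ w ∈ S.W, (∀ j, (fun x => w x j) =O[cobounded ℂ] fun x => x⁻¹) →
      ∀ x ∉ S.B, ∀ j, w x j = 0)
    {γ : Fin n → ℂ} (hv : ∀ j, (fun x => ∑ i, γ i * (w i x j * (x ^ e i)⁻¹))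
      =O[cobounded ℂ] fun x => x⁻¹) : γ = 0 := by
  classical
  obtain ⟨m, ⟨ht, P, hP, hm⟩, hmin⟩ := h
  by_contra hγ
  have hne : (Finset.univ.filter fun i => γ i ≠ 0).Nonempty := by
    by_contra h0
    apply hγ
    ext i
    by_contra hi
    exact h0 ⟨i, by simpa using hi⟩
  obtain ⟨i, hi, hmax⟩ := Finset.exists_max_image _ e hne
  simp only [Finset.mem_filter, Finset.mem_univ, true_and] at hi hmax
  set v : ℂ → Fin n → ℂ := fun x j => ∑ k, (γ k * x ^ (e i - e k)) * w k x j with hvdef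
  have hvW : v ∈ S.W := by
    have : v = ∑ k, w k * fun x (_ : Fin n) => (C (γ k) * X ^ (e i - e k) : ℂ[X]).eval x := by
      ext x j
      simp only [hvdef, Finset.sum_apply, Pi.mul_apply]
      refine Finset.sum_congr rfl fun k _ => ?_
      simp only [eval_mul, eval_C, eval_pow, eval_X]; ring
    rw [this]
    exact sum_mem fun k _ => S.mul_mem_W (ht.mem k) (S.poly_mem_Lam _)
  have hvO : ∀ j, (fun x => v x j) =O[cobounded ℂ] fun x => x ^ e i * x⁻¹ := by
    intro j
    refine ((isBigO_refl (fun x : ℂ => x ^ e i) _).mul (hv j)).congr' ?_ EventuallyEq.rfl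
    filter_upwards [eventually_ne_zero_cobounded] with x hx
    rw [Finset.mul_sum]
    refine Finset.sum_congr rfl fun k _ => ?_
    by_cases hk : γ k = 0
    · simp [hk]
    · have h1 : x ^ e i = x ^ (e i - e k) * x ^ e k := by
        rw [← pow_add, Nat.sub_add_cancel (hmax k hk)]
      rw [h1]
      field_simp
  have hdet : ∀ x, (mat (Function.update w i v) x).det = γ i * (mat w x).det := by
    intro x
    rw [det_mat_update (c := fun k => γ k * x ^ (e i - e k)) fun j => rfl]
    simp
  have hdet' : ∀ x ∉ S.B, (mat (Function.update w i v) x).det ≠ 0 := fun x hx => by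
    rw [hdet]; exact mul_ne_zero hi (ht.det_ne x hx)
  rcases Nat.eq_zero_or_pos (e i) with he | he
  · have h0 := hW v hvW fun j => by simpa [he] using hvO j
    obtain ⟨x, hx⟩ := Infinite.exists_notMem_finset S.B
    apply hdet' x hx
    refine Matrix.det_eq_zero_of_row_eq_zero i fun j => ?_
    simp [mat, h0 x hx]
  have ht' : S.IsTuple (Function.update w i v) (Function.update e i (e i - 1)) := by
    refine ⟨fun k => ?_, fun k j => ?_, hdet'⟩
    · by_cases hk : k = i
      · subst hk; simpa using hvW
      · simpa [hk] using ht.mem k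
    · by_cases hk : k = i
      · subst hk
        simp only [Function.update_self]
        refine (hvO j).congr' EventuallyEq.rfl ?_
        filter_upwards [eventually_ne_zero_cobounded] with x hx
        conv_lhs => rw [← Nat.sub_add_cancel he, pow_succ]
        field_simp
      · simpa [hk] using ht.growth k j
  have h1 : S.HasSize (Function.update w i v) (Function.update e i (e i - 1))
      (P.natDegree + ∑ k, Function.update e i (e i - 1) k) := by
    refine ⟨ht', C (γ i ^ 2) * P, fun x hx => ?_, ?_⟩
    · rw [hdet, eval_mul, eval_C, ← hP x hx]; ring
    · rw [natDegree_C_mul (pow_ne_zero 2 hi)]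
  have h2 := hmin _ _ _ h1
  rw [Finset.sum_update_of_mem (Finset.mem_univ i)] at h2
  have h3 := Finset.add_sum_erase Finset.univ e (Finset.mem_univ i)
  rw [Finset.sdiff_singleton_eq_erase] at h2
  omega

theorem IsMin.isTuple {S : Branches n} {w e} (h : S.IsMin w e) : S.IsTuple w e := by
  obtain ⟨m, ⟨ht, _⟩, _⟩ := h
  exact ht

theorem IsMin.dual_mem {S : Branches n} {w e} (h : S.IsMin w e) (i : Fin n) :
    dual w i ∈ S.Reg :=
  S.dual_mem (fun i => (h.isTuple.mem i).1) h.isTuple.det_ne i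

theorem poly_mul_mem_W {w : ℂ → Fin n → ℂ} (hw : w ∈ S.W) (q : ℂ[X]) :
    (fun x j => q.eval x * w x j) ∈ S.W := by
  have := S.mul_mem_W hw (S.poly_mem_Lam q)
  rwa [mul_comm] at this

theorem W_congr {U U' : ℂ → Fin n → ℂ} (hU : U ∈ S.W) (e : ∀ x ∉ S.B, ∀ j, U' x j = U x j) :
    U' ∈ S.W := by
  refine ⟨S.reg_congr hU.1 e, fun b hb j => (hU.2 b hb j).congr' ?_⟩
  filter_upwards [eventually_notMem_nhdsNE S.B b] with x hx
  rw [e x hx]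

/-- A minimal tuple generates `W` over the polynomials in the base coordinate. -/
theorem IsMin.exists_coeff {S : Branches n} {w e} (h : S.IsMin w e) {u : ℂ → Fin n → ℂ}
    (hu : u ∈ S.W) : ∃ q : Fin n → ℂ[X], ∀ i, ∀ x ∉ S.B, tr (u * dual w i) x = (q i).eval x := by
  have key : ∀ (d : ℕ) (E : ℂ[X]) (r : Fin n → ℂ[X]), E.natDegree = d →
      (∀ x ∉ S.B, E.eval x ≠ 0) →
      (∀ i, ∀ x ∉ S.B, tr (u * dual w i) x * E.eval x = (r i).eval x) →
      ∃ q : Fin n → ℂ[X], ∀ i, ∀ x ∉ S.B, tr (u * dual w i) x = (q i).eval x := by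
    intro d
    induction d with
    | zero =>
      intro E r hE hE0 hr
      rw [natDegree_eq_zero] at hE
      obtain ⟨c, rfl⟩ := hE
      refine ⟨fun i => C c⁻¹ * r i, fun i x hx => ?_⟩
      have := hE0 x hx
      rw [eval_C] at this
      rw [eval_mul, ← hr i x hx, eval_C, eval_C]
      field_simp
    | succ d ih =>
      intro E r hE hE0 hr
      obtain ⟨b, hbE⟩ := IsAlgClosed.exists_root E (by
        intro h; rw [natDegree_eq_zero_iff_degree_le_zero.2 h.le] at hE; omega)
      have hbB : b ∈ S.B := by
        by_contra h; exact hE0 b h hbE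
      obtain ⟨E', rfl⟩ := dvd_iff_isRoot.2 hbE
      have hsub : ∀ x ∉ S.B, x - b ≠ 0 := fun x hx => by
        rw [sub_ne_zero]; rintro rfl; exact hx hbB
      have hr' : ∀ i, ∃ r' : ℂ[X], r i = C ((r i).eval b) + (X - C b) * r' := by
        intro i
        obtain ⟨r', h'⟩ := X_sub_C_dvd_sub_C_eval (a := b) (p := r i)
        exact ⟨r', by rw [← h']; ring⟩
      choose r' hr' using hr'
      have hγ : (fun i => (r i).eval b) = 0 := by
        refine h.no_pole_exchange hbB (S.W_congr (U := (fun x j => E'.eval x * u x j) -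
          ∑ i, fun x j => (r' i).eval x * w i x j) ?_ fun x hx j => ?_)
        · exact sub_mem (S.poly_mul_mem_W hu E')
            (sum_mem fun i _ => S.poly_mul_mem_W (h.isTuple.mem i) _)
        · have h1 : E'.eval x * u x j = (x - b)⁻¹ * ∑ i, (r i).eval x * w i x j := by
            conv_lhs => rw [expand_basis (h.isTuple.det_ne x hx) u j]
            rw [Finset.mul_sum, Finset.mul_sum]
            refine Finset.sum_congr rfl fun i _ => ?_
            rw [← hr i x hx]
            simp only [eval_mul, eval_sub, eval_X, eval_C]
            field_simp [hsub x hx]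
          simp only [Pi.sub_apply, Finset.sum_apply, h1]
          rw [Finset.mul_sum, Finset.mul_sum, ← Finset.sum_sub_distrib]
          refine Finset.sum_congr rfl fun i _ => ?_
          have h2 := congrArg (eval x) (hr' i)
          simp only [eval_add, eval_mul, eval_sub, eval_X, eval_C] at h2
          rw [h2]
          field_simp [hsub x hx]
          ring
      refine ih E' r' ?_ ?_ ?_
      · have hE'0 : E' ≠ 0 := by
          rintro rfl
          simp at hE
        rw [natDegree_mul (X_sub_C_ne_zero b) hE'0, natDegree_X_sub_C] at hE
        omega
      · intro x hx h0
        exact hE0 x hx (by rw [eval_mul, h0, mul_zero])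
      · intro i x hx
        have h1 := hr i x hx
        have h2 := congrArg (eval x) (hr' i)
        rw [congrFun hγ i] at h2
        simp only [eval_add, eval_mul, eval_sub, eval_X, eval_C, Pi.zero_apply, zero_add] at h1 h2
        apply mul_left_cancel₀ (hsub x hx)
        rw [← h2, ← h1]; ring
  obtain ⟨k, r, hr⟩ := rat_common fun i => S.tr_mem (mul_mem hu.1 (h.dual_mem i))
  refine key _ (denom S.B ^ k) r rfl (fun x hx => ?_) fun i x hx => ?_
  · rw [eval_pow]; exact pow_ne_zero _ (denom_eval_ne hx)
  · rw [eval_pow, hr i x hx]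

end Branches

namespace Branches
variable {n : ℕ} (S : Branches n)

/-- There is no nonzero function in `W` vanishing at infinity. -/
def NoForms : Prop :=
  ∀ w ∈ S.W, (∀ j, (fun x => w x j) =O[cobounded ℂ] fun x => x⁻¹) → ∀ x ∉ S.B, ∀ j, w x j = 0

theorem evalEval_mem_Lam (g : ℂ[X][X]) : (fun x j => g.evalEval x (S.Y x j)) ∈ S.Lam := by
  have : (fun x j => g.evalEval x (S.Y x j)) =
      ∑ i ∈ Finset.range (g.natDegree + 1), (fun x (_ : Fin n) => (g.coeff i).eval x) * S.Y ^ i := by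
    ext x j
    rw [← map_evalRingHom_eval, eval_map, eval₂_eq_sum_range]
    simp [Finset.sum_apply]
  rw [this]
  exact sum_mem fun i _ => mul_mem (S.poly_mem_Lam _) (pow_mem S.Y_mem_Lam i)

theorem IsMin.tr_mul_dual_isBigO {S : Branches n} {w e} (h : S.IsMin w e) (hW : S.NoForms)
    {u : ℂ → Fin n → ℂ} (hu : u ∈ S.Reg)
    (hu' : ∀ j, (fun x => u x j) =O[cobounded ℂ] fun _ => (1 : ℂ)) (i : Fin n) :
    (fun x => tr (u * dual w i) x * x ^ e i) =O[cobounded ℂ] fun _ => (1 : ℂ) := by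
  obtain ⟨k, r, hr⟩ := rat_common (B := S.B)
    (h := fun i x => tr (u * dual w i) x * x ^ e i) fun i => by
      have := mul_mem (S.tr_mem (mul_mem hu (h.dual_mem i))) (eval_mem_rat S.B (X ^ e i))
      simpa [Pi.mul_def] using this
  set D : ℂ[X] := denom S.B ^ k with hD
  have hDne : ∀ x ∉ S.B, D.eval x ≠ 0 := fun x hx => by
    rw [hD, eval_pow]; exact pow_ne_zero _ (denom_eval_ne hx)
  by_cases hR : Finset.univ.sup (fun i => (r i).natDegree) ≤ D.natDegree
  · have h1 : (fun x => (r i).eval x) =O[cobounded ℂ] fun x => D.eval x := by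
      refine isBigO_cobounded_of_degree_le ?_
      have h2 : (r i).natDegree ≤ D.natDegree :=
        (Finset.le_sup (f := fun i => (r i).natDegree) (Finset.mem_univ i)).trans hR
      have h3 : D ≠ 0 := pow_ne_zero _ (denom_ne_zero S.B)
      rw [degree_eq_natDegree h3]
      exact degree_le_of_natDegree_le h2
    have h2 := h1.mul (isBigO_refl (fun x => (D.eval x)⁻¹) (cobounded ℂ))
    refine h2.congr' ?_ ?_
    · filter_upwards [eventually_notMem_cobounded S.B] with x hx
      have := hDne x hx
      rw [← hr i x hx]
      simp only [hD, eval_pow] at this ⊢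
      field_simp
    · filter_upwards [eventually_notMem_cobounded S.B] with x hx
      exact mul_inv_cancel₀ (hDne x hx)
  · exfalso
    push Not at hR
    set R := Finset.univ.sup (fun i => (r i).natDegree) with hRdef
    have hle : ∀ i, (r i).natDegree ≤ R := fun i =>
      Finset.le_sup (f := fun i => (r i).natDegree) (Finset.mem_univ i)
    have hγ := h.no_growth_exchange hW (γ := fun i => (r i).coeff R) fun j => by
      have hs : ∀ i, ((r i) - C ((r i).coeff R) * X ^ R).natDegree ≤ R - 1 := by
        intro i
        rw [natDegree_le_iff_coeff_eq_zero]
        intro N hN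
        rw [coeff_sub, coeff_C_mul, coeff_X_pow]
        rcases eq_or_ne N R with rfl | hne
        · simp
        · rw [coeff_eq_zero_of_natDegree_lt ((hle i).trans_lt (by omega))]
          simp [hne]
      have h1 : (fun x => D.eval x * u x j - ∑ i, ((r i) - C ((r i).coeff R) * X ^ R).eval x *
          (w i x j * (x ^ e i)⁻¹)) =O[cobounded ℂ] fun x => x ^ (R - 1) := by
        refine IsBigO.sub ?_ (IsBigO.fun_sum fun i _ => ?_)
        · simpa using (eval_isBigO_cobounded (r := D) (e := R - 1) (by omega)).mul (hu' j)
        · have h2 : (fun x => w i x j * (x ^ e i)⁻¹) =O[cobounded ℂ] fun _ => (1 : ℂ) := by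
            refine ((h.isTuple.growth i j).mul
              (isBigO_refl (fun x : ℂ => (x ^ e i)⁻¹) (cobounded ℂ))).congr' EventuallyEq.rfl ?_
            filter_upwards [eventually_ne_zero_cobounded] with x hx
            exact mul_inv_cancel₀ (pow_ne_zero _ hx)
          simpa using (eval_isBigO_cobounded (hs i)).mul h2
      refine ((isBigO_refl (fun x : ℂ => (x ^ R)⁻¹) (cobounded ℂ)).mul h1).congr' ?_ ?_
      · filter_upwards [eventually_ne_zero_cobounded, eventually_notMem_cobounded S.B] with x hx hxB
        have h3 : D.eval x * u x j = ∑ i, (r i).eval x * (w i x j * (x ^ e i)⁻¹) := by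
          rw [expand_basis (h.isTuple.det_ne x hxB) u j, Finset.mul_sum]
          refine Finset.sum_congr rfl fun i _ => ?_
          rw [← hr i x hxB, hD, eval_pow]
          field_simp
        rw [h3, ← Finset.sum_sub_distrib, Finset.mul_sum]
        refine Finset.sum_congr rfl fun i _ => ?_
        simp only [eval_sub, eval_mul, eval_C, eval_pow, eval_X]
        field_simp
        ring
      · filter_upwards [eventually_ne_zero_cobounded] with x hx
        have : x ^ R = x ^ (R - 1) * x := by rw [← pow_succ]; congr 1; omega
        rw [this]
        field_simp
    have : Nonempty (Fin n) := ⟨i⟩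
    obtain ⟨i₀, -, hi₀⟩ := Finset.exists_mem_eq_sup (Finset.univ (α := Fin n))
      Finset.univ_nonempty (fun i => (r i).natDegree)
    have h4 := congrFun hγ i₀
    rw [← hRdef] at hi₀
    simp only [hi₀, Pi.zero_apply, coeff_natDegree, leadingCoeff_eq_zero] at h4
    rw [h4, natDegree_zero] at hi₀
    omega

theorem denom_eq_mul {B : Finset ℂ} {b : ℂ} (hb : b ∈ B) (x : ℂ) :
    (denom B).eval x = (x - b) * (denom (B.erase b)).eval x := by
  rw [denom, ← Finset.mul_prod_erase _ _ hb, denom]; simp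

theorem reg_mul_denom_isBigO {a : ℂ → Fin n → ℂ} (ha : a ∈ S.Reg) {b : ℂ} (hb : b ∈ S.B) :
    ∃ k : ℕ, ∀ b' ∈ S.B, b' ≠ b → ∀ j,
      (fun x => a x j * (denom (S.B.erase b)).eval x ^ k) =O[𝓝[≠] b'] fun _ => (1 : ℝ) := by
  obtain ⟨k, g, hg⟩ := ha
  refine ⟨k, fun b' hb' hne j => ?_⟩
  have h1 : Tendsto (fun x => ((x - b) ^ k)⁻¹) (𝓝[≠] b') (𝓝 ((b' - b) ^ k)⁻¹) := by
    refine Tendsto.mono_left ?_ nhdsWithin_le_nhds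
    exact ((((continuous_id.sub continuous_const).pow k).tendsto b')).inv₀
      (pow_ne_zero _ (sub_ne_zero.2 hne))
  have h2 := ((S.evalEval_mem_Lam g).2 b' hb' j).mul (h1.isBigO_one ℝ)
  simp only [mul_one] at h2
  refine h2.congr' ?_ EventuallyEq.rfl
  filter_upwards [eventually_notMem_nhdsNE S.B b'] with x hx
  have h3 : x - b ≠ 0 := by rw [sub_ne_zero]; rintro rfl; exact hx hb
  rw [← hg x hx, denom_eq_mul hb, mul_pow]
  field_simp

theorem IsMin.dual_mem_Lam {S : Branches n} {w e} (h : S.IsMin w e) (i : Fin n) :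
    dual w i ∈ S.Lam := by
  refine ⟨h.dual_mem i, fun b hb => ?_⟩
  set a := dual w i with ha
  have hord : ∀ m, 1 ≤ m → m ≤ n → HasOrd (𝓝[≠] b) (fun x => x - b) fun x => ∑ j, a x j ^ m :=
    fun m _ _ => hasOrd_nhdsNE_of_rat (S.tr_mem (pow_mem (h.dual_mem i) m)) b
  have hπ0 : ∀ᶠ x in 𝓝[≠] b, x - b ≠ 0 := by
    filter_upwards [self_mem_nhdsWithin] with x hx
    exact sub_ne_zero.2 hx
  have hπ := tendsto_sub_nhdsNE b
  rcases exists_dominant_powerSum (U := a) hπ hπ0 hord with h0 | ⟨m, N, c, hm, -, hc, hlim, hO⟩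
  · intro j
    refine (isBigO_zero (fun _ => (1 : ℝ)) (𝓝[≠] b) (E' := ℂ)).congr' ?_ EventuallyEq.rfl
    filter_upwards [h0] with x hx
    exact (hx j).symm
  rcases le_or_gt N 0 with hN | hN
  · intro j
    refine isBigO_one_of_pow (by omega : m ≠ 0) ?_
    obtain ⟨M, hM⟩ := Int.eq_ofNat_of_zero_le (neg_nonneg.2 hN)
    have h1 := (hO j).mul ((hπ.pow M).isBigO_one ℝ)
    simp only [mul_one] at h1
    refine h1.congr' ?_ EventuallyEq.rfl
    filter_upwards [hπ0] with x hx
    rw [mul_assoc, ← zpow_natCast (x - b) M, ← zpow_add₀ hx, ← hM]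
    simp
  exfalso
  obtain ⟨N', hN'⟩ := Int.eq_ofNat_of_zero_le (show 0 ≤ N - 1 by omega)
  obtain rfl : N = ((N' + 1 : ℕ) : ℤ) := by push_cast; omega
  simp only [zpow_natCast] at hlim hO
  obtain ⟨m', rfl⟩ : ∃ m', m = m' + 1 := ⟨m - 1, by omega⟩
  obtain ⟨k, hk⟩ := S.reg_mul_denom_isBigO (h.dual_mem i) hb
  set E := denom (S.B.erase b) with hE
  set u : ℂ → Fin n → ℂ := (a * fun x _ => (E ^ k).eval x) ^ m' *
    fun x _ => ((X - C b) ^ N').eval x with hu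
  have huW : u ∈ S.W := by
    refine ⟨mul_mem (pow_mem (mul_mem (h.dual_mem i) (S.poly_mem _)) _) (S.poly_mem _),
      fun b' hb' j => ?_⟩
    by_cases hbb : b' = b
    · subst hbb
      have h1 : Tendsto (fun x => a x j ^ m' * (x - b') ^ (N' + 1)) (𝓝[≠] b') (𝓝 0) := by
        refine tendsto_zero_of_pow (m := m' + 1) ?_
        have h2 : (fun x => (x - b') ^ (N' + 1)) =o[𝓝[≠] b'] fun _ => (1 : ℝ) :=
          (isLittleO_one_iff ℝ).2 (by simpa using hπ.pow (N' + 1))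
        have h3 := ((hO j).pow m').mul_isLittleO h2
        simp only [one_pow, mul_one] at h3
        refine ((isLittleO_one_iff ℝ).1 h3).congr fun x => ?_
        generalize x - b' = z
        ring
      have h4 := (((E ^ (k * m')).continuous.tendsto b').mono_left nhdsWithin_le_nhds).mul h1
      rw [mul_zero] at h4
      refine h4.congr fun x => ?_
      simp only [hu, Pi.mul_apply, Pi.pow_apply, eval_pow, eval_sub, eval_X, eval_C]
      ring
    · have h1 : (fun x => u x j) =O[𝓝[≠] b'] fun _ => (1 : ℝ) := by
        have h2 := ((hk b' hb' hbb j).pow m').mul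
          (((((X - C b) ^ N' : ℂ[X]).continuous.tendsto b').mono_left
            nhdsWithin_le_nhds).isBigO_one ℝ (l := 𝓝[≠] b'))
        simp only [one_pow, mul_one] at h2
        refine h2.congr_left fun x => ?_
        simp [hu, ha]
      have h2 := h1.mul_isLittleO ((isLittleO_one_iff ℝ).2 (tendsto_sub_nhdsNE b'))
      simp only [mul_one] at h2
      exact (isLittleO_one_iff ℝ).1 h2
  obtain ⟨q, hq⟩ := h.exists_coeff huW
  have h1 : Tendsto (fun x => tr (u * a) x * (x - b)) (𝓝[≠] b) (𝓝 0) := by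
    have h2 := ((((q i).continuous.tendsto b).mono_left nhdsWithin_le_nhds).mul hπ)
    rw [mul_zero] at h2
    refine h2.congr' ?_
    filter_upwards [eventually_notMem_nhdsNE S.B b] with x hx
    rw [hq i x hx]
  have h3 : Tendsto (fun x => tr (u * a) x * (x - b)) (𝓝[≠] b)
      (𝓝 ((E ^ (k * m')).eval b * c)) := by
    refine ((((E ^ (k * m')).continuous.tendsto b).mono_left nhdsWithin_le_nhds).mul
      hlim).congr fun x => ?_
    simp only [tr, Finset.sum_mul, Finset.mul_sum]
    refine Finset.sum_congr rfl fun j _ => ?_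
    simp only [hu, Pi.mul_apply, Pi.pow_apply, eval_pow, eval_sub, eval_X, eval_C]
    ring
  have h5 := tendsto_nhds_unique h1 h3
  rw [eval_pow] at h5
  exact mul_ne_zero (pow_ne_zero _ (denom_eval_ne (Finset.notMem_erase b S.B))) hc h5.symm

theorem IsMin.dual_growth {S : Branches n} {w e} (h : S.IsMin w e) (hW : S.NoForms) (i j : Fin n) :
    Tendsto (fun x => dual w i x j * x ^ e i * x⁻¹) (cobounded ℂ) (𝓝 0) := by
  set a := dual w i with ha
  set U : ℂ → Fin n → ℂ := a * fun x _ => (X ^ e i : ℂ[X]).eval x with hU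
  have hUr : U ∈ S.Reg := mul_mem (h.dual_mem i) (S.poly_mem _)
  have hUx : ∀ x j, U x j = a x j * x ^ e i := fun x j => by simp [hU]
  simp_rw [← hUx]
  have hord : ∀ m, 1 ≤ m → m ≤ n → HasOrd (cobounded ℂ) (fun x => x⁻¹) fun x => ∑ j, U x j ^ m :=
    fun m _ _ => hasOrd_cobounded_of_rat (S.tr_mem (pow_mem hUr m))
  have hπ : Tendsto (fun x : ℂ => x⁻¹) (cobounded ℂ) (𝓝 0) := tendsto_inv₀_cobounded
  have hπ0 : ∀ᶠ x : ℂ in cobounded ℂ, x⁻¹ ≠ 0 :=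
    eventually_ne_zero_cobounded.mono fun x hx => inv_ne_zero hx
  rcases exists_dominant_powerSum (U := U) hπ hπ0 hord with h0 | ⟨m, N, c, hm, -, hc, hlim, hO⟩
  · refine tendsto_const_nhds.congr' ?_
    filter_upwards [h0] with x hx
    simp [hx j]
  rcases lt_or_ge N m with hN | hN
  · refine tendsto_zero_of_pow (m := m) ?_
    obtain ⟨M, hM⟩ := Int.eq_ofNat_of_zero_le (show 0 ≤ (m : ℤ) - N - 1 by omega)
    have h1 := (hO j).mul_isLittleO ((isLittleO_one_iff ℝ (f := fun x : ℂ => x⁻¹ ^ (M + 1))).2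
      (by simpa using hπ.pow (M + 1)))
    simp only [mul_one] at h1
    refine ((isLittleO_one_iff ℝ).1 h1).congr' ?_
    filter_upwards [hπ0] with x hx
    have h2 : N + ((M + 1 : ℕ) : ℤ) = m := by push_cast; omega
    rw [mul_pow, mul_assoc, ← zpow_natCast x⁻¹ (M + 1), ← zpow_add₀ hx, h2, zpow_natCast]
  exfalso
  obtain ⟨N', hN'⟩ := Int.eq_ofNat_of_zero_le (show 0 ≤ N - m by omega)
  obtain ⟨m', rfl⟩ : ∃ m', m = m' + 1 := ⟨m - 1, by omega⟩
  obtain rfl : N = ((N' + m' + 1 : ℕ) : ℤ) := by push_cast at *; omega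
  simp only [zpow_natCast] at hlim hO
  have hinv : (fun x : ℂ => (x⁻¹) ^ (N' + m')) ∈ Rat S.B := by
    have := pow_mem (inv_sub_mem_rat S.zero_mem) (N' + m')
    simpa [Pi.pow_def] using this
  set v : ℂ → Fin n → ℂ := U ^ m' * fun x _ => (x⁻¹) ^ (N' + m') with hv
  have h1 := h.tr_mul_dual_isBigO hW (u := v)
    (mul_mem (pow_mem hUr m') (S.const_mem hinv)) (fun j => by
      have : (fun x => v x j) =O[cobounded ℂ]
          fun _ => (1 : ℝ) := by
        refine isBigO_one_of_pow (m := m' + 1) (by omega) ?_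
        have h2 := ((hO j).pow m').mul ((hπ.pow N').isBigO_one ℝ)
        simp only [one_pow, mul_one] at h2
        refine h2.congr_left fun x => ?_
        simp only [hv, Pi.mul_apply, Pi.pow_apply]
        ring
      exact this.trans (isBigO_const_const _ one_ne_zero _)) i
  have h2 := h1.mul (isBigO_refl (fun x : ℂ => x⁻¹) (cobounded ℂ))
  simp only [one_mul] at h2
  have h3 : Tendsto (fun x => (∑ j, U x j ^ (m' + 1)) * x⁻¹ ^ (N' + m' + 1)) (cobounded ℂ)
      (𝓝 0) := by
    refine (h2.trans_tendsto hπ).congr fun x => ?_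
    rw [← ha]
    simp only [tr, Finset.sum_mul]
    refine Finset.sum_congr rfl fun j _ => ?_
    simp only [hv, Pi.mul_apply, Pi.pow_apply]
    rw [pow_succ (U x j), hUx x j]
    ring
  exact hc (tendsto_nhds_unique hlim h3)

theorem IsMin.exponent_eq_zero {S : Branches n} {w e} (h : S.IsMin w e) (hW : S.NoForms)
    (i : Fin n) : e i = 0 := by
  by_contra he
  obtain ⟨d, hd⟩ : ∃ d, e i = d + 1 := ⟨e i - 1, by omega⟩
  have h0 := S.lam_eq_zero (h.dual_mem_Lam i) fun j => by
    have h2 : (fun x : ℂ => (x⁻¹) ^ d) =O[cobounded ℂ] fun _ => (1 : ℝ) :=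
      ((tendsto_inv₀_cobounded (α := ℂ)).pow d).isBigO_one ℝ
    have h3 := ((isLittleO_one_iff ℝ).2 (h.dual_growth hW i j)).mul_isBigO h2
    simp only [mul_one] at h3
    refine ((isLittleO_one_iff ℝ).1 h3).congr' ?_
    filter_upwards [eventually_ne_zero_cobounded] with x hx
    rw [hd, inv_pow]
    field_simp
    ring
  obtain ⟨x, hx⟩ := Infinite.exists_notMem_finset S.B
  have h1 := tr_dual_mul (h.isTuple.det_ne x hx) i i
  simp [tr, h0 x hx] at h1

end Branches

namespace Branches
variable {n : ℕ} (S : Branches n)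

/-- The plane curve as a topological space. -/
abbrev Curve : Type := {z : ℂ × ℂ // S.F.evalEval z.1 z.2 = 0}

/-- Projection of the curve to the first coordinate. -/
def proj (z : S.Curve) : ℂ := z.1.1

theorem continuous_proj : Continuous S.proj := continuous_fst.comp continuous_subtype_val

theorem contDiff_evalEval (g : ℂ[X][X]) : ContDiff ℂ 1 fun z : ℂ × ℂ => g.evalEval z.1 z.2 := by
  have : (fun z : ℂ × ℂ => g.evalEval z.1 z.2) =
      fun z => ∑ i ∈ Finset.range (g.natDegree + 1), (g.coeff i).eval z.1 * z.2 ^ i := by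
    ext z
    rw [← map_evalRingHom_eval, eval_map, eval₂_eq_sum_range]
    simp
  rw [this]
  refine ContDiff.sum fun i _ => ContDiff.mul ?_ (contDiff_snd.pow i)
  simpa [Function.comp_def] using ((g.coeff i).contDiff_aeval (R := ℂ) (𝕜 := ℂ) 1).comp contDiff_fst

theorem continuous_evalEval (g : ℂ[X][X]) : Continuous fun z : ℂ × ℂ => g.evalEval z.1 z.2 :=
  (contDiff_evalEval g).continuous

theorem exists_bound_Y {K : Set ℂ} (hK : IsCompact K) : ∃ M : ℝ, ∀ x ∈ K, ∀ j, ‖S.Y x j‖ ≤ M := by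
  refine hK.induction_on (p := fun s => ∃ M : ℝ, ∀ x ∈ s, ∀ j, ‖S.Y x j‖ ≤ M) ⟨0, by simp⟩
    (fun s t hst ⟨M, hM⟩ => ⟨M, fun x hx => hM x (hst hx)⟩)
    (fun s t ⟨M, hM⟩ ⟨M', hM'⟩ => ⟨max M M', fun x hx j => ?_⟩) fun b _ => ?_
  · rcases hx with hx | hx
    · exact (hM x hx j).trans (le_max_left _ _)
    · exact (hM' x hx j).trans (le_max_right _ _)
  · have h : ∀ j, ∃ M : ℝ, ∀ᶠ x in 𝓝 b, ‖S.Y x j‖ ≤ M := fun j => by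
      obtain ⟨M, hM⟩ := (S.Y_isBigO_one b j).bound
      exact ⟨M, by simpa using hM⟩
    choose M hM using h
    refine ⟨{x | ∀ j, ‖S.Y x j‖ ≤ M j}, mem_nhdsWithin_of_mem_nhds (eventually_all.2 hM),
      ∑ j, |M j|, fun x hx j => ?_⟩
    exact ((hx j).trans (le_abs_self _)).trans
      (Finset.single_le_sum (f := fun j => |M j|) (fun _ _ => abs_nonneg _) (Finset.mem_univ j))

theorem isClosed_curve : IsClosed {z : ℂ × ℂ | S.F.evalEval z.1 z.2 = 0} :=
  isClosed_eq (continuous_evalEval S.F) continuous_const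

theorem isProperMap_proj : IsProperMap S.proj := by
  rw [isProperMap_iff_isCompact_preimage]
  refine ⟨S.continuous_proj, fun K hK => ?_⟩
  obtain ⟨M, hM⟩ := S.exists_bound_Y hK
  have h1 : S.proj ⁻¹' K = Subtype.val ⁻¹' (K ×ˢ Metric.closedBall (0 : ℂ) M) := by
    ext ⟨⟨x, y⟩, hz⟩
    simp only [proj, Set.mem_preimage, Set.mem_prod, Metric.mem_closedBall, dist_zero_right,
      iff_self_and]
    intro hx
    obtain ⟨j, hj⟩ := S.evalEval_eq_zero_iff.1 hz
    exact (congrArg norm hj).trans_le (hM x hx j)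
  rw [h1]
  exact S.isClosed_curve.isClosedEmbedding_subtypeVal.isCompact_preimage
    (hK.prod (isCompact_closedBall _ _))

theorem finite_fiber (x : ℂ) : (S.proj ⁻¹' {x}).Finite := by
  refine Set.Finite.of_finite_image ?_ (f := fun z : S.Curve => z.1) Subtype.val_injective.injOn
  refine (Set.finite_range fun j => (x, S.Y x j)).subset ?_
  rintro _ ⟨⟨⟨x', y⟩, hz⟩, hx, rfl⟩
  obtain rfl : x' = x := hx
  obtain ⟨j, hj⟩ := S.evalEval_eq_zero_iff.1 hz
  exact ⟨j, congrArg (Prod.mk x') hj.symm⟩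

/-- The shear map `(x, y) ↦ (x, F(x, y))`. -/
noncomputable def shear (z : ℂ × ℂ) : ℂ × ℂ := (z.1, S.F.evalEval z.1 z.2)

theorem exists_hasStrictFDerivAt_shear {z : ℂ × ℂ} (hz : S.F.evalEval z.1 z.2 = 0)
    (hB : z.1 ∉ S.B) : ∃ L : (ℂ × ℂ) ≃L[ℂ] (ℂ × ℂ),
      HasStrictFDerivAt S.shear (L : (ℂ × ℂ) →L[ℂ] (ℂ × ℂ)) z := by
  set f' := fderiv ℂ (fun z : ℂ × ℂ => S.F.evalEval z.1 z.2) z with hf'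
  have hf : HasStrictFDerivAt (fun z : ℂ × ℂ => S.F.evalEval z.1 z.2) f' z :=
    (contDiff_evalEval S.F).contDiffAt.hasStrictFDerivAt one_ne_zero
  have hsep : (S.F.map (evalRingHom z.1)).Separable := by
    rw [S.map_eq]
    exact separable_prod_X_sub_C_iff.2 (S.inj _ hB)
  have hβ : f' (0, 1) ≠ 0 := by
    have h1 : HasDerivAt (fun y => (z.1, y)) ((0, 1) : ℂ × ℂ) z.2 :=
      (hasDerivAt_const _ _).prodMk (hasDerivAt_id _)
    have h2 := HasFDerivAt.comp_hasDerivAt z.2 hf.hasFDerivAt h1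
    have h3 := (S.F.map (evalRingHom z.1)).hasDerivAt z.2
    have h4 : (fun z : ℂ × ℂ => S.F.evalEval z.1 z.2) ∘ (fun y => (z.1, y)) =
        fun y => (S.F.map (evalRingHom z.1)).eval y := by
      ext y
      simp [map_evalRingHom_eval]
    rw [h4] at h2
    rw [h2.unique h3]
    have := hsep.eval₂_derivative_ne_zero (RingHom.id ℂ) (x := z.2)
      (by rw [eval₂_id, map_evalRingHom_eval, hz])
    rwa [eval₂_id] at this
  set L₀ : (ℂ × ℂ) →L[ℂ] (ℂ × ℂ) := (ContinuousLinearMap.fst ℂ ℂ ℂ).prod f' with hL₀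
  have hinj : Function.Injective L₀ := by
    rw [injective_iff_map_eq_zero]
    rintro ⟨u, v⟩ h
    simp only [hL₀, ContinuousLinearMap.prod_apply, ContinuousLinearMap.coe_fst',
      Prod.mk_eq_zero] at h
    obtain ⟨rfl, h⟩ := h
    have h1 : ((0 : ℂ), v) = v • ((0 : ℂ), (1 : ℂ)) := by simp
    rw [h1, map_smul, smul_eq_mul, mul_eq_zero, or_iff_left hβ] at h
    simp [h]
  let L : (ℂ × ℂ) ≃L[ℂ] (ℂ × ℂ) :=
    (LinearEquiv.ofInjectiveEndo (L₀ : (ℂ × ℂ) →ₗ[ℂ] (ℂ × ℂ)) hinj).toContinuousLinearEquiv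
  refine ⟨L, ?_⟩
  have hL : (L : (ℂ × ℂ) →L[ℂ] (ℂ × ℂ)) = L₀ := by
    ext <;> rfl
  rw [hL]
  exact hasStrictFDerivAt_fst.prodMk hf

theorem isLocalHomeomorphOn_proj : IsLocalHomeomorphOn S.proj (S.proj ⁻¹' (↑S.B : Set ℂ)ᶜ) := by
  classical
  refine IsLocalHomeomorphOn.mk S.proj _ fun z hz => ?_
  obtain ⟨L, hL⟩ := S.exists_hasStrictFDerivAt_shear z.2 hz
  set P := hL.toOpenPartialHomeomorph S.shear with hP
  have hPc : ∀ z, P z = S.shear z := fun z => rfl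
  have hmem : ∀ x : ℂ, (x, (0 : ℂ)) ∈ P.target →
      (P.symm (x, 0)).1 = x ∧ S.F.evalEval (P.symm (x, 0)).1 (P.symm (x, 0)).2 = 0 := by
    intro x hx
    have h1 := P.right_inv hx
    rw [hPc, shear, Prod.mk.injEq] at h1
    exact h1
  let inv : ℂ → S.Curve := fun x =>
    if h : S.F.evalEval (P.symm (x, 0)).1 (P.symm (x, 0)).2 = 0 then ⟨P.symm (x, 0), h⟩ else z
  have hinv : ∀ x : ℂ, (x, (0 : ℂ)) ∈ P.target → (inv x).1 = P.symm (x, 0) := fun x hx => by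
    simp only [inv, dif_pos (hmem x hx).2]
  have hcurve : ∀ z : S.Curve, P z.1 = (z.1.1, 0) := fun z => by
    rw [hPc, shear, z.2]
  have hcont : ContinuousOn inv {x | (x, (0 : ℂ)) ∈ P.target} := by
    refine Topology.IsInducing.subtypeVal.continuousOn_iff.2 ?_
    have h3 : ContinuousOn (fun x : ℂ => P.symm (x, 0)) {x | (x, (0 : ℂ)) ∈ P.target} :=
      P.continuousOn_symm.comp (by fun_prop) fun x hx => hx
    exact h3.congr fun x hx => hinv x hx
  refine ⟨⟨⟨⟨S.proj, inv, Subtype.val ⁻¹' P.source, {x | (x, (0 : ℂ)) ∈ P.target}, ?_, ?_, ?_, ?_⟩,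
    ?_, ?_⟩, ?_, ?_⟩, ?_, fun _ _ => rfl⟩
  · intro z hz
    have := P.map_source hz
    rwa [hcurve] at this
  · intro x hx
    simp only [Set.mem_preimage, hinv x hx]
    exact P.map_target hx
  · intro z hz
    have h2 : (z.1.1, (0 : ℂ)) ∈ P.target := by
      have := P.map_source hz
      rwa [hcurve] at this
    apply Subtype.ext
    rw [proj, hinv _ h2, ← hcurve z, P.left_inv hz]
  · intro x hx
    rw [proj, hinv x hx, (hmem x hx).1]
  · exact S.continuous_proj.continuousOn
  · exact hcont
  · exact P.open_source.preimage continuous_subtype_val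
  · exact P.open_target.preimage (by fun_prop)
  · exact hL.mem_toOpenPartialHomeomorph_source

theorem isCoveringMapOn_proj : IsCoveringMapOn S.proj (↑S.B : Set ℂ)ᶜ :=
  S.isProperMap_proj.isClosedMap.isCoveringMapOn_of_isLocalHomeomorphOn
    (fun x _ => S.finite_fiber x) S.isLocalHomeomorphOn_proj

/-- A continuous section of the curve is differentiable away from the branch points. -/
theorem differentiableAt_section {s : ℂ → ℂ} {x : ℂ} (hx : x ∉ S.B) (hs : ContinuousAt s x)
    (h : ∀ᶠ x in 𝓝 x, S.F.evalEval x (s x) = 0) : DifferentiableAt ℂ s x := by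
  obtain ⟨L, hL⟩ := S.exists_hasStrictFDerivAt_shear (z := (x, s x)) h.self_of_nhds hx
  set P := hL.toOpenPartialHomeomorph S.shear with hP
  have hPc : ∀ z, P z = S.shear z := fun z => rfl
  have hsrc : (x, s x) ∈ P.source := hL.mem_toOpenPartialHomeomorph_source
  have h1 : ∀ᶠ x' in 𝓝 x, (x', s x') ∈ P.source :=
    (continuousAt_id.prodMk hs).eventually (P.open_source.mem_nhds hsrc)
  have h2 : (fun x' => (P.symm (x', 0)).2) =ᶠ[𝓝 x] s := by
    filter_upwards [h1, h] with x' h1 h3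
    have := P.left_inv h1
    rw [hPc, shear] at this
    simp only [h3] at this
    rw [this]
  refine DifferentiableAt.congr_of_eventuallyEq ?_ h2.symm
  have h3 : DifferentiableAt ℂ P.symm (x, 0) := by
    have h4 : S.shear (x, s x) = (x, 0) := by
      rw [shear]; simp only [h.self_of_nhds]
    have h5 := hL.to_localInverse.hasFDerivAt.differentiableAt
    rw [h4] at h5
    exact h5
  have h6 : DifferentiableAt ℂ (fun x' : ℂ => (x', (0 : ℂ))) x := by fun_prop
  exact (DifferentiableAt.comp x h3 h6).snd

end Branches

namespace Branches
variable {n : ℕ} (S : Branches n)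

theorem exists_section {c : ℂ} {r : ℝ} (h : ∀ x ∈ Metric.ball c r, x ∉ S.B)
    {x₀ y₀ : ℂ} (hx₀ : x₀ ∈ Metric.ball c r) (hy₀ : S.F.evalEval x₀ y₀ = 0) :
    ∃ s : ℂ → ℂ, ContinuousOn s (Metric.ball c r) ∧ s x₀ = y₀ ∧
      (∀ x ∈ Metric.ball c r, S.F.evalEval x (s x) = 0) ∧
      ∀ s' : ℂ → ℂ, ContinuousOn s' (Metric.ball c r) → s' x₀ = y₀ →
        (∀ x ∈ Metric.ball c r, S.F.evalEval x (s' x) = 0) → Set.EqOn s' s (Metric.ball c r) := by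
  classical
  have : ContractibleSpace (Metric.ball c r) := (convex_ball c r).contractibleSpace ⟨x₀, hx₀⟩
  have : LocallyPathConnectedSpace (Metric.ball c r) :=
    Metric.isOpen_ball.locallyPathConnectedSpace
  obtain ⟨G, ⟨hG₀, hG⟩, hu⟩ := S.isCoveringMapOn_proj.existsUnique_continuousMap_lifts
    (⟨Subtype.val, continuous_subtype_val⟩ : C(Metric.ball c r, ℂ))
    (a₀ := ⟨x₀, hx₀⟩) (e₀ := (⟨(x₀, y₀), hy₀⟩ : S.Curve)) rfl (fun a => h a.1 a.2)
  have hGx : ∀ a, (G a).1.1 = a.1 := fun a => congrFun hG a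
  refine ⟨fun x => if hx : x ∈ Metric.ball c r then (G ⟨x, hx⟩).1.2 else 0, ?_, ?_, ?_, ?_⟩
  · rw [continuousOn_iff_continuous_domRestrict]
    have : Continuous fun a => (G a).1.2 :=
      continuous_snd.comp (continuous_subtype_val.comp G.continuous)
    refine this.congr fun a => ?_
    rw [Set.domRestrict_apply, dif_pos a.2]
  · simp only [dif_pos hx₀, hG₀]
  · intro x hx
    simp only [dif_pos hx]
    have := (G ⟨x, hx⟩).2
    rwa [hGx] at this
  · intro s' hs' h0 hF x hx
    simp only [dif_pos hx]
    have := hu ⟨fun a => ⟨(a.1, s' a.1), hF a.1 a.2⟩, by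
      refine Continuous.subtype_mk (continuous_subtype_val.prodMk ?_) _
      exact continuousOn_iff_continuous_domRestrict.1 hs'⟩ ⟨?_, ?_⟩
    · rw [← this]; rfl
    · apply Subtype.ext
      simp only [ContinuousMap.coe_mk, h0]
    · rfl

/-- Over a ball avoiding `B` the curve is the disjoint union of `n` graphs. -/
structure IsSections (c : ℂ) (r : ℝ) (σ : Fin n → ℂ → ℂ) : Prop where
  notMem : ∀ x ∈ Metric.ball c r, x ∉ S.B
  diff : ∀ j, DifferentiableOn ℂ (σ j) (Metric.ball c r)
  perm : ∀ x ∈ Metric.ball c r, ∃ τ : Equiv.Perm (Fin n), ∀ j, σ j x = S.Y x (τ j)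

theorem section_unique {c : ℂ} {r : ℝ} (h : ∀ x ∈ Metric.ball c r, x ∉ S.B) {s s' : ℂ → ℂ}
    (hs : ContinuousOn s (Metric.ball c r)) (hs' : ContinuousOn s' (Metric.ball c r))
    (hF : ∀ x ∈ Metric.ball c r, S.F.evalEval x (s x) = 0)
    (hF' : ∀ x ∈ Metric.ball c r, S.F.evalEval x (s' x) = 0)
    {x₀ : ℂ} (hx₀ : x₀ ∈ Metric.ball c r) (h0 : s x₀ = s' x₀) :
    Set.EqOn s s' (Metric.ball c r) := by
  obtain ⟨t, -, -, -, ht⟩ := S.exists_section h hx₀ (hF x₀ hx₀)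
  exact (ht s hs rfl hF).trans (ht s' hs' h0.symm hF').symm

theorem exists_sections {c : ℂ} {r : ℝ} (hr : 0 < r) (h : ∀ x ∈ Metric.ball c r, x ∉ S.B) :
    ∃ σ, S.IsSections c r σ ∧ ∀ j, σ j c = S.Y c j := by
  choose σ hc h0 hF _ using fun j => S.exists_section h (Metric.mem_ball_self hr) (S.evalEval_Y c j)
  refine ⟨σ, ⟨h, fun j x hx => ?_, fun x hx => ?_⟩, h0⟩
  · have hn := Metric.isOpen_ball.mem_nhds hx
    exact (S.differentiableAt_section (h x hx) ((hc j).continuousAt hn)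
      (by filter_upwards [hn] with x hx using hF j x hx)).differentiableWithinAt
  · choose τ hτ using fun j => S.evalEval_eq_zero_iff.1 (hF j x hx)
    have hinj : Function.Injective τ := by
      intro i j hij
      have h1 : σ i x = σ j x := by rw [hτ, hτ, hij]
      have h2 := S.section_unique h (hc i) (hc j) (hF i) (hF j) hx h1 (Metric.mem_ball_self hr)
      rw [h0, h0] at h2
      exact S.inj c (h c (Metric.mem_ball_self hr)) h2
    exact ⟨Equiv.ofBijective τ (Finite.injective_iff_bijective.1 hinj), hτ⟩

variable {S}

theorem IsSections.evalEval {c r σ} (h : S.IsSections c r σ) {x : ℂ} (hx : x ∈ Metric.ball c r)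
    (j : Fin n) : S.F.evalEval x (σ j x) = 0 := by
  obtain ⟨τ, hτ⟩ := h.perm x hx
  rw [hτ]
  exact S.evalEval_Y x _

theorem IsSections.exists_eq {c r σ} (h : S.IsSections c r σ) {x : ℂ} (hx : x ∈ Metric.ball c r)
    {y : ℂ} (hy : S.F.evalEval x y = 0) : ∃ j, σ j x = y := by
  obtain ⟨τ, hτ⟩ := h.perm x hx
  obtain ⟨j, rfl⟩ := S.evalEval_eq_zero_iff.1 hy
  exact ⟨τ.symm j, by rw [hτ, Equiv.apply_symm_apply]⟩

theorem IsSections.injective {c r σ} (h : S.IsSections c r σ) {x : ℂ} (hx : x ∈ Metric.ball c r) :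
    Function.Injective fun j => σ j x := by
  obtain ⟨τ, hτ⟩ := h.perm x hx
  intro i j hij
  simp only [hτ] at hij
  exact τ.injective (S.inj x (h.notMem x hx) hij)

theorem IsSections.sum_eq {c r σ} (h : S.IsSections c r σ) {x : ℂ} (hx : x ∈ Metric.ball c r)
    (φ : ℂ → ℂ) : ∑ j, φ (σ j x) = ∑ j, φ (S.Y x j) := by
  obtain ⟨τ, hτ⟩ := h.perm x hx
  simp only [hτ]
  exact Equiv.sum_comp τ fun j => φ (S.Y x j)

end Branches

/-- The fibre bundle with discrete fibre glued from functions which differ by locally constant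
functions. -/
def gluingCore {X ι A : Type*} [TopologicalSpace X] [AddCommGroup A] [TopologicalSpace A]
    [DiscreteTopology A] {U : ι → Set X} (hU : ∀ i, IsOpen (U i)) {ix : X → ι}
    (hix : ∀ x, x ∈ U (ix x)) {f : ι → X → A}
    (hf : ∀ i k, ∀ x ∈ U i ∩ U k, ∀ᶠ z in 𝓝 x, f i z - f k z = f i x - f k x) :
    FiberBundleCore ι X A where
  baseSet := U
  isOpen_baseSet := hU
  indexAt := ix
  mem_baseSet_at := hix
  coordChange i k x v := v + (f i x - f k x)
  coordChange_self i x _ v := by simp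
  continuousOn_coordChange i k := by
    rintro ⟨x, v⟩ ⟨hx, -⟩
    have h1 : Tendsto (fun p : X × A => p.2 + (f i x - f k x)) (𝓝 (x, v))
        (𝓝 (v + (f i x - f k x))) :=
      (continuous_snd.add continuous_const).tendsto (x, v)
    have h2 : ∀ᶠ p : X × A in 𝓝 (x, v), p.2 + (f i x - f k x) = p.2 + (f i p.1 - f k p.1) := by
      filter_upwards [continuous_fst.continuousAt.eventually (hf i k x hx)] with p hp
      rw [hp]
    exact (h1.congr' h2).mono_left nhdsWithin_le_nhds
  coordChange_comp i j k x _ v := by abel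

theorem exists_section_of_contractible {X E : Type*} [TopologicalSpace X] [TopologicalSpace E]
    [ContractibleSpace X] [Nonempty E] {p : E → X} (hp : IsCoveringMap p)
    (hs : Function.Surjective p) : ∃ s : C(X, E), ∀ x, p (s x) = x := by
  obtain ⟨x₀, ⟨H⟩⟩ := id_nullhomotopic X
  obtain ⟨e₀, he₀⟩ := hs x₀
  have H0 : ∀ a : X, H.symm.toContinuousMap (0, a) = p ((ContinuousMap.const X e₀) a) := by
    intro a
    simp [he₀]
  set G := hp.liftHomotopy H.symm.toContinuousMap (ContinuousMap.const X e₀) H0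
  refine ⟨⟨fun x => G (1, x), by fun_prop⟩, fun x => ?_⟩
  have := congrFun (hp.liftHomotopy_lifts H.symm.toContinuousMap (ContinuousMap.const X e₀) H0)
    (1, x)
  exact this.trans (by simp)

theorem exists_glue_discrete {X ι A : Type*} [TopologicalSpace X] [ContractibleSpace X]
    [AddCommGroup A] [TopologicalSpace A] [DiscreteTopology A] {U : ι → Set X}
    (hU : ∀ i, IsOpen (U i)) {ix : X → ι} (hix : ∀ x, x ∈ U (ix x)) {f : ι → X → A}
    (hf : ∀ i k, ∀ x ∈ U i ∩ U k, ∀ᶠ z in 𝓝 x, f i z - f k z = f i x - f k x) :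
    ∃ F : X → A, ∀ i, ∀ x ∈ U i, ∀ᶠ z in 𝓝 x, F z - f i z = F x - f i x := by
  set Z := gluingCore hU hix hf with hZ
  have : Nonempty Z.TotalSpace :=
    ⟨⟨(Classical.arbitrary X), (0 : A)⟩⟩
  obtain ⟨s, hs⟩ := exists_section_of_contractible (p := Z.proj)
    (FiberBundle.isCoveringMap (F := A) (E := Z.Fiber)) (fun x => ⟨⟨x, (0 : A)⟩, rfl⟩)
  set v : X → A := fun x => (s x).2 with hv
  have hval : ∀ i x, (Z.localTriv i (s x)).2 = v x + (f (ix x) x - f i x) := by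
    intro i x
    rw [FiberBundleCore.localTriv_apply]
    show v x + (f (ix (s x).1) (s x).1 - f i (s x).1) = _
    have h1 : (s x).1 = x := hs x
    rw [h1]
  refine ⟨fun x => v x + f (ix x) x, fun i x hx => ?_⟩
  have hmem : s x ∈ (Z.localTriv i).source := by
    rw [FiberBundleCore.mem_localTriv_source]
    have h1 : (s x).1 = x := hs x
    rw [h1]
    exact hx
  have hc : ContinuousAt (fun z => (Z.localTriv i (s z)).2) x :=
    continuous_snd.continuousAt.comp
      (((Z.localTriv i).continuousAt hmem).comp s.continuous.continuousAt)
  have h2 : ∀ᶠ z in 𝓝 x, (Z.localTriv i (s z)).2 = (Z.localTriv i (s x)).2 := by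
    have := hc.eventually (show ∀ᶠ a in 𝓝 ((Z.localTriv i (s x)).2),
      a = (Z.localTriv i (s x)).2 by rw [nhds_discrete]; rfl)
    exact this
  filter_upwards [h2] with z hz
  rw [hval, hval] at hz
  simpa [add_sub_assoc] using hz

/-- Local functions differing by locally constant functions glue on a contractible space, up to
locally constant functions. -/
theorem exists_glue {X ι A : Type*} [TopologicalSpace X] [ContractibleSpace X]
    [AddCommGroup A] {U : ι → Set X}
    (hU : ∀ i, IsOpen (U i)) (hix : ∀ x, ∃ i, x ∈ U i) {f : ι → X → A}
    (hf : ∀ i k, ∀ x ∈ U i ∩ U k, ∀ᶠ z in 𝓝 x, f i z - f k z = f i x - f k x) :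
    ∃ F : X → A, ∀ i, ∀ x ∈ U i, ∀ᶠ z in 𝓝 x, F z - f i z = F x - f i x := by
  choose ix hix using hix
  let _ : TopologicalSpace A := ⊥
  have : DiscreteTopology A := ⟨rfl⟩
  exact exists_glue_discrete hU hix hf

theorem exists_limit_of_norm_deriv_le {φ φ' : ℝ → ℂ} {A ε : ℝ} (hε : 0 < ε)
    (hφ : ∀ t ∈ Set.Ioc (0 : ℝ) 1, HasDerivAt φ (φ' t) t)
    (hb : ∀ t ∈ Set.Ioc (0 : ℝ) 1, ‖φ' t‖ ≤ A * t ^ (ε - 1)) :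
    ∃ l, Tendsto φ (𝓝[>] 0) (𝓝 l) ∧ ‖φ 1 - l‖ ≤ A / ε := by
  have key : ∀ s t : ℝ, 0 < s → s ≤ t → t ≤ 1 →
      ‖φ t - φ s‖ ≤ A / ε * t ^ ε - A / ε * s ^ ε := by
    intro s t hs hst ht
    refine image_norm_le_of_norm_deriv_right_le_deriv_boundary' (a := s) (b := t)
      (f := fun u => φ u - φ s) (f' := φ') (B := fun u => A / ε * u ^ ε - A / ε * s ^ ε)
      (B' := fun u => A * u ^ (ε - 1)) ?_ ?_ (by simp) ?_ ?_ ?_ ⟨hst, le_rfl⟩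
    · exact fun u hu => ((hφ u ⟨hs.trans_le hu.1, hu.2.trans ht⟩).continuousAt.sub
        continuousAt_const).continuousWithinAt
    · exact fun u hu => ((hφ u ⟨hs.trans_le hu.1, hu.2.le.trans ht⟩).sub_const _).hasDerivWithinAt
    · exact fun u hu => ((Real.continuousAt_rpow_const u ε (Or.inl (hs.trans_le hu.1).ne')).const_mul
        _ |>.sub continuousAt_const).continuousWithinAt
    · intro u hu
      have := ((Real.hasDerivAt_rpow_const (x := u) (p := ε)
        (Or.inl (hs.trans_le hu.1).ne')).const_mul (A / ε)).sub_const (A / ε * s ^ ε)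
      refine (this.congr_deriv ?_).hasDerivWithinAt
      field_simp
    · exact fun u hu => hb u ⟨hs.trans_le hu.1, hu.2.le.trans ht⟩
  have hA : 0 ≤ A := by simpa using (norm_nonneg _).trans (hb 1 ⟨one_pos, le_rfl⟩)
  have hlim : Tendsto (fun t : ℝ => A / ε * t ^ ε) (𝓝[>] 0) (𝓝 0) := by
    have := ((Real.continuousAt_rpow_const 0 ε (Or.inr hε.le)).const_mul (A / ε)).tendsto
    rw [Real.zero_rpow hε.ne', mul_zero] at this
    exact this.mono_left nhdsWithin_le_nhds
  have hc : Cauchy (map φ (𝓝[>] (0 : ℝ))) := by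
    rw [Metric.cauchy_iff]
    refine ⟨inferInstance, fun δ hδ => ?_⟩
    have h1 : ∀ᶠ t in 𝓝[>] (0 : ℝ), A / ε * t ^ ε < δ ∧ t ∈ Set.Ioc (0 : ℝ) 1 :=
      (hlim.eventually_lt_const hδ).and (Ioc_mem_nhdsGT one_pos)
    refine ⟨φ '' {t | A / ε * t ^ ε < δ ∧ t ∈ Set.Ioc (0 : ℝ) 1}, image_mem_map h1, ?_⟩
    have hpos : ∀ s : ℝ, 0 < s → 0 ≤ A / ε * s ^ ε := fun s hs => by positivity
    rintro _ ⟨t, ht, rfl⟩ _ ⟨s, hs, rfl⟩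
    rcases le_total s t with h | h
    · rw [dist_eq_norm]
      linarith [key s t hs.2.1 h ht.2.2, hpos s hs.2.1, ht.1]
    · rw [dist_comm, dist_eq_norm]
      linarith [key t s ht.2.1 h hs.2.2, hpos t ht.2.1, hs.1]
  obtain ⟨l, hl⟩ := cauchy_map_iff_exists_tendsto.1 hc
  refine ⟨l, hl, ?_⟩
  refine le_of_tendsto ((tendsto_const_nhds.sub hl).norm) ?_
  filter_upwards [Ioc_mem_nhdsGT (one_pos : (0 : ℝ) < 1)] with s hs
  have := key s 1 hs.1 hs.2 le_rfl
  rw [Real.one_rpow, mul_one] at this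
  have : 0 ≤ A / ε * s ^ ε := by have := hs.1; positivity
  linarith

/-- A function on a convex open set whose derivative is `O(|z - c| ^ (ε - 1))` has a limit at the
boundary point `c`. -/
theorem exists_boundary_limit {D : Set ℂ} (hD : IsOpen D) (hconv : Convex ℝ D) {c : ℂ}
    (hc : c ∈ closure D) (hcD : c ∉ D) {G G' : ℂ → ℂ} {K ε : ℝ} (hε : 0 < ε) (hε1 : ε ≤ 1)
    (hK : 0 ≤ K)
    (hG : ∀ z ∈ D, HasDerivAt G (G' z) z) (hb : ∀ z ∈ D, ‖G' z‖ ≤ K * ‖z - c‖ ^ (ε - 1)) :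
    ∃ l, ∀ z ∈ D, ‖G z - l‖ ≤ K / ε * ‖z - c‖ ^ ε := by
  have hray : ∀ z ∈ D, ∀ t ∈ Set.Ioc (0 : ℝ) 1, c + t * (z - c) ∈ D := by
    intro z hz t ht
    rcases ht.2.eq_or_lt with h | h
    · simpa [h] using hz
    · have := hconv.openSegment_interior_closure_subset_interior
        (x := z) (y := c) (by rwa [hD.interior_eq]) hc
      rw [hD.interior_eq] at this
      refine this ⟨t, 1 - t, ht.1, by linarith, by ring, ?_⟩
      simp only [Complex.real_smul]
      push_cast; ring
  have hlim : ∀ z ∈ D, ∃ l, Tendsto (fun t : ℝ => G (c + t * (z - c))) (𝓝[>] 0) (𝓝 l) ∧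
      ‖G z - l‖ ≤ K / ε * ‖z - c‖ ^ ε := by
    intro z hz
    have hzc : 0 < ‖z - c‖ := norm_pos_iff.2 (sub_ne_zero.2 fun h => hcD (h ▸ hz))
    obtain ⟨l, h1, h2⟩ := exists_limit_of_norm_deriv_le (φ := fun t : ℝ => G (c + t * (z - c)))
      (φ' := fun t => G' (c + t * (z - c)) * (z - c)) (A := K * ‖z - c‖ ^ ε) hε (fun t ht => by
        have h1 : HasDerivAt (fun t : ℂ => c + t * (z - c)) (z - c) (t : ℂ) := by
          simpa using ((hasDerivAt_id (t : ℂ)).mul_const (z - c)).const_add c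
        exact ((hG _ (hray z hz t ht)).comp (t : ℂ) h1).comp_ofReal) (fun t ht => by
        have := hb _ (hray z hz t ht)
        rw [norm_mul]
        rw [add_sub_cancel_left, norm_mul, Complex.norm_real, Real.norm_of_nonneg ht.1.le,
          Real.mul_rpow ht.1.le hzc.le] at this
        calc _ ≤ K * (t ^ (ε - 1) * ‖z - c‖ ^ (ε - 1)) * ‖z - c‖ := by gcongr
          _ = K * t ^ (ε - 1) * (‖z - c‖ ^ (ε - 1) * ‖z - c‖) := by ring
          _ = K * t ^ (ε - 1) * ‖z - c‖ ^ ε := by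
            rw [Real.rpow_sub_one hzc.ne', div_mul_cancel₀ _ hzc.ne']
          _ = _ := by ring)
    refine ⟨l, h1, ?_⟩
    simp only [Complex.ofReal_one, one_mul, add_sub_cancel] at h2
    rwa [div_mul_eq_mul_div]
  obtain ⟨z₀, hz₀⟩ : D.Nonempty := closure_nonempty_iff.1 ⟨c, hc⟩
  obtain ⟨l, hl, -⟩ := hlim z₀ hz₀
  refine ⟨l, fun z hz => ?_⟩
  obtain ⟨l', hl', hb'⟩ := hlim z hz
  suffices l' = l by rwa [this] at hb'
  have hseg : segment ℝ z₀ z ⊆ D := hconv.segment_subset hz₀ hz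
  obtain ⟨d, hd, hdist⟩ : ∃ d > 0, ∀ p ∈ segment ℝ z₀ z, d ≤ ‖p - c‖ := by
    have hcomp : IsCompact (segment ℝ z₀ z) := by
      rw [segment_eq_image_lineMap]
      exact isCompact_Icc.image AffineMap.lineMap_continuous
    obtain ⟨p, hp, hmin⟩ := hcomp.exists_isMinOn ⟨z₀, left_mem_segment ℝ z₀ z⟩
      (f := fun p => ‖p - c‖) (by fun_prop)
    exact ⟨‖p - c‖, norm_pos_iff.2 (sub_ne_zero.2 fun h => hcD (h ▸ hseg hp)), fun q hq => hmin hq⟩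
  have hdiff : Tendsto (fun t : ℝ => G (c + t * (z - c)) - G (c + t * (z₀ - c))) (𝓝[>] 0)
      (𝓝 0) := by
    refine squeeze_zero_norm' (a := fun t : ℝ => K * d ^ (ε - 1) * ‖z - z₀‖ * t ^ ε) ?_ ?_
    · filter_upwards [Ioc_mem_nhdsGT (one_pos : (0 : ℝ) < 1)] with t ht
      have hsub : ∀ p ∈ segment ℝ (c + t * (z₀ - c)) (c + t * (z - c)),
          ∃ q ∈ segment ℝ z₀ z, p = c + t * (q - c) := by
        rintro p ⟨a, b, ha, hb, hab, rfl⟩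
        refine ⟨a • z₀ + b • z, ⟨a, b, ha, hb, hab, rfl⟩, ?_⟩
        simp only [Complex.real_smul]
        have : (a : ℂ) = 1 - b := by rw [← Complex.ofReal_one, ← hab]; push_cast; ring
        rw [this]; ring
      have := Convex.norm_image_sub_le_of_norm_hasDerivWithin_le (f := G) (f' := G')
        (s := segment ℝ (c + t * (z₀ - c)) (c + t * (z - c))) (C := K * (t * d) ^ (ε - 1))
        (x := c + t * (z₀ - c)) (y := c + t * (z - c))
        (fun p hp => by
          obtain ⟨q, hq, rfl⟩ := hsub p hp
          exact (hG _ (hray q (hseg hq) t ht)).hasDerivWithinAt)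
        (fun p hp => by
          obtain ⟨q, hq, rfl⟩ := hsub p hp
          refine (hb _ (hray q (hseg hq) t ht)).trans ?_
          refine mul_le_mul_of_nonneg_left ?_ hK
          refine Real.rpow_le_rpow_of_nonpos (mul_pos ht.1 hd) ?_ (by linarith)
          rw [add_sub_cancel_left, norm_mul, Complex.norm_real, Real.norm_of_nonneg ht.1.le]
          exact mul_le_mul_of_nonneg_left (hdist q hq) ht.1.le)
        (convex_segment _ _) (left_mem_segment _ _ _) (right_mem_segment _ _ _)
      refine this.trans_eq ?_
      rw [show c + t * (z - c) - (c + t * (z₀ - c)) = t * (z - z₀) by ring, norm_mul,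
        Complex.norm_real, Real.norm_of_nonneg ht.1.le, Real.mul_rpow ht.1.le hd.le,
        Real.rpow_sub_one ht.1.ne']
      have := ht.1.ne'
      field_simp
    · have := ((Real.continuousAt_rpow_const 0 ε (Or.inr hε.le)).const_mul
        (K * d ^ (ε - 1) * ‖z - z₀‖)).tendsto
      rw [Real.zero_rpow hε.ne', mul_zero] at this
      exact this.mono_left nhdsWithin_le_nhds
  exact sub_eq_zero.1 (tendsto_nhds_unique (hl'.sub hl) hdiff)

theorem boundary_limit_unique {D : Set ℂ} {c : ℂ} (hc : c ∈ closure D) {G : ℂ → ℂ} {K ε : ℝ}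
    (hε : 0 < ε) {l l' : ℂ}
    (h : ∀ z ∈ D, ‖G z - l‖ ≤ K * ‖z - c‖ ^ ε) (h' : ∀ z ∈ D, ‖G z - l'‖ ≤ K * ‖z - c‖ ^ ε) :
    l = l' := by
  have hne : (𝓝[D] c).NeBot := mem_closure_iff_nhdsWithin_neBot.1 hc
  have hlim : Tendsto (fun z => K * ‖z - c‖ ^ ε) (𝓝[D] c) (𝓝 0) := by
    have h1 : ContinuousAt (fun z : ℂ => K * ‖z - c‖ ^ ε) c := by
      refine ContinuousAt.const_mul (ContinuousAt.rpow_const (by fun_prop) (Or.inr hε.le)) K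
    have := h1.tendsto
    rw [sub_self, norm_zero, Real.zero_rpow hε.ne', mul_zero] at this
    exact this.mono_left nhdsWithin_le_nhds
  have hl : ∀ l, (∀ z ∈ D, ‖G z - l‖ ≤ K * ‖z - c‖ ^ ε) → Tendsto G (𝓝[D] c) (𝓝 l) := by
    intro l h
    rw [tendsto_iff_norm_sub_tendsto_zero]
    exact squeeze_zero' (Eventually.of_forall fun _ => norm_nonneg _)
      (by filter_upwards [self_mem_nhdsWithin] with z hz using h z hz) hlim
  exact tendsto_nhds_unique (hl l h) (hl l' h')

namespace Branches
variable {n : ℕ} (S : Branches n)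

/-- `s` is a continuous section of the curve near `x`. -/
def Germ (s : ℂ → ℂ) (x : ℂ) : Prop :=
  ∀ᶠ x' in 𝓝 x, ContinuousAt s x' ∧ S.F.evalEval x' (s x') = 0

/-- On `V`, the derivative of `f` along the curve is `ω` at all unbranched points. -/
def IsPrim (ω f : ℂ → ℂ → ℂ) (V : Set ℂ) : Prop :=
  ∀ x ∈ V, x ∉ S.B → ∀ s, S.Germ s x → HasDerivAt (fun x' => f x' (s x')) (ω x (s x)) x

variable {S}

theorem Germ.eventually {s : ℂ → ℂ} {x : ℂ} (h : S.Germ s x) : ∀ᶠ x' in 𝓝 x, S.Germ s x' :=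
  eventually_eventually_nhds.2 h

theorem germ_of_continuousOn {s : ℂ → ℂ} {V : Set ℂ} (hV : IsOpen V) (hs : ContinuousOn s V)
    (hF : ∀ x ∈ V, S.F.evalEval x (s x) = 0) {x : ℂ} (hx : x ∈ V) : S.Germ s x := by
  filter_upwards [hV.mem_nhds hx] with x' hx'
  exact ⟨hs.continuousAt (hV.mem_nhds hx'), hF x' hx'⟩

theorem IsSections.continuousOn {c r σ} (h : S.IsSections c r σ) (j : Fin n) :
    ContinuousOn (σ j) (Metric.ball c r) := (h.diff j).continuousOn

theorem IsSections.germ {c r σ} (h : S.IsSections c r σ) {x : ℂ} (hx : x ∈ Metric.ball c r)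
    (j : Fin n) : S.Germ (σ j) x :=
  germ_of_continuousOn Metric.isOpen_ball (h.continuousOn j) (fun _ hx => h.evalEval hx j) hx

variable (S)

theorem exists_ball_notMem {x : ℂ} (hx : x ∉ S.B) :
    ∀ᶠ r in 𝓝[>] (0 : ℝ), ∀ x' ∈ Metric.ball x r, x' ∉ S.B := by
  have h : (↑S.B : Set ℂ)ᶜ ∈ 𝓝 x := S.B.finite_toSet.isClosed.isOpen_compl.mem_nhds (by simpa)
  obtain ⟨R, hR, hb⟩ := Metric.mem_nhds_iff.1 h
  filter_upwards [Ioc_mem_nhdsGT hR] with r hr x' hx'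
  simpa using hb (Metric.ball_subset_ball hr.2 hx')

theorem germ_eq {s s' : ℂ → ℂ} {x : ℂ} (hx : x ∉ S.B) (h : S.Germ s x) (h' : S.Germ s' x)
    (e : s x = s' x) : s =ᶠ[𝓝 x] s' := by
  obtain ⟨R, hR, hb⟩ := Metric.eventually_nhds_iff_ball.1 (h.and h')
  obtain ⟨r, h1, hr⟩ := ((S.exists_ball_notMem hx).and (Ioc_mem_nhdsGT hR)).exists
  have hsub := Metric.ball_subset_ball (x := x) hr.2
  have := S.section_unique (s := s) (s' := s') h1
    (fun z hz => (hb z (hsub hz)).1.1.continuousWithinAt)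
    (fun z hz => (hb z (hsub hz)).2.1.continuousWithinAt)
    (fun z hz => (hb z (hsub hz)).1.2) (fun z hz => (hb z (hsub hz)).2.2)
    (Metric.mem_ball_self hr.1) e
  exact this.eventuallyEq_of_mem (Metric.ball_mem_nhds x hr.1)

theorem exists_germ {x y : ℂ} (hx : x ∉ S.B) (hy : S.F.evalEval x y = 0) :
    ∃ s, S.Germ s x ∧ s x = y := by
  obtain ⟨r, h1, hr⟩ := ((S.exists_ball_notMem hx).and self_mem_nhdsWithin).exists
  obtain ⟨s, hs, h0, hF, -⟩ := S.exists_section h1 (Metric.mem_ball_self hr) hy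
  exact ⟨s, germ_of_continuousOn Metric.isOpen_ball hs hF (Metric.mem_ball_self hr), h0⟩

theorem germ_differentiableAt {s : ℂ → ℂ} {x : ℂ} (hx : x ∉ S.B) (h : S.Germ s x) :
    DifferentiableAt ℂ s x :=
  S.differentiableAt_section hx h.self_of_nhds.1 (h.mono fun _ h => h.2)

theorem curve_eventually_eq {s : ℂ → ℂ} (z₀ : S.Curve) (hx : z₀.1.1 ∉ S.B) (h : S.Germ s z₀.1.1)
    (e : s z₀.1.1 = z₀.1.2) : ∀ᶠ z : S.Curve in 𝓝 z₀, z.1.2 = s z.1.1 := by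
  obtain ⟨r, h1, hr⟩ := ((S.exists_ball_notMem hx).and self_mem_nhdsWithin).exists
  obtain ⟨σ, hσ, h0⟩ := S.exists_sections hr h1
  obtain ⟨j₀, hj₀⟩ := hσ.exists_eq (Metric.mem_ball_self hr) z₀.2
  have hfst : Tendsto (fun z : S.Curve => z.1.1) (𝓝 z₀) (𝓝 z₀.1.1) :=
    S.continuous_proj.tendsto z₀
  have hsnd : Tendsto (fun z : S.Curve => z.1.2) (𝓝 z₀) (𝓝 z₀.1.2) :=
    (continuous_snd.comp continuous_subtype_val).tendsto z₀
  have hne : ∀ᶠ z : S.Curve in 𝓝 z₀, ∀ j, j ≠ j₀ → z.1.2 ≠ σ j z.1.1 := by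
    rw [eventually_all]
    intro j
    by_cases hj : j = j₀
    · simp [hj]
    · have hc : Tendsto (fun z : S.Curve => z.1.2 - σ j z.1.1) (𝓝 z₀)
          (𝓝 (z₀.1.2 - σ j z₀.1.1)) :=
        hsnd.sub (((hσ.continuousOn j).continuousAt (Metric.ball_mem_nhds _ hr)).tendsto.comp hfst)
      have : z₀.1.2 - σ j z₀.1.1 ≠ 0 := by
        rw [sub_ne_zero, ← hj₀]
        exact fun h => hj (hσ.injective (Metric.mem_ball_self hr) h).symm
      filter_upwards [hc.eventually_ne this] with z hz _
      exact sub_ne_zero.1 hz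
  have heq := S.germ_eq hx h (hσ.germ (Metric.mem_ball_self hr) j₀) (e.trans hj₀.symm)
  filter_upwards [hne, hfst.eventually heq, hfst.eventually (Metric.ball_mem_nhds _ hr)] with
    z h1 h2 h3
  obtain ⟨j, hj⟩ := hσ.exists_eq h3 z.2
  by_cases hjj : j = j₀
  · rw [h2, ← hj, hjj]
  · exact (h1 j hjj hj.symm).elim

variable {S}

theorem IsPrim.eventually_sub_eq {ω f f' : ℂ → ℂ → ℂ} {V : Set ℂ} (hV : IsOpen V)
    (h : S.IsPrim ω f V) (h' : S.IsPrim ω f' V) (z₀ : S.Curve) (hx : z₀.1.1 ∉ S.B)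
    (hz : z₀.1.1 ∈ V) :
    ∀ᶠ z : S.Curve in 𝓝 z₀, f z.1.1 z.1.2 - f' z.1.1 z.1.2 =
      f z₀.1.1 z₀.1.2 - f' z₀.1.1 z₀.1.2 := by
  obtain ⟨s, hs, e⟩ := S.exists_germ hx z₀.2
  obtain ⟨R, hR, hb⟩ := Metric.eventually_nhds_iff_ball.1 (hs.eventually.and (hV.mem_nhds hz))
  obtain ⟨r, h1, hr⟩ := ((S.exists_ball_notMem hx).and (Ioc_mem_nhdsGT hR)).exists
  have hsub := Metric.ball_subset_ball (x := z₀.1.1) hr.2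
  have hd : ∀ x ∈ Metric.ball z₀.1.1 r,
      HasDerivAt (fun x => f x (s x) - f' x (s x)) 0 x := fun x hx => by
    have := (h x (hb x (hsub hx)).2 (h1 x hx) s (hb x (hsub hx)).1).sub
      (h' x (hb x (hsub hx)).2 (h1 x hx) s (hb x (hsub hx)).1)
    rwa [sub_self] at this
  have hconst : ∀ x ∈ Metric.ball z₀.1.1 r, f x (s x) - f' x (s x) =
      f z₀.1.1 (s z₀.1.1) - f' z₀.1.1 (s z₀.1.1) := fun x hx =>
    Metric.isOpen_ball.is_const_of_deriv_eq_zero (convex_ball _ _).isPreconnected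
      (fun x hx => (hd x hx).differentiableAt.differentiableWithinAt)
      (fun x hx => (hd x hx).deriv) hx (Metric.mem_ball_self hr.1)
  have hfst : Tendsto (fun z : S.Curve => z.1.1) (𝓝 z₀) (𝓝 z₀.1.1) :=
    S.continuous_proj.tendsto z₀
  filter_upwards [S.curve_eventually_eq z₀ hx hs e,
    hfst.eventually (Metric.ball_mem_nhds _ hr.1)] with z h1 h2
  rw [h1, hconst _ h2, e]

theorem IsPrim.continuousAt {ω f : ℂ → ℂ → ℂ} {V : Set ℂ}
    (h : S.IsPrim ω f V) (z₀ : S.Curve) (hx : z₀.1.1 ∉ S.B) (hz : z₀.1.1 ∈ V) :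
    ContinuousAt (fun z : S.Curve => f z.1.1 z.1.2) z₀ := by
  obtain ⟨s, hs, e⟩ := S.exists_germ hx z₀.2
  have h1 : ContinuousAt (fun z : S.Curve => f z.1.1 (s z.1.1)) z₀ :=
    ContinuousAt.comp (f := fun z : S.Curve => z.1.1) (x := z₀) (g := fun x => f x (s x))
      (h _ hz hx s hs).continuousAt S.continuous_proj.continuousAt
  refine h1.congr ?_
  filter_upwards [S.curve_eventually_eq z₀ hx hs e] with z hz
  rw [hz]

theorem IsPrim.mono {ω f : ℂ → ℂ → ℂ} {V V' : Set ℂ} (h : S.IsPrim ω f V) (hV : V' ⊆ V) :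
    S.IsPrim ω f V' := fun x hx => h x (hV hx)

variable (S)

/-- `ω` is holomorphic along the curve away from the branch points. -/
def IsHol (ω : ℂ → ℂ → ℂ) : Prop :=
  ∀ x ∉ S.B, ∀ s, S.Germ s x → DifferentiableAt ℂ (fun x' => ω x' (s x')) x

theorem exists_prim_ball {ω : ℂ → ℂ → ℂ} (hω : S.IsHol ω) {c : ℂ} {r : ℝ}
    (hr : 0 < r) (hB : ∀ x ∈ Metric.ball c r, x ∉ S.B) :
    ∃ f, S.IsPrim ω f (Metric.ball c r) := by
  classical
  obtain ⟨σ, hσ, -⟩ := S.exists_sections hr hB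
  have hex : ∀ j, Complex.IsExactOn (fun x => ω x (σ j x)) (Metric.ball c r) := fun j =>
    DifferentiableOn.isExactOn_ball fun x hx =>
      (hω x (hB x hx) (σ j) (hσ.germ hx j)).differentiableWithinAt
  choose G hG using hex
  refine ⟨fun x y => ∑ j, if σ j x = y then G j x else 0, fun x hx _ s hs => ?_⟩
  obtain ⟨j, hj⟩ := hσ.exists_eq hx hs.self_of_nhds.2
  have heq := S.germ_eq (hB x hx) (hσ.germ hx j) hs hj
  have := hG j x hx
  simp only [hj] at this
  refine this.congr_of_eventuallyEq ?_
  filter_upwards [heq, Metric.isOpen_ball.mem_nhds hx] with x' hx' hxb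
  rw [Finset.sum_eq_single j, if_pos hx']
  · intro i _ hij
    rw [if_neg]
    intro h
    exact hij (hσ.injective hxb (h.trans hx'.symm))
  · simp

end Branches

namespace Branches
variable {n : ℕ} (S : Branches n)

theorem section_eqOn {V : Set ℂ} (hV : IsOpen V) (hc : IsPreconnected V)
    (hB : ∀ x ∈ V, x ∉ S.B) {s s' : ℂ → ℂ}
    (hs : ContinuousOn s V) (hs' : ContinuousOn s' V)
    (hF : ∀ x ∈ V, S.F.evalEval x (s x) = 0) (hF' : ∀ x ∈ V, S.F.evalEval x (s' x) = 0)
    {x₀ : ℂ} (hx₀ : x₀ ∈ V) (h0 : s x₀ = s' x₀) : Set.EqOn s s' V := by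
  have hu : IsOpen {x | x ∈ V ∧ s x = s' x} := by
    rw [isOpen_iff_mem_nhds]
    rintro x ⟨hx, he⟩
    filter_upwards [hV.mem_nhds hx, S.germ_eq (hB x hx) (germ_of_continuousOn hV hs hF hx)
      (germ_of_continuousOn hV hs' hF' hx) he] with z h1 h2 using ⟨h1, h2⟩
  have hv : IsOpen {x | x ∈ V ∧ s x - s' x ≠ 0} :=
    (hs.sub hs').isOpen_inter_preimage hV isOpen_ne
  have := hc.subset_left_of_subset_union hu hv
    (Set.disjoint_left.2 fun x h1 h2 => h2.2 (sub_eq_zero.2 h1.2))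
    (fun x hx => by
      by_cases h : s x = s' x
      · exact Or.inl ⟨hx, h⟩
      · exact Or.inr ⟨hx, sub_ne_zero.2 h⟩)
    ⟨x₀, hx₀, hx₀, h0⟩
  exact fun x hx => (this hx).2

theorem exists_prim_branch {ω : ℂ → ℂ → ℂ} (hω : S.IsHol ω) {b : ℂ} (hbB : b ∈ S.B) {R K ε : ℝ}
    (hε : 0 < ε) (hε1 : ε ≤ 1) (hK : 0 ≤ K)
    (hB : ∀ x ∈ Metric.ball b (2 * R), x ≠ b → x ∉ S.B)
    (hb : ∀ x ∈ Metric.ball b (2 * R), x ≠ b → ∀ y, S.F.evalEval x y = 0 →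
      ‖ω x y‖ ≤ K * ‖x - b‖ ^ (ε - 1)) :
    ∃ f, S.IsPrim ω f (Metric.ball b R) ∧
      ∀ x ∈ Metric.ball b R, ∀ y, S.F.evalEval x y = 0 → ‖f x y‖ ≤ K / ε * ‖x - b‖ ^ ε := by
  classical
  set D : ℂ → Set ℂ := fun x => Metric.ball x ‖x - b‖ with hD
  have hbD : ∀ x, b ∉ D x := fun x h => by
    rw [hD, Metric.mem_ball, dist_comm, dist_eq_norm] at h
    exact lt_irrefl _ h
  have hDsub : ∀ x ∈ Metric.ball b R, ∀ z ∈ D x, z ∈ Metric.ball b (2 * R) ∧ z ≠ b := by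
    intro x hx z hz
    refine ⟨?_, fun h => hbD x (h ▸ hz)⟩
    rw [Metric.mem_ball] at hx ⊢
    rw [hD, Metric.mem_ball, ← dist_eq_norm] at hz
    linarith [dist_triangle z x b]
  have hDB : ∀ x ∈ Metric.ball b R, ∀ z ∈ D x, z ∉ S.B := fun x hx z hz =>
    hB z (hDsub x hx z hz).1 (hDsub x hx z hz).2
  have hmem : ∀ x, x ≠ b → x ∈ D x := fun x hx =>
    Metric.mem_ball_self (norm_pos_iff.2 (sub_ne_zero.2 hx))
  have hclD : ∀ x, x ≠ b → b ∈ closure (D x) := fun x hx => by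
    rw [hD, closure_ball x (norm_ne_zero_iff.2 (sub_ne_zero.2 hx)), Metric.mem_closedBall,
      dist_comm, dist_eq_norm]
  have hex : ∀ x y, ∃ (s G : ℂ → ℂ) (l : ℂ), x ∈ Metric.ball b R → x ≠ b →
      S.F.evalEval x y = 0 → s x = y ∧ ContinuousOn s (D x) ∧
        (∀ z ∈ D x, S.F.evalEval z (s z) = 0) ∧
        (∀ z ∈ D x, HasDerivAt G (ω z (s z)) z) ∧
        ∀ z ∈ D x, ‖G z - l‖ ≤ K / ε * ‖z - b‖ ^ ε := by
    intro x y
    by_cases h : x ∈ Metric.ball b R ∧ x ≠ b ∧ S.F.evalEval x y = 0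
    · obtain ⟨h1, h2, h3⟩ := h
      obtain ⟨s, hs, h0, hF, -⟩ := S.exists_section (hDB x h1) (hmem x h2) h3
      obtain ⟨G, hG⟩ : Complex.IsExactOn (fun z => ω z (s z)) (D x) :=
        DifferentiableOn.isExactOn_ball fun z hz => (hω z (hDB x h1 z hz) s
          (germ_of_continuousOn Metric.isOpen_ball hs hF hz)).differentiableWithinAt
      obtain ⟨l, hl⟩ := exists_boundary_limit Metric.isOpen_ball (convex_ball _ _) (hclD x h2)
        (hbD x) hε hε1 hK hG
        (fun z hz => hb z (hDsub x h1 z hz).1 (hDsub x h1 z hz).2 _ (hF z hz))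
      exact ⟨s, G, l, fun _ _ _ => ⟨h0, hs, hF, hG, hl⟩⟩
    · exact ⟨0, 0, 0, fun h1 h2 h3 => (h ⟨h1, h2, h3⟩).elim⟩
  choose s G l hsG using hex
  refine ⟨fun x y => if x = b then 0 else G x y x - l x y, ?_, ?_⟩
  · intro x hx hxB σ hσ
    have hFx := hσ.self_of_nhds.2
    have hxb : x ≠ b := fun h => hxB (h ▸ hbB)
    obtain ⟨h0, hs, hF, hG, hl⟩ := hsG x (σ x) hx hxb hFx
    have heq := S.germ_eq hxB hσ (germ_of_continuousOn Metric.isOpen_ball hs hF (hmem x hxb)) h0.symm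
    have hder := (hG x (hmem x hxb)).sub_const (l x (σ x))
    rw [h0] at hder
    refine hder.congr_of_eventuallyEq ?_
    filter_upwards [heq, Metric.isOpen_ball.mem_nhds hx, Metric.isOpen_ball.mem_nhds (hmem x hxb)]
      with x' h1 h2 h3
    have hx'b : x' ≠ b := (hDsub x hx x' h3).2
    rw [if_neg hx'b, h1]
    obtain ⟨h0', hs', hF', hG', hl'⟩ := hsG x' (s x (σ x) x') h2 hx'b (hF x' h3)
    have hV : IsOpen (D x ∩ D x') := Metric.isOpen_ball.inter Metric.isOpen_ball
    have hVc : Convex ℝ (D x ∩ D x') := (convex_ball _ _).inter (convex_ball _ _)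
    have hmV : x' ∈ D x ∩ D x' := ⟨h3, hmem x' hx'b⟩
    have hss := S.section_eqOn hV hVc.isPreconnected (fun z hz => hDB x hx z hz.1)
      (hs.mono Set.inter_subset_left) (hs'.mono Set.inter_subset_right)
      (fun z hz => hF z hz.1) (fun z hz => hF' z hz.2) hmV h0'.symm
    set G₁ := G x' (s x (σ x) x')
    have hd : ∀ z ∈ D x ∩ D x', HasDerivAt (fun z => G₁ z - G x (σ x) z) 0 z := fun z hz => by
      have := (hG' z hz.2).sub (hG z hz.1)
      rwa [hss hz, sub_self] at this
    have hconst : ∀ z ∈ D x ∩ D x', G₁ z - G x (σ x) z = G₁ x' - G x (σ x) x' := fun z hz =>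
      hV.is_const_of_deriv_eq_zero hVc.isPreconnected
        (fun z hz => (hd z hz).differentiableAt.differentiableWithinAt)
        (fun z hz => (hd z hz).deriv) hz hmV
    have hclV : b ∈ closure (D x ∩ D x') := by
      have hseg : openSegment ℝ x' b ⊆ D x ∩ D x' := by
        have h1 := (convex_ball x ‖x - b‖).openSegment_interior_closure_subset_interior
          (x := x') (y := b) (by rwa [Metric.isOpen_ball.interior_eq]) (hclD x hxb)
        have h2 := (convex_ball x' ‖x' - b‖).openSegment_interior_closure_subset_interior
          (x := x') (y := b) (by rw [Metric.isOpen_ball.interior_eq]; exact hmem x' hx'b)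
          (hclD x' hx'b)
        rw [Metric.isOpen_ball.interior_eq] at h1 h2
        exact Set.subset_inter h1 h2
      refine closure_mono hseg ?_
      rw [closure_openSegment]
      exact right_mem_segment ℝ x' b
    have hll := boundary_limit_unique hclV hε (G := G₁) (K := K / ε) (l := l x' (s x (σ x) x'))
      (l' := l x (σ x) + (G₁ x' - G x (σ x) x')) (fun z hz => hl' z hz.2) (fun z hz => by
        have := hl z hz.1
        rw [← hconst z hz]
        convert this using 2
        ring)
    rw [hll]; ring
  · intro x hx y hy
    beta_reduce
    by_cases hxb : x = b
    · rw [if_pos hxb, norm_zero]; positivity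
    · rw [if_neg hxb]
      exact (hsG x y hx hxb hy).2.2.2.2 x (hmem x hxb)

end Branches

namespace Branches
variable {n : ℕ} (S : Branches n)

/-- `ω` is integrable at `b`, quantitatively. -/
def MildAt (ω : ℂ → ℂ → ℂ) (b : ℂ) : Prop :=
  ∃ K ε : ℝ, 0 ≤ K ∧ 0 < ε ∧ ε ≤ 1 ∧ ∀ᶠ x in 𝓝[≠] b, ∀ y, S.F.evalEval x y = 0 →
    ‖ω x y‖ ≤ K * ‖x - b‖ ^ (ε - 1)

theorem exists_local_prim {ω : ℂ → ℂ → ℂ} (hω : S.IsHol ω) (hb : ∀ b ∈ S.B, S.MildAt ω b) (c : ℂ) :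
    ∃ (r : ℝ) (f : ℂ → ℂ → ℂ), 0 < r ∧ (∀ x ∈ Metric.ball c r, x ≠ c → x ∉ S.B) ∧
      S.IsPrim ω f (Metric.ball c r) ∧ ∀ z : S.Curve, z.1.1 ∈ Metric.ball c r →
        ContinuousAt (fun z : S.Curve => f z.1.1 z.1.2) z := by
  by_cases hc : c ∈ S.B
  · obtain ⟨K, ε, hK, hε, hε1, h⟩ := hb c hc
    have h' := h.and (eventually_notMem_nhdsNE S.B c)
    rw [eventually_nhdsWithin_iff] at h'
    obtain ⟨R, hR, hball⟩ := Metric.eventually_nhds_iff_ball.1 h'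
    have e : 2 * (R / 2) = R := by ring
    have hr : 0 < R / 2 := by positivity
    obtain ⟨f, hf, hfb⟩ := S.exists_prim_branch hω hc (R := R / 2) hε hε1 hK
      (fun x hx hxc => (hball x (e ▸ hx) hxc).2) (fun x hx hxc => (hball x (e ▸ hx) hxc).1)
    have hB : ∀ x ∈ Metric.ball c (R / 2), x ≠ c → x ∉ S.B := fun x hx hxc =>
      (hball x (Metric.ball_subset_ball (by linarith) hx) hxc).2
    refine ⟨R / 2, f, hr, hB, hf, fun z hz => ?_⟩
    by_cases hzc : z.1.1 = c
    · have h0 : f z.1.1 z.1.2 = 0 := by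
        have := hfb z.1.1 hz z.1.2 z.2
        rw [hzc, sub_self, norm_zero, Real.zero_rpow hε.ne', mul_zero] at this
        rw [hzc]
        exact norm_le_zero_iff.1 this
      have hlim : Tendsto (fun z : S.Curve => K / ε * ‖z.1.1 - c‖ ^ ε) (𝓝 z) (𝓝 0) := by
        have h1 : ContinuousAt (fun z : S.Curve => K / ε * ‖z.1.1 - c‖ ^ ε) z := by
          refine ContinuousAt.const_mul (ContinuousAt.rpow_const ?_ (Or.inr hε.le)) _
          exact (S.continuous_proj.continuousAt.sub continuousAt_const).norm
        have := h1.tendsto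
        rwa [hzc, sub_self, norm_zero, Real.zero_rpow hε.ne', mul_zero] at this
      rw [ContinuousAt, h0]
      refine squeeze_zero_norm' ?_ hlim
      filter_upwards [S.continuous_proj.continuousAt.eventually (Metric.isOpen_ball.mem_nhds hz)]
        with z' hz' using hfb z'.1.1 hz' z'.1.2 z'.2
    · exact hf.continuousAt z (hB _ hz hzc) hz
  · obtain ⟨r, hB, hr⟩ := ((S.exists_ball_notMem hc).and self_mem_nhdsWithin).exists
    obtain ⟨f, hf⟩ := S.exists_prim_ball hω hr hB
    exact ⟨r, f, hr, fun x hx _ => hB x hx, hf, fun z hz => hf.continuousAt z (hB _ hz) hz⟩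

theorem exists_prim [ContractibleSpace S.Curve] {ω : ℂ → ℂ → ℂ} (hω : S.IsHol ω)
    (hb : ∀ b ∈ S.B, S.MildAt ω b) :
    ∃ f, S.IsPrim ω f Set.univ ∧ Continuous fun z : S.Curve => f z.1.1 z.1.2 := by
  classical
  choose r f hr hB hf hfc using S.exists_local_prim hω hb
  obtain ⟨Φ, hΦ⟩ := exists_glue (X := S.Curve) (U := fun c => S.proj ⁻¹' Metric.ball c (r c))
    (f := fun c z => f c z.1.1 z.1.2)
    (fun c => Metric.isOpen_ball.preimage S.continuous_proj)
    (fun z => ⟨z.1.1, Metric.mem_ball_self (hr _)⟩) (fun c d z hz => by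
      by_cases hzB : z.1.1 ∈ S.B
      · have h1 : z.1.1 = c := by
          by_contra h
          exact hB c _ hz.1 h hzB
        have h2 : z.1.1 = d := by
          by_contra h
          exact hB d _ hz.2 h hzB
        have h3 : c = d := h1.symm.trans h2
        subst h3
        simp
      · exact IsPrim.eventually_sub_eq (V := Metric.ball c (r c) ∩ Metric.ball d (r d))
          (Metric.isOpen_ball.inter Metric.isOpen_ball)
          ((hf c).mono Set.inter_subset_left) ((hf d).mono Set.inter_subset_right) z hzB hz)
  set Ψ : ℂ → ℂ → ℂ := fun x y => if h : S.F.evalEval x y = 0 then Φ ⟨(x, y), h⟩ else 0 with hΨ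
  have hΨz : ∀ z : S.Curve, Ψ z.1.1 z.1.2 = Φ z := fun z => dif_pos z.2
  refine ⟨Ψ, fun x _ hxB s hs => ?_, ?_⟩
  · have hz : S.F.evalEval x (s x) = 0 := hs.self_of_nhds.2
    have h1 := hΦ x ⟨(x, s x), hz⟩ (Metric.mem_ball_self (hr x))
    rw [nhds_subtype_eq_comap, eventually_comap] at h1
    have hcont : Tendsto (fun x' => (x', s x')) (𝓝 x) (𝓝 (x, s x)) :=
      tendsto_id.prodMk_nhds hs.self_of_nhds.1
    have h2 := hf x x (Metric.mem_ball_self (hr x)) hxB s hs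
    refine (h2.add_const (Φ ⟨(x, s x), hz⟩ - f x x (s x))).congr_of_eventuallyEq ?_
    filter_upwards [hcont.eventually h1, hs] with x' h3 h4
    have h5 := h3 ⟨(x', s x'), h4.2⟩ rfl
    rw [← h5]
    have h6 : Ψ x' (s x') = Φ ⟨(x', s x'), h4.2⟩ := dif_pos h4.2
    rw [h6]; ring
  · rw [continuous_iff_continuousAt]
    intro z
    simp only [hΨz]
    have hmem : z.1.1 ∈ Metric.ball z.1.1 (r z.1.1) := Metric.mem_ball_self (hr _)
    refine ((hfc z.1.1 z hmem).add_const
      (Φ z - f z.1.1 z.1.1 z.1.2)).congr ?_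
    filter_upwards [hΦ z.1.1 z hmem] with z' hz'
    rw [← hz']; ring

end Branches

theorem exists_polynomial_of_entire (d : ℕ) : ∀ {f : ℂ → ℂ}, Differentiable ℂ f →
    f =O[cobounded ℂ] (fun x => x ^ d) → ∃ q : ℂ[X], ∀ x, f x = q.eval x := by
  induction d with
  | zero =>
    intro f hf h
    obtain ⟨C, hC⟩ := h.bound
    have hb : IsBounded (Set.range f) := by
      obtain ⟨r, hr⟩ := (Metric.hasBasis_cobounded_compl_closedBall (0 : ℂ)).eventually_iff.1 hC
      obtain ⟨M, hM⟩ := (isCompact_closedBall (0 : ℂ) r).exists_bound_of_continuousOn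
        hf.continuous.continuousOn
      refine isBounded_iff_forall_norm_le.2 ⟨max C M, ?_⟩
      rintro _ ⟨x, rfl⟩
      by_cases hx : x ∈ Metric.closedBall (0 : ℂ) r
      · exact (hM x hx).trans (le_max_right _ _)
      · have := hr.2 hx
        simp only [pow_zero, norm_one, mul_one] at this
        exact this.trans (le_max_left _ _)
    obtain ⟨c, hc⟩ := hf.exists_const_forall_eq_of_bounded hb
    exact ⟨Polynomial.C c, fun x => by rw [hc, eval_C]⟩
  | succ d ih =>
    intro f hf h
    have hG : Differentiable ℂ (dslope f 0) := by
      rw [← differentiableOn_univ] at hf ⊢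
      exact (Complex.differentiableOn_dslope univ_mem).2 hf
    have hfx : ∀ x, f x = f 0 + x * dslope f 0 x := fun x => by
      have := sub_smul_dslope f 0 x
      rw [sub_zero, smul_eq_mul] at this
      rw [this]; ring
    have hO : dslope f 0 =O[cobounded ℂ] fun x => x ^ d := by
      have h1 : (fun x => f x - f 0) =O[cobounded ℂ] fun x => x ^ (d + 1) :=
        h.sub (by
          have := (isBigO_pow_pow_cobounded_of_le (R := ℂ) (Nat.zero_le (d + 1)))
          simp only [pow_zero] at this
          exact (isBigO_const_const (f 0) (one_ne_zero (α := ℂ)) _).trans this)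
      have h2 := h1.mul (isBigO_refl (fun x : ℂ => x⁻¹) (cobounded ℂ))
      refine (h2.congr' ?_ ?_)
      · filter_upwards [eventually_ne_zero_cobounded] with x hx
        rw [hfx x]; field_simp; ring
      · filter_upwards [eventually_ne_zero_cobounded] with x hx
        field_simp
        exact pow_succ' x d
    obtain ⟨q, hq⟩ := ih hG hO
    exact ⟨C (f 0) + X * q, fun x => by rw [hfx x, hq]; simp⟩

theorem exists_entire_extension {B : Finset ℂ} {f : ℂ → ℂ} (hf : ∀ x ∉ B, DifferentiableAt ℂ f x)
    (hb : ∀ b ∈ B, f =O[𝓝[≠] b] fun _ => (1 : ℝ)) :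
    ∃ g : ℂ → ℂ, Differentiable ℂ g ∧ ∀ x ∉ B, g x = f x := by
  classical
  refine ⟨fun x => if x ∈ B then limUnder (𝓝[≠] x) f else f x, fun x => ?_, fun x hx => if_neg hx⟩
  by_cases hx : x ∈ B
  · obtain ⟨C, hC⟩ := (hb x hx).bound
    have h' := hC.and (eventually_notMem_nhdsNE B x)
    rw [eventually_nhdsWithin_iff] at h'
    obtain ⟨R, hR, hball⟩ := Metric.eventually_nhds_iff_ball.1 h'
    have hn := Metric.ball_mem_nhds x hR
    have := Complex.differentiableOn_update_limUnder_of_bddAbove (f := f) hn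
      (fun z hz => (hf z (hball z hz.1 hz.2).2).differentiableWithinAt)
      ⟨C, by
        rintro _ ⟨z, hz, rfl⟩
        simpa using (hball z hz.1 hz.2).1⟩
    refine (this.differentiableAt hn).congr_of_eventuallyEq ?_
    filter_upwards [hn] with z hz
    by_cases hzx : z = x
    · subst hzx; simp [hx]
    · rw [Function.update_of_ne hzx, if_neg (hball z hz hzx).2]
  · refine (hf x hx).congr_of_eventuallyEq ?_
    filter_upwards [B.finite_toSet.isClosed.isOpen_compl.mem_nhds (by simpa using hx)] with z hz
    exact if_neg (by simpa using hz)

theorem exists_polynomial_of_hol {B : Finset ℂ} {f : ℂ → ℂ}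
    (hf : ∀ x ∉ B, DifferentiableAt ℂ f x)
    (hb : ∀ b ∈ B, f =O[𝓝[≠] b] fun _ => (1 : ℝ)) {d : ℕ}
    (hd : f =O[cobounded ℂ] (fun x => x ^ d)) : ∃ q : ℂ[X], ∀ x ∉ B, f x = q.eval x := by
  obtain ⟨g, hg, hgf⟩ := exists_entire_extension hf hb
  obtain ⟨q, hq⟩ := exists_polynomial_of_entire d hg (hd.congr' (by
    filter_upwards [eventually_notMem_cobounded B] with x hx using (hgf x hx).symm) EventuallyEq.rfl)
  exact ⟨q, fun x hx => by rw [← hgf x hx, hq]⟩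

namespace Branches
variable {n : ℕ} (S : Branches n)

variable {S} in
theorem IsHol.mul {f g : ℂ → ℂ → ℂ} (hf : S.IsHol f) (hg : S.IsHol g) :
    S.IsHol fun x y => f x y * g x y := fun x hx s hs => (hf x hx s hs).mul (hg x hx s hs)

variable {S} in
theorem IsHol.pow {f : ℂ → ℂ → ℂ} (hf : S.IsHol f) (m : ℕ) :
    S.IsHol fun x y => f x y ^ m := fun x hx s hs => (hf x hx s hs).pow m

variable {S} in
theorem IsHol.sub {f g : ℂ → ℂ → ℂ} (hf : S.IsHol f) (hg : S.IsHol g) :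
    S.IsHol fun x y => f x y - g x y := fun x hx s hs => (hf x hx s hs).sub (hg x hx s hs)

theorem isHol_snd : S.IsHol fun _ y => y := fun _ hx _ hs => S.germ_differentiableAt hx hs

variable {S} in
theorem IsPrim.isHol {ω f : ℂ → ℂ → ℂ} (h : S.IsPrim ω f Set.univ) : S.IsHol f :=
  fun x hx s hs => (h x trivial hx s hs).differentiableAt

theorem isHol_evalEval (g : ℂ[X][X]) : S.IsHol fun x y => g.evalEval x y := fun x hx s hs => by
  have h1 : DifferentiableAt ℂ (fun z : ℂ × ℂ => g.evalEval z.1 z.2) (x, s x) :=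
    (contDiff_evalEval g).differentiable one_ne_zero _
  exact h1.comp (f := fun x => (x, s x)) x
    (differentiableAt_id.prodMk (S.germ_differentiableAt hx hs))

/-- An element of `Reg` as a function of a point of the curve. -/
theorem exists_value {U : ℂ → Fin n → ℂ} (hU : U ∈ S.Reg) :
    ∃ ω : ℂ → ℂ → ℂ, S.IsHol ω ∧ ∀ x ∉ S.B, ∀ j, ω x (S.Y x j) = U x j := by
  obtain ⟨k, g, hg⟩ := hU
  refine ⟨fun x y => g.evalEval x y / (denom S.B).eval x ^ k, fun x hx s hs => ?_,
    fun x hx j => ?_⟩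
  · exact (S.isHol_evalEval g x hx s hs).div ((denom S.B).differentiable.differentiableAt.pow k)
      (pow_ne_zero k (denom_eval_ne hx))
  · beta_reduce
    rw [← hg x hx j, mul_div_cancel_right₀ _ (pow_ne_zero k (denom_eval_ne hx))]

variable {S} in
theorem IsHol.tr_differentiableAt {f : ℂ → ℂ → ℂ} (hf : S.IsHol f) {x : ℂ} (hx : x ∉ S.B) :
    DifferentiableAt ℂ (tr fun x j => f x (S.Y x j)) x := by
  obtain ⟨r, h1, hr⟩ := ((S.exists_ball_notMem hx).and self_mem_nhdsWithin).exists
  obtain ⟨σ, hσ, -⟩ := S.exists_sections hr h1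
  have h2 : DifferentiableAt ℂ (fun x => ∑ j, f x (σ j x)) x :=
    DifferentiableAt.fun_sum fun j _ => hf x hx (σ j) (hσ.germ (Metric.mem_ball_self hr) j)
  refine h2.congr_of_eventuallyEq ?_
  filter_upwards [Metric.ball_mem_nhds x hr] with z hz
  exact (hσ.sum_eq hz (f z)).symm

variable {S} in
theorem IsHol.mem_reg {f : ℂ → ℂ → ℂ} (hf : S.IsHol f)
    (hb : ∀ b ∈ S.B, ∀ j, (fun x => f x (S.Y x j)) =O[𝓝[≠] b] fun _ => (1 : ℝ)) {d : ℕ}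
    (hd : ∀ j, (fun x => f x (S.Y x j)) =O[cobounded ℂ] fun x => x ^ d) :
    (fun x j => f x (S.Y x j)) ∈ S.Reg := by
  obtain ⟨e, he⟩ := S.exists_Y_isBigO
  refine S.mem_reg_of_tr S.ypow_mem S.det_ypow fun i => ?_
  obtain ⟨q, hq⟩ := exists_polynomial_of_hol (B := S.B) (d := d + e * i)
    (f := tr ((fun x j => f x (S.Y x j)) * S.ypow i))
    (fun x hx => (hf.mul (S.isHol_snd.pow i)).tr_differentiableAt hx)
    (fun b hbB => by
      refine IsBigO.fun_sum fun j _ => ?_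
      have := (hb b hbB j).mul (((S.Y_isBigO_one b j).mono nhdsWithin_le_nhds).pow i)
      simp only [one_pow, mul_one] at this
      exact this)
    (by
      refine IsBigO.fun_sum fun j _ => ?_
      have := (hd j).mul ((he j).pow i)
      simp_rw [← pow_mul, ← pow_add] at this
      exact this)
  exact rat_congr (eval_mem_rat S.B q) fun x hx => hq x hx

end Branches

namespace Branches
variable {n : ℕ} (S : Branches n)

theorem mildAt_of_mem_W {w : ℂ → Fin n → ℂ} (hw : w ∈ S.W) {ω : ℂ → ℂ → ℂ}
    (hω : ∀ x ∉ S.B, ∀ j, ω x (S.Y x j) = w x j) {b : ℂ} (hb : b ∈ S.B) : S.MildAt ω b := by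
  have hmem : w * (fun x _ => x - b) ∈ S.Reg := by
    refine mul_mem hw.1 ?_
    exact S.reg_congr (S.poly_mem (X - C b)) fun x _ _ => by simp
  have hlim := hw.2 b hb
  have hne : ∀ᶠ x in 𝓝[≠] b, x - b ≠ 0 := by
    filter_upwards [self_mem_nhdsWithin] with x hx using sub_ne_zero.2 hx
  have hval : ∀ᶠ x in 𝓝[≠] b, ∀ y, S.F.evalEval x y = 0 → ∃ j, ω x y = w x j := by
    filter_upwards [eventually_notMem_nhdsNE S.B b] with x hx y hy
    obtain ⟨j, rfl⟩ := S.evalEval_eq_zero_iff.1 hy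
    exact ⟨j, hω x hx j⟩
  rcases exists_dominant_powerSum (U := fun x j => w x j * (x - b)) (tendsto_sub_nhdsNE b) hne
    (fun m _ _ => hasOrd_nhdsNE_of_rat (S.tr_mem (pow_mem hmem m)) b) with h | ⟨m, N, c, hm, -, hc, ht, hO⟩
  · refine ⟨0, 1, le_rfl, one_pos, le_rfl, ?_⟩
    filter_upwards [h, hne, hval] with x h1 h2 h3 y hy
    obtain ⟨j, hj⟩ := h3 y hy
    have := (mul_eq_zero.1 (h1 j)).resolve_right h2
    simp [hj, this]
  · have hN : N ≤ -1 := by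
      by_contra hN
      obtain ⟨k, rfl⟩ := Int.eq_ofNat_of_zero_le (show 0 ≤ N by omega)
      have h1 : Tendsto (fun x => (∑ j, (w x j * (x - b)) ^ m) * (x - b) ^ (k : ℤ)) (𝓝[≠] b)
          (𝓝 ((∑ j : Fin n, (0 : ℂ) ^ m) * 0 ^ k)) := by
        simp_rw [zpow_natCast]
        exact (tendsto_finsetSum _ fun j _ => (hlim j).pow m).mul ((tendsto_sub_nhdsNE b).pow k)
      have h2 := tendsto_nhds_unique ht h1
      rw [h2] at hc
      simp [show m ≠ 0 by omega] at hc
    have hO' : ∃ K : ℝ, 0 ≤ K ∧ ∀ᶠ x in 𝓝[≠] b, ∀ j,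
        ‖(w x j * (x - b)) ^ m * (x - b) ^ N‖ ≤ K := by
      choose K hK using fun j => (hO j).bound
      refine ⟨∑ j, |K j|, Finset.sum_nonneg fun _ _ => abs_nonneg _, ?_⟩
      filter_upwards [eventually_all.2 hK] with x hx j
      have := hx j
      simp only [norm_one, mul_one] at this
      exact (this.trans (le_abs_self _)).trans
        (Finset.single_le_sum (f := fun j => |K j|) (fun _ _ => abs_nonneg _) (Finset.mem_univ j))
    obtain ⟨K, hK, hKb⟩ := hO'
    have hm0 : (0 : ℝ) < m := by exact_mod_cast hm
    refine ⟨K ^ (1 / m : ℝ), 1 / m, by positivity, by positivity, ?_, ?_⟩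
    · rw [div_le_one hm0]; exact_mod_cast hm
    · filter_upwards [hKb, hne, hval, nhdsWithin_le_nhds (Metric.ball_mem_nhds b one_pos)]
        with x h1 h2 h3 h4 y hy
      obtain ⟨j, hj⟩ := h3 y hy
      have hp : 0 < ‖x - b‖ := norm_pos_iff.2 h2
      have hp1 : ‖x - b‖ ≤ 1 := by rw [Metric.mem_ball, dist_eq_norm] at h4; exact h4.le
      have h5 := h1 j
      rw [norm_mul, norm_pow, norm_mul, norm_zpow] at h5
      have h6 : (‖w x j‖ * ‖x - b‖) ^ m ≤ K * ‖x - b‖ := by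
        have h7 : ‖x - b‖ ^ (-N) ≤ ‖x - b‖ := by
          have := zpow_le_zpow_right_of_le_one₀ hp hp1 (show (1 : ℤ) ≤ -N by omega)
          simpa using this
        calc (‖w x j‖ * ‖x - b‖) ^ m
            = (‖w x j‖ * ‖x - b‖) ^ m * ‖x - b‖ ^ N * ‖x - b‖ ^ (-N) := by
              rw [mul_assoc, ← zpow_add₀ hp.ne']; simp
          _ ≤ K * ‖x - b‖ := mul_le_mul h5 h7 (by positivity) hK
      have h8 : ‖w x j‖ * ‖x - b‖ ≤ (K * ‖x - b‖) ^ (1 / m : ℝ) := by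
        rw [one_div]
        exact (Real.le_rpow_inv_iff_of_pos (by positivity) (by positivity) hm0).2
          (by rw [Real.rpow_natCast]; exact h6)
      rw [Real.mul_rpow hK hp.le] at h8
      rw [hj, Real.rpow_sub_one hp.ne', ← mul_div_assoc, le_div_iff₀ hp]
      exact h8

theorem exists_W_prim [ContractibleSpace S.Curve] {w : ℂ → Fin n → ℂ} (hw : w ∈ S.W) :
    ∃ ω f : ℂ → ℂ → ℂ, (∀ x ∉ S.B, ∀ j, ω x (S.Y x j) = w x j) ∧ S.IsPrim ω f Set.univ ∧
      Continuous fun z : S.Curve => f z.1.1 z.1.2 := by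
  obtain ⟨ω, hω, hval⟩ := S.exists_value hw.1
  obtain ⟨f, hf⟩ := S.exists_prim hω fun b hb => S.mildAt_of_mem_W hw hval hb
  exact ⟨ω, f, hval, hf⟩

theorem exists_bound_closedBall {f : ℂ → ℂ → ℂ} (hf : Continuous fun z : S.Curve => f z.1.1 z.1.2)
    (c : ℂ) (r : ℝ) : ∃ A, ∀ x ∈ Metric.closedBall c r, ∀ j, ‖f x (S.Y x j)‖ ≤ A := by
  obtain ⟨A, hA⟩ := (S.isProperMap_proj.isCompact_preimage
    (isCompact_closedBall c r)).exists_bound_of_continuousOn hf.continuousOn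
  exact ⟨A, fun x hx j => hA ⟨(x, S.Y x j), S.evalEval_Y x j⟩ hx⟩

theorem isBigO_one_of_continuous {f : ℂ → ℂ → ℂ}
    (hf : Continuous fun z : S.Curve => f z.1.1 z.1.2) (b : ℂ) (j : Fin n) :
    (fun x => f x (S.Y x j)) =O[𝓝[≠] b] fun _ => (1 : ℝ) := by
  obtain ⟨A, hA⟩ := S.exists_bound_closedBall hf b 1
  refine IsBigO.of_bound A ?_
  filter_upwards [nhdsWithin_le_nhds (Metric.closedBall_mem_nhds b one_pos)] with x hx
  simpa using hA x hx j

/-- Growth of a primitive, by comparison of the values at `x` and `(2/3)x`. -/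
theorem IsPrim.growth {S : Branches n} {ω f : ℂ → ℂ → ℂ} (h : S.IsPrim ω f Set.univ)
    (hf : Continuous fun z : S.Curve => f z.1.1 z.1.2) {R : ℝ} (hR : 0 < R)
    (hB : ∀ b ∈ S.B, ‖b‖ < R) {G : ℝ → ℝ} (hG : ∀ ρ, R ≤ ρ → 0 ≤ G ρ)
    (hω : ∀ x : ℂ, 2 * R ≤ ‖x‖ → ∀ x' ∈ Metric.ball x (‖x‖ / 2), ∀ j,
      ‖ω x' (S.Y x' j)‖ * (‖x‖ / 3) ≤ G ‖x‖ - G (2 / 3 * ‖x‖)) :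
    ∃ A, ∀ x : ℂ, R ≤ ‖x‖ → ∀ j, ‖f x (S.Y x j)‖ ≤ A + G ‖x‖ := by
  obtain ⟨A, hA⟩ := S.exists_bound_closedBall hf 0 (2 * R)
  refine ⟨A, ?_⟩
  have key : ∀ k : ℕ, ∀ x : ℂ, R ≤ ‖x‖ → ‖x‖ ≤ 2 * R * (3 / 2) ^ k → ∀ j,
      ‖f x (S.Y x j)‖ ≤ A + G ‖x‖ := by
    intro k
    induction k with
    | zero =>
      intro x hx hx' j
      have h1 := hA x (by simpa using hx') j
      linarith [hG _ hx]
    | succ k ih =>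
      intro x hx hx' j
      by_cases hx2 : ‖x‖ ≤ 2 * R
      · have h1 := hA x (by simpa using hx2) j
        linarith [hG _ hx]
      push Not at hx2
      have hxp : 0 < ‖x‖ := by linarith
      have hball : ∀ x' ∈ Metric.ball x (‖x‖ / 2), x' ∉ S.B := fun x' hx' hb => by
        have h1 := hB x' hb
        rw [Metric.mem_ball, dist_comm, dist_eq_norm] at hx'
        have := norm_sub_norm_le x x'
        linarith
      obtain ⟨σ, hσ, hσc⟩ := S.exists_sections (by positivity) hball
      set x' : ℂ := (2 / 3 : ℝ) * x with hx'def
      have hnx : ‖x'‖ = 2 / 3 * ‖x‖ := by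
        rw [hx'def, norm_mul, Complex.norm_real]; norm_num
      have hsub : ‖x - x'‖ = ‖x‖ / 3 := by
        have : x - x' = ((1 / 3 : ℝ) : ℂ) * x := by rw [hx'def]; push_cast; ring
        rw [this, norm_mul, Complex.norm_real]; norm_num; ring
      have hmem : x' ∈ Metric.ball x (‖x‖ / 2) := by
        rw [Metric.mem_ball, dist_comm, dist_eq_norm, hsub]; linarith
      have hmemx : x ∈ Metric.ball x (‖x‖ / 2) := Metric.mem_ball_self (by positivity)
      have hd : ∀ z ∈ Metric.ball x (‖x‖ / 2),
          HasDerivAt (fun z => f z (σ j z)) (ω z (σ j z)) z := fun z hz =>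
        h z trivial (hball z hz) _ (hσ.germ hz j)
      have hbd : ∀ z ∈ Metric.ball x (‖x‖ / 2), ‖ω z (σ j z)‖ ≤
          (G ‖x‖ - G (2 / 3 * ‖x‖)) / (‖x‖ / 3) := fun z hz => by
        obtain ⟨i, hi⟩ := S.evalEval_eq_zero_iff.1 (hσ.evalEval hz j)
        rw [hi, le_div_iff₀ (by positivity)]
        exact hω x hx2.le z hz i
      have h1 := (convex_ball x (‖x‖ / 2)).norm_image_sub_le_of_norm_hasDerivWithin_le
        (fun z hz => (hd z hz).hasDerivWithinAt) hbd hmem hmemx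
      rw [hsub, div_mul_cancel₀ _ (by positivity)] at h1
      obtain ⟨i, hi⟩ := S.evalEval_eq_zero_iff.1 (hσ.evalEval hmem j)
      have h2 := ih x' (by rw [hnx]; linarith) (by rw [hnx, pow_succ] at *; linarith) i
      rw [hnx] at h2
      rw [hi, hσc j] at h1
      have h3 := norm_sub_norm_le (f x (S.Y x j)) (f x' (S.Y x' i))
      linarith
  intro x hx j
  obtain ⟨k, hk⟩ := pow_unbounded_of_one_lt (‖x‖ / (2 * R)) (show (1 : ℝ) < 3 / 2 by norm_num)
  rw [div_lt_iff₀ (by positivity)] at hk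
  exact key k x hx (by linarith) j

end Branches

namespace Branches
variable {n : ℕ} (S : Branches n)

theorem exists_isBigO_of_reg {U : ℂ → Fin n → ℂ} (hU : U ∈ S.Reg) :
    ∃ d : ℕ, ∀ j, (fun x => U x j) =O[cobounded ℂ] fun x => x ^ d := by
  obtain ⟨e, he⟩ := S.exists_Y_isBigO
  have hg : ∀ g : ℂ[X][X], ∃ d : ℕ, ∀ j,
      (fun x => g.evalEval x (S.Y x j)) =O[cobounded ℂ] fun x => x ^ d := by
    intro g
    induction g using Polynomial.induction_on' with
    | add p q hp hq =>
      obtain ⟨d, hd⟩ := hp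
      obtain ⟨d', hd'⟩ := hq
      refine ⟨max d d', fun j => ?_⟩
      simp_rw [evalEval_add]
      exact ((hd j).trans (isBigO_pow_pow_cobounded_of_le (le_max_left _ _))).add
        ((hd' j).trans (isBigO_pow_pow_cobounded_of_le (le_max_right _ _)))
    | monomial i p =>
      refine ⟨p.natDegree + e * i, fun j => ?_⟩
      have h1 := (eval_isBigO_cobounded (le_refl p.natDegree)).mul ((he j).pow i)
      refine h1.congr (fun x => ?_) fun x => ?_
      · simp [evalEval, eval_monomial]
      · rw [← pow_mul, ← pow_add]
  obtain ⟨k, g, hkg⟩ := hU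
  obtain ⟨d, hd⟩ := hg g
  refine ⟨d, fun j => IsBigO.trans ?_ (hd j)⟩
  have h1 : (fun _ => (1 : ℂ)) =O[cobounded ℂ] fun x => (denom S.B).eval x := by
    have := isBigO_cobounded_of_degree_le (P := (1 : ℂ[X])) (Q := denom S.B) (by
      rw [degree_one, degree_eq_natDegree (denom_ne_zero S.B)]
      exact_mod_cast Nat.zero_le _)
    simpa using this
  refine ((isBigO_refl (fun x => U x j) (cobounded ℂ)).mul (h1.pow k)).congr' ?_ ?_
  · exact Eventually.of_forall fun x => by simp
  · filter_upwards [eventually_notMem_cobounded S.B] with x hx using hkg x hx j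

theorem exists_const_of_lam {a : ℂ → Fin n → ℂ} (ha : a ∈ S.Lam)
    (h : ∀ m, 1 ≤ m → tr (a ^ m) =o[cobounded ℂ] fun x => x) :
    ∃ c, ∀ x ∉ S.B, ∀ j, a x j = c := by
  refine S.exists_const_of_tr ha.1 fun m hm => ?_
  obtain ⟨q, hq⟩ := S.tr_of_mem_W (S.lam_le_W (pow_mem ha m))
  refine ⟨q.coeff 0, fun x hx => ?_⟩
  have hd : q.natDegree = 0 := by
    by_cases hq0 : q = 0
    · simp [hq0]
    have h1 : (fun x => q.eval x) =o[cobounded ℂ] fun x => x ^ 1 := by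
      simp only [pow_one]
      exact (h m hm).congr' (poly_congr_cobounded hq) EventuallyEq.rfl
    have := natDegree_lt_of_isLittleO hq0 h1
    omega
  rw [hq x hx, eq_C_of_natDegree_eq_zero hd]; simp

theorem exists_bound_cobounded {w : ℂ → Fin n → ℂ} {g : ℂ → ℂ}
    (h : ∀ j, (fun x => w x j) =O[cobounded ℂ] g) :
    ∃ K R : ℝ, 0 ≤ K ∧ 1 ≤ R ∧ (∀ b ∈ S.B, ‖b‖ < R) ∧
      ∀ x : ℂ, R ≤ ‖x‖ → ∀ j, ‖w x j‖ ≤ K * ‖g x‖ := by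
  choose K hK using fun j => (h j).bound
  have h1 : ∀ᶠ x in cobounded ℂ, x ∉ S.B ∧ ∀ j, ‖w x j‖ ≤ (∑ j, |K j|) * ‖g x‖ := by
    filter_upwards [eventually_notMem_cobounded S.B, eventually_all.2 hK] with x hxB hx
    refine ⟨hxB, fun j => (hx j).trans (mul_le_mul_of_nonneg_right ?_ (norm_nonneg _))⟩
    exact (le_abs_self _).trans
      (Finset.single_le_sum (f := fun j => |K j|) (fun _ _ => abs_nonneg _) (Finset.mem_univ j))
  obtain ⟨r, -, hr⟩ := (Metric.hasBasis_cobounded_compl_closedBall (0 : ℂ)).eventually_iff.1 h1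
  have hout : ∀ x : ℂ, max 1 (r + 1) ≤ ‖x‖ → x ∈ (Metric.closedBall (0 : ℂ) r)ᶜ := fun x hx => by
    have := (le_max_right 1 (r + 1)).trans hx
    simp only [Set.mem_compl_iff, mem_closedBall_zero_iff, not_le]
    linarith
  refine ⟨∑ j, |K j|, max 1 (r + 1), Finset.sum_nonneg fun _ _ => abs_nonneg _, le_max_left _ _,
    fun b hb => ?_, fun x hx => (hr (hout x hx)).2⟩
  by_contra hlt
  exact (hr (hout b (not_lt.1 hlt))).1 hb

theorem norm_le_of_mem_ball_half {x x' : ℂ} (h : x' ∈ Metric.ball x (‖x‖ / 2)) :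
    ‖x‖ / 2 ≤ ‖x'‖ ∧ ‖x'‖ ≤ 3 / 2 * ‖x‖ := by
  rw [Metric.mem_ball, dist_eq_norm] at h
  have h1 := norm_sub_norm_le x' x
  have h2 := norm_sub_norm_le x x'
  rw [norm_sub_rev] at h2
  constructor <;> linarith

theorem IsPrim.mem_lam {S : Branches n} {ω f : ℂ → ℂ → ℂ} {w : ℂ → Fin n → ℂ} (hw : w ∈ S.W)
    (hω : ∀ x ∉ S.B, ∀ j, ω x (S.Y x j) = w x j) (h : S.IsPrim ω f Set.univ)
    (hf : Continuous fun z : S.Curve => f z.1.1 z.1.2) :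
    (fun x j => f x (S.Y x j)) ∈ S.Lam := by
  obtain ⟨d, hd⟩ := S.exists_isBigO_of_reg hw.1
  obtain ⟨K, R, hK, hR, hB, hbd⟩ := S.exists_bound_cobounded hd
  set M : ℝ := K * (3 / 2) ^ d with hM
  have hM0 : 0 ≤ M := by positivity
  obtain ⟨A, hA⟩ := h.growth hf (by linarith) hB (G := fun ρ => M * ρ ^ (d + 1))
    (fun ρ hρ => by have : 0 ≤ ρ := by linarith
                    positivity) (fun x hx x' hx' j => by
      obtain ⟨h1, h2⟩ := norm_le_of_mem_ball_half hx'
      have hRx : R ≤ ‖x'‖ := by linarith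
      have h3 := hbd x' hRx j
      rw [hω x' (fun hb => absurd (hB x' hb) (not_lt.2 hRx)) j]
      rw [norm_pow] at h3
      have h4 : ‖w x' j‖ ≤ M * ‖x‖ ^ d := by
        refine h3.trans ?_
        rw [hM, mul_assoc, ← mul_pow]
        gcongr
      have h5 : ((2 : ℝ) / 3) ^ (d + 1) ≤ 2 / 3 := by
        have := pow_le_pow_of_le_one (show (0 : ℝ) ≤ 2 / 3 by norm_num) (by norm_num)
          (show 1 ≤ d + 1 by omega)
        simpa using this
      calc ‖w x' j‖ * (‖x‖ / 3) ≤ M * ‖x‖ ^ d * (‖x‖ / 3) := by gcongr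
        _ = M * ‖x‖ ^ (d + 1) * (1 - 2 / 3) := by ring
        _ ≤ M * ‖x‖ ^ (d + 1) * (1 - (2 / 3) ^ (d + 1)) := by gcongr
        _ = _ := by rw [mul_pow]; ring)
  have hb : ∀ b ∈ S.B, ∀ j, (fun x => f x (S.Y x j)) =O[𝓝[≠] b] fun _ => (1 : ℝ) :=
    fun b _ j => S.isBigO_one_of_continuous hf b j
  refine ⟨h.isHol.mem_reg hb (d := d + 1) fun j => ?_, hb⟩
  refine IsBigO.of_bound (|A| + M) ?_
  filter_upwards [(tendsto_norm_cobounded_atTop (E := ℂ)).eventually_ge_atTop R] with x hx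
  have h1 : 1 ≤ ‖x‖ ^ (d + 1) := one_le_pow₀ (hR.trans hx)
  rw [norm_pow]
  calc _ ≤ A + M * ‖x‖ ^ (d + 1) := hA x hx j
    _ ≤ |A| * ‖x‖ ^ (d + 1) + M * ‖x‖ ^ (d + 1) := by
      gcongr
      exact (le_abs_self A).trans (le_mul_of_one_le_right (abs_nonneg A) h1)
    _ = _ := by ring

theorem IsPrim.eq_zero_of_const {S : Branches n} {ω f : ℂ → ℂ → ℂ} (h : S.IsPrim ω f Set.univ)
    {c : ℂ} (hc : ∀ x ∉ S.B, ∀ j, f x (S.Y x j) = c) {x : ℂ} (hx : x ∉ S.B) (j : Fin n) :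
    ω x (S.Y x j) = 0 := by
  obtain ⟨s, hs, hsx⟩ := S.exists_germ hx (S.evalEval_Y x j)
  have h1 := h x trivial hx s hs
  rw [hsx] at h1
  refine h1.unique ((hasDerivAt_const x c).congr_of_eventuallyEq ?_)
  have hev : ∀ᶠ x' in 𝓝 x, x' ∉ S.B :=
    S.B.finite_toSet.isClosed.isOpen_compl.mem_nhds (by simpa using hx)
  filter_upwards [hev, hs] with x' h1 h2
  obtain ⟨i, hi⟩ := S.evalEval_eq_zero_iff.1 h2.2
  rw [hi, hc x' h1]

theorem noForms_of_contractible [ContractibleSpace S.Curve] : S.NoForms := by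
  intro w hw hO
  obtain ⟨ω, f, hω, h, hf⟩ := S.exists_W_prim hw
  have hlam := IsPrim.mem_lam hw hω h hf
  obtain ⟨K, R, hK, hR, hB, hbd⟩ := S.exists_bound_cobounded hO
  have hlog : 0 < Real.log (3 / 2) := Real.log_pos (by norm_num)
  set M : ℝ := 2 * K / (3 * Real.log (3 / 2)) with hM
  have hM0 : 0 ≤ M := by positivity
  obtain ⟨A, hA⟩ := h.growth hf (by linarith) hB (G := fun ρ => M * Real.log ρ)
    (fun ρ hρ => mul_nonneg hM0 (Real.log_nonneg (hR.trans hρ))) (fun x hx x' hx' j => by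
      obtain ⟨h1, h2⟩ := norm_le_of_mem_ball_half hx'
      have hRx : R ≤ ‖x'‖ := by linarith
      have hxp : 0 < ‖x‖ := by linarith
      have hxp' : 0 < ‖x'‖ := by linarith
      have h3 := hbd x' hRx j
      rw [hω x' (fun hb => absurd (hB x' hb) (not_lt.2 hRx)) j]
      rw [norm_inv] at h3
      rw [Real.log_mul (by norm_num) hxp.ne', ← mul_sub, sub_add_cancel_right, ← Real.log_inv]
      norm_num
      have h4 : ‖w x' j‖ * ‖x‖ ≤ 2 * K := by
        have h5 : ‖w x' j‖ * ‖x'‖ ≤ K := by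
          rwa [← div_eq_mul_inv, le_div_iff₀ hxp'] at h3
        nlinarith [norm_nonneg (w x' j)]
      rw [hM]
      field_simp
      exact h4)
  have hfO : ∀ j, (fun x => f x (S.Y x j)) =O[cobounded ℂ] fun x => Real.log ‖x‖ := by
    intro j
    refine IsBigO.of_bound (|A| + M) ?_
    filter_upwards [(tendsto_norm_cobounded_atTop (E := ℂ)).eventually_ge_atTop R,
      (Real.tendsto_log_atTop.comp (tendsto_norm_cobounded_atTop (E := ℂ))).eventually_ge_atTop 1]
      with x hx hx1
    simp only [Function.comp_apply] at hx1
    rw [Real.norm_of_nonneg (by linarith)]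
    calc _ ≤ A + M * Real.log ‖x‖ := hA x hx j
      _ ≤ |A| * Real.log ‖x‖ + M * Real.log ‖x‖ := by
        gcongr
        exact (le_abs_self A).trans (le_mul_of_one_le_right (abs_nonneg A) hx1)
      _ = _ := by ring
  obtain ⟨c, hc⟩ := S.exists_const_of_lam hlam fun m hm => by
    refine tr_isLittleO fun j => ?_
    have h1 := (Real.isLittleO_pow_log_id_atTop (n := m)).comp_tendsto
      (tendsto_norm_cobounded_atTop (E := ℂ))
    have h2 := ((hfO j).pow m).trans_isLittleO h1
    exact h2.of_norm_right
  intro x hx j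
  rw [← hω x hx j]
  exact h.eq_zero_of_const hc hx j

end Branches

theorem pow_dvd_of_isBigO {q : ℂ[X]} {c : ℂ} {k : ℕ}
    (h : (fun x => q.eval x) =O[𝓝[≠] c] fun x => (x - c) ^ k) : (X - C c) ^ k ∣ q := by
  by_cases hq : q = 0
  · simp [hq]
  obtain ⟨g, hg, hg0⟩ := exists_eq_pow_rootMultiplicity_mul_and_not_dvd q hq c
  rw [dvd_iff_isRoot] at hg0
  set m := q.rootMultiplicity c with hm
  have hkm : k ≤ m := by
    by_contra hlt
    obtain ⟨d, hd⟩ := Nat.exists_eq_add_of_lt (not_le.1 hlt)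
    have hne : ∀ᶠ x in 𝓝[≠] c, x - c ≠ 0 := by
      filter_upwards [self_mem_nhdsWithin] with x hx using sub_ne_zero.2 hx
    have h0 : Tendsto (fun x => x - c) (𝓝[≠] c) (𝓝 0) := by
      have : Tendsto (fun x => x - c) (𝓝 c) (𝓝 (c - c)) := (continuous_id.sub continuous_const).tendsto c
      rw [sub_self] at this
      exact this.mono_left nhdsWithin_le_nhds
    have h1 : (fun x => g.eval x) =O[𝓝[≠] c] fun x => (x - c) ^ (d + 1) := by
      refine (h.mul (isBigO_refl (fun x => ((x - c) ^ m)⁻¹) _)).congr' ?_ ?_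
      · filter_upwards [hne] with x hx
        rw [hg]
        simp only [eval_mul, eval_pow, eval_sub, eval_X, eval_C]
        field_simp
      · filter_upwards [hne] with x hx
        rw [hd, show m + d + 1 = m + (d + 1) by ring, pow_add]
        field_simp
    have h2 : Tendsto (fun x => (x - c) ^ (d + 1)) (𝓝[≠] c) (𝓝 0) := by
      simpa using h0.pow (d + 1)
    exact hg0 (tendsto_nhds_unique ((g.continuous.tendsto c).mono_left nhdsWithin_le_nhds)
      (h1.trans_tendsto h2))
  exact (pow_dvd_pow _ hkm).trans ⟨g, hg⟩

theorem monic_of_tendsto {q : ℂ[X]} {k : ℕ}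
    (h : Tendsto (fun x => q.eval x / x ^ k) (cobounded ℂ) (𝓝 1)) : q.Monic ∧ q.natDegree = k := by
  have h1 : q.natDegree ≤ k := by
    refine natDegree_le_of_isBigO ?_
    refine ((h.isBigO_one ℂ).mul (isBigO_refl (fun x : ℂ => x ^ k) _)).congr' ?_ ?_
    · filter_upwards [eventually_ne_zero_cobounded] with x hx
      field_simp
    · exact Eventually.of_forall fun x => one_mul _
  have h2 := tendsto_eval_div_pow q
  have h3 : q.natDegree = k := by
    by_contra hne
    obtain ⟨d, hd⟩ := Nat.exists_eq_add_of_lt (lt_of_le_of_ne h1 hne)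
    have h4 : Tendsto (fun x : ℂ => x⁻¹ ^ (d + 1)) (cobounded ℂ) (𝓝 0) := by
      simpa using (tendsto_inv₀_cobounded (α := ℂ)).pow (d + 1)
    have h5 := h2.mul h4
    rw [mul_zero] at h5
    refine one_ne_zero (tendsto_nhds_unique (h.congr' ?_) h5)
    filter_upwards [eventually_ne_zero_cobounded] with x hx
    rw [hd, show q.natDegree + d + 1 = q.natDegree + (d + 1) by ring, pow_add]
    rw [inv_pow]
    field_simp
  refine ⟨?_, h3⟩
  rw [h3] at h2
  exact tendsto_nhds_unique h2 h

namespace Branches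
variable {n : ℕ} (S : Branches n)

theorem prod_mem_rat {U : ℂ → Fin n → ℂ} (hU : U ∈ S.Reg) :
    (fun x => ∏ j, U x j) ∈ Rat S.B := by
  refine rat_congr (det_mem_rat
    (M := fun x => Matrix.of fun i k => tr (S.ypow i * U * dual S.ypow k) x) fun i k =>
      S.tr_mem (mul_mem (mul_mem (S.ypow_mem i) hU) (S.dual_mem S.ypow_mem S.det_ypow k)))
    fun x hx => ?_
  have h1 : (Matrix.of fun i k => tr (S.ypow i * U * dual S.ypow k) x) =
      mat S.ypow x * Matrix.diagonal (U x) * (mat S.ypow x)⁻¹ := by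
    ext i k
    rw [Matrix.mul_apply]
    simp [Matrix.mul_diagonal, mat, tr, dual]
  have h2 := S.det_ypow x hx
  rw [h1, Matrix.det_mul, Matrix.det_mul, Matrix.det_diagonal, Matrix.det_nonsing_inv,
    Ring.inverse_eq_inv']
  field_simp

theorem inv_mem_reg {U : ℂ → Fin n → ℂ} (hU : U ∈ S.Reg) (h0 : ∀ x ∉ S.B, ∀ j, U x j ≠ 0) :
    (fun x j => (U x j)⁻¹) ∈ S.Reg := by
  have hm : ∀ x, mat (fun i => S.ypow i * U) x = mat S.ypow x * Matrix.diagonal (U x) := fun x => by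
    ext i j; simp [mat, Matrix.mul_diagonal]
  have hdet : ∀ x ∉ S.B, (mat (fun i => S.ypow i * U) x).det ≠ 0 := fun x hx => by
    rw [hm, Matrix.det_mul, Matrix.det_diagonal]
    exact mul_ne_zero (S.det_ypow x hx) (Finset.prod_ne_zero_iff.2 fun j _ => h0 x hx j)
  refine S.reg_congr (sum_mem (t := Finset.univ) fun i _ =>
    mul_mem (S.dual_mem (fun i => mul_mem (S.ypow_mem i) hU) hdet i) (S.ypow_mem i))
    fun x hx j => ?_
  have h1 := sum_dual_mul (hdet x hx) j j
  rw [if_pos rfl] at h1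
  rw [Finset.sum_apply, Finset.sum_apply]
  have h2 := h0 x hx j
  rw [inv_eq_iff_eq_inv, ← one_div, eq_div_iff, ← h1]
  · rw [Finset.mul_sum]
    refine Finset.sum_congr rfl fun i _ => ?_
    simp only [Pi.mul_apply]; ring
  · intro h3
    apply one_ne_zero (α := ℂ)
    rw [← h1]
    calc _ = U x j * ∑ i, (dual (fun i => S.ypow i * U) i * S.ypow i) x j := by
          rw [Finset.mul_sum]
          refine Finset.sum_congr rfl fun i _ => ?_
          simp only [Pi.mul_apply]; ring
      _ = 0 := by rw [h3, mul_zero]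

theorem eval_comp_mem {A : Subalgebra ℂ (ℂ → Fin n → ℂ)} {U : ℂ → Fin n → ℂ} (hU : U ∈ A)
    (P : ℂ[X]) : (fun x j => P.eval (U x j)) ∈ A := by
  have : (fun x j => P.eval (U x j)) =
      ∑ i ∈ Finset.range (P.natDegree + 1), algebraMap ℂ (ℂ → Fin n → ℂ) (P.coeff i) * U ^ i := by
    ext x j
    rw [eval_eq_sum_range]
    simp [Finset.sum_apply]
  rw [this]
  exact sum_mem fun i _ => mul_mem (Subalgebra.algebraMap_mem _ _) (pow_mem hU i)

/-- The same curve with one more excluded abscissa. -/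
noncomputable def exclude (x₀ : ℂ) : Branches n where
  F := S.F
  monic := S.monic
  prime := S.prime
  Y := S.Y
  map_eq := S.map_eq
  B := insert x₀ S.B
  zero_mem := Finset.mem_insert_of_mem S.zero_mem
  inj := fun x hx => S.inj x fun h => hx (Finset.mem_insert_of_mem h)

theorem reg_le_exclude {x₀ : ℂ} (h : x₀ ∉ S.B) : S.Reg ≤ (S.exclude x₀).Reg := by
  rintro U ⟨k, g, hg⟩
  refine ⟨k, g * C ((X - C x₀) ^ k), fun x hx j => ?_⟩
  have hx' : x ∉ S.B := fun h => hx (Finset.mem_insert_of_mem h)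
  have : denom (S.exclude x₀).B = (X - C x₀) * denom S.B := by
    simp only [denom, exclude]
    exact Finset.prod_insert h
  rw [this, evalEval_mul, show (S.exclude x₀).Y = S.Y from rfl, ← hg x hx' j, evalEval_C]
  simp only [eval_mul, eval_pow, eval_sub, eval_X, eval_C, mul_pow]
  ring

theorem exists_spike (hW : S.NoForms) {x₀ : ℂ} (hx₀ : x₀ ∉ S.B) (j₀ : Fin n) :
    ∃ a ∈ S.Lam, (∀ j, (fun x => a x j) =o[cobounded ℂ] fun x => x) ∧
      ∀ j, a x₀ j = if j = j₀ then 1 else 0 := by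
  obtain ⟨w, e, hw⟩ : ∃ w e, S.IsMin w e := by
    obtain ⟨w, e, m, h⟩ := S.exists_minimal
    exact ⟨w, e, m, h⟩
  refine ⟨∑ i, w i x₀ j₀ • dual w i, sum_mem fun i _ => Subalgebra.smul_mem _ (hw.dual_mem_Lam i) _,
    fun j => ?_, fun j => ?_⟩
  · simp only [Finset.sum_apply, Pi.smul_apply, smul_eq_mul]
    refine IsLittleO.fun_sum fun i _ => IsLittleO.const_mul_left ?_ _
    rw [isLittleO_iff_tendsto' (by
      filter_upwards [eventually_ne_zero_cobounded] with x hx h using absurd h hx)]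
    have := hw.dual_growth hW i j
    simpa [hw.exponent_eq_zero hW i, div_eq_mul_inv] using this
  · rw [← sum_dual_mul (hw.isTuple.det_ne x₀ hx₀) j j₀]
    simp only [Finset.sum_apply, Pi.smul_apply, smul_eq_mul]
    exact Finset.sum_congr rfl fun i _ => mul_comm _ _

theorem exists_linear_factor {x₀ : ℂ} (hx₀ : x₀ ∉ S.B) {j₀ : Fin n} {a : ℂ → Fin n → ℂ}
    (ha : a ∈ S.Lam) (hao : ∀ j, (fun x => a x j) =o[cobounded ℂ] fun x => x)
    (ha₀ : ∀ j, a x₀ j = if j = j₀ then 1 else 0) (s : ℂ) :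
    ∃ P : ℂ, ∀ x ∉ S.B, ∏ j, ((x - x₀) - s * a x j) = (x - x₀) ^ (n - 1) * (x - P) := by
  set U : ℂ → Fin n → ℂ := fun x j => (x - x₀) - s * a x j with hU
  have hUL : U ∈ S.Lam := by
    have h1 := S.poly_mem_Lam (X - C x₀)
    have h2 := sub_mem h1 (Subalgebra.smul_mem _ ha s)
    convert h2 using 1
    ext x j
    simp [hU]
  have hlim : ∀ b ∈ S.B, Tendsto (fun x => (∏ j, U x j) * (x - b)) (𝓝[≠] b) (𝓝 0) := fun b hb => by
    have h1 : (fun x => ∏ j, U x j) =O[𝓝[≠] b] fun _ => ∏ _j : Fin n, (1 : ℝ) :=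
      IsBigO.finsetProd fun j _ => hUL.2 b hb j
    simp only [Finset.prod_const_one] at h1
    have h2 := h1.mul_isLittleO ((isLittleO_one_iff ℝ).2 (tendsto_sub_nhdsNE b))
    simp only [one_mul] at h2
    exact (isLittleO_one_iff ℝ).1 h2
  obtain ⟨q, hq⟩ := exists_polynomial_of_rat (S.prod_mem_rat hUL.1) hlim
  have hmon : q.Monic ∧ q.natDegree = n := by
    refine monic_of_tendsto ?_
    have h1 : ∀ j, Tendsto (fun x => U x j / x) (cobounded ℂ) (𝓝 1) := fun j => by
      have h2 : Tendsto (fun x => 1 - x₀ * x⁻¹ - s * (a x j / x)) (cobounded ℂ)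
          (𝓝 (1 - x₀ * 0 - s * 0)) :=
        (tendsto_const_nhds.sub (tendsto_inv₀_cobounded.const_mul _)).sub
          ((hao j).tendsto_div_nhds_zero.const_mul s)
      simp only [mul_zero, sub_zero] at h2
      refine h2.congr' ?_
      filter_upwards [eventually_ne_zero_cobounded] with x hx
      simp only [hU]
      field_simp
    have h3 := tendsto_finsetProd Finset.univ fun j _ => h1 j
    simp only [Finset.prod_const_one] at h3
    refine h3.congr' ?_
    filter_upwards [eventually_notMem_cobounded S.B] with x hx
    rw [← hq x hx, Finset.prod_div_distrib]
    simp
  have hdvd : (X - C x₀) ^ (n - 1) ∣ q := by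
    refine pow_dvd_of_isBigO ?_
    obtain ⟨ω, hω, hval⟩ := S.exists_value hUL.1
    obtain ⟨r, h1, hr⟩ := ((S.exists_ball_notMem hx₀).and self_mem_nhdsWithin).exists
    obtain ⟨σ, hσ, hσc⟩ := S.exists_sections hr h1
    have hd : ∀ j, DifferentiableAt ℂ (fun x => ω x (σ j x)) x₀ := fun j =>
      hω x₀ hx₀ (σ j) (hσ.germ (Metric.mem_ball_self hr) j)
    have h2 : (fun x => ω x (σ j₀ x) * ∏ j ∈ Finset.univ.erase j₀, ω x (σ j x)) =O[𝓝 x₀]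
        fun x => 1 * ∏ j ∈ Finset.univ.erase j₀, (x - x₀) := by
      refine ((hd j₀).continuousAt.tendsto.isBigO_one ℂ).mul (IsBigO.finsetProd fun j hj => ?_)
      have h3 := (hd j).isBigO_sub
      have h4 : U x₀ j = 0 := by
        simp only [hU]
        rw [ha₀, if_neg (Finset.ne_of_mem_erase hj)]; ring
      simpa only [hσc, hval x₀ hx₀, h4, sub_zero] using h3
    simp only [Finset.prod_const, one_mul, Finset.mem_univ, Finset.card_erase_of_mem,
      Finset.card_univ, Fintype.card_fin] at h2
    refine (h2.mono nhdsWithin_le_nhds).congr' ?_ EventuallyEq.rfl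
    filter_upwards [nhdsWithin_le_nhds (Metric.ball_mem_nhds x₀ hr)] with x hx
    rw [Finset.mul_prod_erase Finset.univ (fun j => ω x (σ j x)) (Finset.mem_univ j₀),
      ← hq x (h1 x hx)]
    obtain ⟨τ, hτ⟩ := hσ.perm x hx
    rw [← Equiv.prod_comp τ fun j => U x j]
    exact Finset.prod_congr rfl fun j _ => by rw [hτ j, hval x (h1 x hx)]
  obtain ⟨g, rfl⟩ := hdvd
  have hm1 : ((X - C x₀) ^ (n - 1)).Monic := (monic_X_sub_C x₀).pow _
  have hg : g.Monic := hm1.of_mul_monic_left hmon.1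
  have hdeg : g.natDegree = 1 := by
    have h1 := hmon.2
    have := S.n_pos
    rw [hm1.natDegree_mul hg, natDegree_pow, natDegree_X_sub_C] at h1
    omega
  refine ⟨-g.coeff 0, fun x hx => ?_⟩
  rw [hq x hx, hg.eq_X_add_C hdeg]
  simp

end Branches

theorem eval_reverse_eq {P : ℂ[X]} {v : ℂ} (hv : v ≠ 0) :
    P.reverse.eval v = P.eval v⁻¹ * v ^ P.natDegree := by
  have : Invertible v⁻¹ := invertibleOfNonzero (inv_ne_zero hv)
  have h := eval₂_reverse_mul_pow (RingHom.id ℂ) v⁻¹ P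
  simp only [eval₂_id, invOf_eq_inv, inv_inv] at h
  rw [← h, mul_assoc, ← mul_pow, inv_mul_cancel₀ hv, one_pow, mul_one]

namespace Branches
variable {n : ℕ} (S : Branches n)

theorem exists_parameter (hW : S.NoForms) : ∃ x₀ ∉ S.B, ∃ (P : ℂ[X]) (c : ℂ),
    ∃ t ∈ (S.exclude x₀).Reg, c ≠ 0 ∧ ∀ x ∉ (S.exclude x₀).B,
      P - C x = C c * ∏ j, (X - C (t x j)) := by
  obtain ⟨x₀, hx₀⟩ := Infinite.exists_notMem_finset S.B
  have hn := S.n_pos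
  obtain ⟨a, ha, hao, ha₀⟩ := S.exists_spike hW hx₀ ⟨0, hn⟩
  choose p hp using S.exists_linear_factor hx₀ ha hao ha₀
  set S' := S.exclude x₀ with hS'
  have hB : ∀ x ∉ S'.B, x ∉ S.B ∧ x - x₀ ≠ 0 := fun x hx =>
    ⟨fun h => hx (Finset.mem_insert_of_mem h), fun h => hx (by
      rw [sub_eq_zero.1 h]; exact Finset.mem_insert_self _ _)⟩
  set v : ℂ → Fin n → ℂ := fun x j => a x j * (x - x₀)⁻¹ with hv
  have hvR : v ∈ S'.Reg := mul_mem (S.reg_le_exclude hx₀ ha.1)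
    (S'.const_mem (inv_sub_mem_rat (Finset.mem_insert_self _ _)))
  have hprod : ∀ x ∉ S'.B, ∀ s, (x - x₀) * ∏ j, (1 - v x j * s) = x - p s := by
    intro x hx s
    obtain ⟨h1, h2⟩ := hB x hx
    have h3 := hp s x h1
    have h4 : ∏ j, (x - x₀ - s * a x j) = (x - x₀) ^ n * ∏ j, (1 - v x j * s) := by
      rw [show (x - x₀) ^ n = ∏ _j : Fin n, (x - x₀) by simp, ← Finset.prod_mul_distrib]
      refine Finset.prod_congr rfl fun j _ => ?_
      simp only [hv]
      field_simp
    rw [h4, show (x - x₀) ^ n = (x - x₀) ^ (n - 1) * (x - x₀) by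
      rw [← pow_succ, Nat.sub_add_cancel hn], mul_assoc] at h3
    exact mul_left_cancel₀ (pow_ne_zero (n - 1) h2) h3
  obtain ⟨x₁, hx₁⟩ := Infinite.exists_notMem_finset S'.B
  set P : ℂ[X] := C x₁ - C (x₁ - x₀) * ∏ j, (1 - C (v x₁ j) * X) with hP
  have hPp : ∀ s, P.eval s = p s := fun s => by
    have := hprod x₁ hx₁ s
    simp only [hP, eval_sub, eval_C, eval_mul, eval_prod, eval_one, eval_X]
    rw [this]; ring
  have hPx : ∀ x ∉ S'.B, P - C x = - (C (x - x₀) * ∏ j, (1 - C (v x j) * X)) := by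
    intro x hx
    refine Polynomial.funext fun s => ?_
    have := hprod x hx s
    simp only [eval_sub, eval_C, eval_mul, eval_prod, eval_one, eval_X, eval_neg, hPp]
    rw [this]; ring
  have hP0 : P.eval 0 = x₀ := by
    have := hprod x₁ hx₁ 0
    rw [hPp]
    simp only [mul_zero, sub_zero, Finset.prod_const_one, mul_one] at this
    linear_combination this
  have hroot : ∀ x ∉ S'.B, ∀ j, v x j ≠ 0 → P.eval (v x j)⁻¹ = x := by
    intro x hx j hj
    have h1 := hprod x hx (v x j)⁻¹
    rw [Finset.prod_eq_zero (Finset.mem_univ j) (by rw [mul_inv_cancel₀ hj, sub_self]),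
      mul_zero] at h1
    rw [hPp]; linear_combination h1
  have hv0 : ¬ ∀ x ∉ S'.B, ∀ j, v x j = 0 := by
    intro h0
    obtain ⟨q, hq⟩ := S.tr_of_mem_W (S.lam_le_W ha)
    have hq0 : q = 0 := eval_eq_of_notMem (B := S'.B) fun x hx => by
      obtain ⟨h1, h2⟩ := hB x hx
      rw [← hq x h1, eval_zero]
      exact Finset.sum_eq_zero fun j _ =>
        (mul_eq_zero.1 (h0 x hx j)).resolve_right (inv_ne_zero h2)
    have h1 := hq x₀ hx₀
    rw [hq0, eval_zero, tr] at h1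
    simp [ha₀] at h1
  have hk : P.natDegree ≠ 0 := by
    intro hk
    push Not at hv0
    obtain ⟨x, hx, j, hj⟩ := hv0
    have h1 := hroot x hx j hj
    rw [eq_C_of_natDegree_eq_zero hk, eval_C] at h1 hP0
    exact (hB x hx).2 (by rw [← h1, hP0, sub_self])
  have hrel : ∀ x ∉ S'.B, ∀ j, P.reverse.eval (v x j) - x * v x j ^ P.natDegree = 0 := by
    refine (S'.reg_domain hvR (V := fun x j => P.reverse.eval (v x j) - x * v x j ^ P.natDegree)
      (sub_mem (eval_comp_mem hvR _) (mul_mem ?_ (pow_mem hvR _))) fun x hx j => ?_).resolve_left hv0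
    · simpa using S'.poly_mem X
    · by_cases hj : v x j = 0
      · rw [hj, zero_mul]
      · rw [eval_reverse_eq hj, hroot x hx j hj, sub_self, mul_zero]
  have hvne : ∀ x ∉ S'.B, ∀ j, v x j ≠ 0 := by
    intro x hx j hj
    have h1 := hrel x hx j
    rw [hj, zero_pow hk, mul_zero, sub_zero, ← coeff_zero_eq_eval_zero, coeff_zero_reverse,
      leadingCoeff_eq_zero] at h1
    exact hk (by rw [h1, natDegree_zero])
  have hfac : ∀ x ∉ S'.B, P - C x =
      C (-((x - x₀) * ∏ j, (- v x j))) * ∏ j, (X - C (v x j)⁻¹) := by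
    intro x hx
    rw [hPx x hx, C_neg, C_mul, map_prod, neg_mul, mul_assoc, ← Finset.prod_mul_distrib]
    congr 2
    refine Finset.prod_congr rfl fun j _ => ?_
    have := hvne x hx j
    have h1 : C (v x j) * C (v x j)⁻¹ = (1 : ℂ[X]) := by rw [← C_mul, mul_inv_cancel₀ this, C_1]
    rw [C_neg]
    linear_combination -h1
  have hcoef : ∀ x ∉ S'.B, -((x - x₀) * ∏ j, (- v x j)) = P.coeff n := by
    intro x hx
    have h1 := congrArg (fun q : ℂ[X] => q.coeff n) (hfac x hx)
    have hm : (∏ j, (X - C (v x j)⁻¹)).Monic := monic_prod_of_monic _ _ fun j _ => monic_X_sub_C _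
    have hd : (∏ j, (X - C (v x j)⁻¹)).natDegree = n := by
      rw [natDegree_prod_of_monic _ _ fun j _ => monic_X_sub_C _]; simp
    have h2 : (∏ j, (X - C (v x j)⁻¹)).coeff n = 1 := by
      have := hm.coeff_natDegree
      rwa [hd] at this
    simp only [coeff_sub, coeff_C_mul, h2, mul_one, coeff_C, hn.ne', if_false, sub_zero] at h1
    exact h1.symm
  refine ⟨x₀, hx₀, P, P.coeff n, fun x j => (v x j)⁻¹, S'.inv_mem_reg hvR hvne, ?_, fun x hx => ?_⟩
  · rw [← hcoef x₁ hx₁, neg_ne_zero]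
    exact mul_ne_zero (hB x₁ hx₁).2
      (Finset.prod_ne_zero_iff.2 fun j _ => neg_ne_zero.2 (hvne x₁ hx₁ j))
  · rw [hfac x hx, hcoef x hx]

end Branches

namespace Branches
variable {n : ℕ} (S : Branches n)

/-- The function `t` takes each complex value once on the curve, and `P` expresses the abscissa
through it. -/
structure IsParam (P : ℂ[X]) (c : ℂ) (t : ℂ → Fin n → ℂ) : Prop where
  mem : t ∈ S.Reg
  ne : c ≠ 0
  eq : ∀ x ∉ S.B, P - C x = C c * ∏ j, (X - C (t x j))

namespace IsParam
variable {S} {P : ℂ[X]} {c : ℂ} {t : ℂ → Fin n → ℂ}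

theorem natDegree_eq (h : S.IsParam P c t) : P.natDegree = n := by
  obtain ⟨x, hx⟩ := Infinite.exists_notMem_finset S.B
  rw [← natDegree_sub_C (a := x), h.eq x hx, natDegree_C_mul h.ne,
    natDegree_prod_of_monic _ _ fun j _ => monic_X_sub_C _]
  simp

theorem eval_sub_eq (h : S.IsParam P c t) {x : ℂ} (hx : x ∉ S.B) (s : ℂ) :
    P.eval s - x = c * ∏ j, (s - t x j) := by
  have := congrArg (eval s) (h.eq x hx)
  simpa [eval_prod] using this

theorem eval_t (h : S.IsParam P c t) {x : ℂ} (hx : x ∉ S.B) (j : Fin n) :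
    P.eval (t x j) = x := by
  have := h.eval_sub_eq hx (t x j)
  rw [Finset.prod_eq_zero (Finset.mem_univ j) (sub_self _), mul_zero] at this
  exact sub_eq_zero.1 this

theorem exists_eq_t (h : S.IsParam P c t) {s : ℂ} (hs : P.eval s ∉ S.B) :
    ∃ j, s = t (P.eval s) j := by
  have := h.eval_sub_eq hs s
  rw [sub_self, eq_comm, mul_eq_zero, Finset.prod_eq_zero_iff] at this
  obtain ⟨j, _, hj⟩ := this.resolve_left h.ne
  exact ⟨j, sub_eq_zero.1 hj⟩

theorem eq_zero_of_eval (h : S.IsParam P c t) {p : ℂ[X]}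
    (hp : ∀ x ∉ S.B, ∀ j, p.eval (t x j) = 0) : p = 0 := by
  refine p.eq_zero_of_infinite_isRoot (Set.Infinite.mono (s := (fun x => t x ⟨0, S.n_pos⟩) ''
    (S.B : Set ℂ)ᶜ) ?_ ?_)
  · rintro _ ⟨x, hx, rfl⟩
    exact hp x hx _
  · refine Set.Infinite.image (fun x hx y hy hxy => ?_) S.B.finite_toSet.infinite_compl
    rw [← h.eval_t hx ⟨0, S.n_pos⟩, ← h.eval_t hy ⟨0, S.n_pos⟩]
    exact congrArg (eval · P) hxy

theorem exists_pow_bound (h : S.IsParam P c t) :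
    ∃ K : ℝ, ∀ s, ‖s ^ n‖ ≤ K * (‖P.eval s‖ + 1) := by
  have hP : P ≠ 0 := fun h0 => S.n_pos.ne' (by rw [← h.natDegree_eq, h0, natDegree_zero])
  have h1 : (fun s : ℂ => s ^ n) =O[cobounded ℂ] fun s => P.eval s := by
    have : (X ^ n : ℂ[X]).degree ≤ P.degree := by
      rw [degree_X_pow, degree_eq_natDegree hP, h.natDegree_eq]
    simpa using isBigO_cobounded_of_degree_le this
  obtain ⟨K, hK⟩ := h1.bound
  obtain ⟨R, -, hR⟩ := (Metric.hasBasis_cobounded_compl_closedBall (0 : ℂ)).eventually_iff.1 hK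
  refine ⟨|K| + |R| ^ n, fun s => ?_⟩
  have hRn : 0 ≤ |R| ^ n := by positivity
  have hp := norm_nonneg (P.eval s)
  by_cases hs : ‖s‖ ≤ R
  · have h2 : ‖s ^ n‖ ≤ |R| ^ n := by
      rw [norm_pow]
      exact pow_le_pow_left₀ (norm_nonneg _) (hs.trans (le_abs_self R)) n
    nlinarith [abs_nonneg K, mul_nonneg (abs_nonneg K) hp, mul_nonneg hRn hp]
  · have h2 := hR (x := s) (by simpa using hs)
    nlinarith [abs_nonneg K, mul_nonneg (abs_nonneg K) hp, mul_nonneg hRn hp,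
      mul_le_mul_of_nonneg_right (le_abs_self K) hp]

theorem mem_Lam (h : S.IsParam P c t) : t ∈ S.Lam := by
  obtain ⟨K, hK⟩ := h.exists_pow_bound
  refine ⟨h.mem, fun b _ j => isBigO_one_of_pow S.n_pos.ne' ?_⟩
  have h1 : (fun x : ℂ => K * (‖x‖ + 1)) =O[𝓝[≠] b] fun _ => (1 : ℝ) := by
    have h2 : Continuous fun x : ℂ => K * (‖x‖ + 1) := by fun_prop
    exact ((h2.tendsto b).mono_left nhdsWithin_le_nhds).isBigO_one ℝ
  refine IsBigO.trans (IsBigO.of_bound 1 ?_) h1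
  filter_upwards [eventually_notMem_nhdsNE S.B b] with x hx
  rw [one_mul]
  have h3 := hK (t x j)
  rw [h.eval_t hx] at h3
  exact h3.trans (le_abs_self _)

theorem pow_isLittleO (h : S.IsParam P c t) {i : ℕ} (hi : i < n) (j : Fin n) :
    (fun x => t x j ^ i) =o[cobounded ℂ] fun x => x := by
  obtain ⟨K, hK⟩ := h.exists_pow_bound
  have h1 : (fun x => t x j ^ n * x⁻¹) =O[cobounded ℂ] fun _ => (1 : ℂ) := by
    refine IsBigO.of_bound (|K| * 2) ?_
    filter_upwards [eventually_notMem_cobounded S.B,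
      tendsto_norm_cobounded_atTop.eventually_ge_atTop 1] with x hx hx1
    have h3 := hK (t x j)
    rw [h.eval_t hx] at h3
    have hpos : 0 < ‖x‖ := by linarith
    rw [norm_mul, norm_inv, norm_one, mul_one, mul_inv_le_iff₀ hpos]
    calc _ ≤ _ := h3
      _ ≤ |K| * (‖x‖ + 1) := mul_le_mul_of_nonneg_right (le_abs_self K) (by positivity)
      _ ≤ |K| * 2 * ‖x‖ := by nlinarith [abs_nonneg K]
  rw [isLittleO_iff_tendsto' (by
    filter_upwards [eventually_ne_zero_cobounded] with x hx h using absurd h hx)]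
  refine tendsto_zero_of_pow (m := n) ?_
  have h2 : Tendsto (fun x : ℂ => x⁻¹ ^ (n - i)) (cobounded ℂ) (𝓝 0) := by
    have := (tendsto_inv₀_cobounded (α := ℂ)).pow (n - i)
    rwa [zero_pow (by omega)] at this
  have h3 := (h1.pow i).mul_isLittleO ((isLittleO_one_iff ℂ).2 h2)
  simp only [one_pow, mul_one] at h3
  refine ((isLittleO_one_iff ℂ).1 h3).congr fun x => ?_
  have hni : x⁻¹ ^ n = x⁻¹ ^ i * x⁻¹ ^ (n - i) := by rw [← pow_add, Nat.add_sub_cancel' hi.le]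
  rw [div_eq_mul_inv, mul_pow, mul_pow, hni, ← pow_mul, ← pow_mul, mul_comm n i, mul_assoc]

theorem exists_matrix (h : S.IsParam P c t) (hW : S.NoForms) {w e} (hw : S.IsMin w e) :
    ∃ M : Matrix (Fin n) (Fin n) ℂ, ∀ i k : Fin n, ∀ x ∉ S.B, tr (t ^ (i : ℕ) * w k) x = M i k := by
  have key : ∀ i k : Fin n, ∃ m : ℂ, ∀ x ∉ S.B, tr (t ^ (i : ℕ) * w k) x = m := fun i k => by
    have hmem : t ^ (i : ℕ) * w k ∈ S.W := by
      rw [mul_comm]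
      exact S.mul_mem_W (hw.isTuple.mem k) (pow_mem h.mem_Lam i)
    obtain ⟨q, hq⟩ := S.tr_of_mem_W hmem
    refine ⟨q.coeff 0, fun x hx => ?_⟩
    have hd : q.natDegree = 0 := by
      by_cases hq0 : q = 0
      · simp [hq0]
      have h1 : tr (t ^ (i : ℕ) * w k) =o[cobounded ℂ] fun x => x := tr_isLittleO fun j => by
        have h2 := hw.isTuple.growth k j
        simp only [hw.exponent_eq_zero hW k, pow_zero] at h2
        simpa using (h.pow_isLittleO i.2 j).mul_isBigO h2
      have h3 := natDegree_lt_of_isLittleO (e := 1) hq0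
        (by simpa using h1.congr' (poly_congr_cobounded hq) EventuallyEq.rfl)
      omega
    rw [hq x hx, eq_C_of_natDegree_eq_zero hd]; simp
  choose M hM using key
  exact ⟨Matrix.of M, hM⟩

theorem exists_polynomial (h : S.IsParam P c t) (hW : S.NoForms) {u : ℂ → Fin n → ℂ}
    (hu : u ∈ S.Lam) : ∃ Q : ℂ[X], ∀ x ∉ S.B, ∀ j, u x j = Q.eval (t x j) := by
  obtain ⟨w, e, hw⟩ : ∃ w e, S.IsMin w e := by
    obtain ⟨w, e, m, h⟩ := S.exists_minimal
    exact ⟨w, e, m, h⟩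
  obtain ⟨M, hM⟩ := h.exists_matrix hW hw
  have hpow : ∀ i : Fin n, ∀ x ∉ S.B, ∀ j, t x j ^ (i : ℕ) = ∑ k, M i k * dual w k x j := by
    intro i x hx j
    have := expand_dual (hw.isTuple.det_ne x hx) (t ^ (i : ℕ)) j
    simpa only [hM i _ x hx, Pi.pow_apply] using this
  have hdet : M.det ≠ 0 := by
    intro h0
    obtain ⟨v, hv, hvM⟩ := Matrix.exists_vecMul_eq_zero_iff.2 h0
    have hp : (∑ i, C (v i) * X ^ (i : ℕ) : ℂ[X]) = 0 := h.eq_zero_of_eval fun x hx j => by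
      simp only [eval_finsetSum, eval_mul, eval_C, eval_pow, eval_X, hpow _ x hx j,
        Finset.mul_sum]
      rw [Finset.sum_comm]
      refine Finset.sum_eq_zero fun k _ => ?_
      have := congrFun hvM k
      simp only [Matrix.vecMul, dotProduct, Pi.zero_apply] at this
      simp only [← mul_assoc, ← Finset.sum_mul, this, zero_mul]
    refine hv (funext fun i => ?_)
    have := congrArg (fun p => p.coeff (i : ℕ)) hp
    simpa [finsetSum_coeff, coeff_X_pow, Fin.val_inj] using this
  choose q hq using fun k => S.tr_of_mem_W (w := u * w k) (by
    rw [mul_comm]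
    exact S.mul_mem_W (hw.isTuple.mem k) hu)
  refine ⟨∑ k, (q k).comp P * ∑ i, C (M⁻¹ k i) * X ^ (i : ℕ), fun x hx j => ?_⟩
  rw [expand_dual (hw.isTuple.det_ne x hx) u j]
  simp only [eval_finsetSum, eval_mul, eval_comp, h.eval_t hx, eval_C, eval_pow, eval_X]
  refine Finset.sum_congr rfl fun k _ => ?_
  rw [hq k x hx]
  congr 1
  simp only [hpow _ x hx j, Finset.mul_sum]
  rw [Finset.sum_comm]
  have hinv : ∀ l, ∑ i, M⁻¹ k i * M i l = if k = l then 1 else 0 := fun l => by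
    rw [← Matrix.mul_apply, Matrix.nonsing_inv_mul _ hdet.isUnit, Matrix.one_apply]
  simp only [← mul_assoc, ← Finset.sum_mul, hinv]
  simp

end IsParam
end Branches

theorem tendsto_eval_div_derivative {R : ℂ[X]} (hR : R ≠ 0) {s : ℂ} (hs : R.eval s = 0) :
    Tendsto (fun z => (R.derivative.eval z)⁻¹ * R.eval z) (𝓝[≠] s) (𝓝 0) := by
  obtain ⟨g, hg, hg0⟩ := exists_eq_pow_rootMultiplicity_mul_and_not_dvd R hR s
  have hm : R.rootMultiplicity s ≠ 0 := (rootMultiplicity_pos hR).2 hs |>.ne'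
  obtain ⟨m, hm⟩ := Nat.exists_eq_succ_of_ne_zero hm
  rw [hm] at hg
  rw [dvd_iff_isRoot, IsRoot] at hg0
  have hm1 : ((m : ℂ) + 1) ≠ 0 := Nat.cast_add_one_ne_zero m
  have h1 : Tendsto (fun z => ((m + 1) * g.eval z + (z - s) * g.derivative.eval z)⁻¹ *
      ((z - s) * g.eval z)) (𝓝[≠] s) (𝓝 0) := by
    have hc : ContinuousAt (fun z => ((m + 1) * g.eval z + (z - s) * g.derivative.eval z)⁻¹ *
      ((z - s) * g.eval z)) s := by
      refine ContinuousAt.mul (ContinuousAt.inv₀ (by fun_prop) ?_) (by fun_prop)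
      simpa using ⟨hm1, hg0⟩
    have := hc.tendsto.mono_left (nhdsWithin_le_nhds (s := {s}ᶜ))
    simpa using this
  refine h1.congr' ?_
  filter_upwards [self_mem_nhdsWithin] with z hz
  have hz : z - s ≠ 0 := sub_ne_zero.2 hz
  have h2 : R.derivative.eval z =
      (z - s) ^ m * ((m + 1) * g.eval z + (z - s) * g.derivative.eval z) := by
    rw [hg]
    simp [derivative_mul, derivative_pow]
    ring
  have h3 : R.eval z = (z - s) ^ m * ((z - s) * g.eval z) := by
    conv_lhs => rw [hg]
    simp
    ring
  rw [h2, h3, mul_inv, mul_mul_mul_comm, inv_mul_cancel₀ (pow_ne_zero m hz), one_mul]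

namespace Branches
namespace IsParam
variable {n : ℕ} {S : Branches n} {P : ℂ[X]} {c : ℂ} {t : ℂ → Fin n → ℂ}

theorem derivative_ne_zero (h : S.IsParam P c t) (hW : S.NoForms) {x : ℂ} (hx : x ∉ S.B)
    (j : Fin n) : P.derivative.eval (t x j) ≠ 0 := by
  obtain ⟨q, hq⟩ := h.exists_polynomial hW S.Y_mem_Lam
  have hinj : Function.Injective (t x) := fun i k hik => S.inj x hx (by
    rw [hq x hx, hq x hx, hik])
  have h1 : P.derivative = (C c * ∏ j, (X - C (t x j))).derivative := by
    rw [← h.eq x hx]; simp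
  classical
  rw [h1, ← Finset.mul_prod_erase _ _ (Finset.mem_univ j)]
  simp only [derivative_mul, derivative_C, zero_mul, zero_add, derivative_sub, derivative_X,
    sub_zero, one_mul, eval_mul, eval_add, eval_C, eval_sub, eval_X, sub_self, add_zero, eval_prod]
  refine mul_ne_zero h.ne (Finset.prod_ne_zero_iff.2 fun k hk => sub_ne_zero.2 fun e => ?_)
  exact Finset.ne_of_mem_erase hk (hinj e.symm)

theorem inv_derivative_mem_W (h : S.IsParam P c t) (hW : S.NoForms) :
    (fun x j => (P.derivative.eval (t x j))⁻¹) ∈ S.W := by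
  refine ⟨S.inv_mem_reg (eval_comp_mem h.mem _) fun x hx j => h.derivative_ne_zero hW hx j,
    fun b hb j => tendsto_iff_ultrafilter _ _ _ |>.2 fun 𝒰 h𝒰 => ?_⟩
  obtain ⟨K, hK⟩ := (h.mem_Lam.2 b hb j).bound
  have hB := eventually_notMem_nhdsNE S.B b
  have hP : P - C b ≠ 0 := fun h0 => S.n_pos.ne' (by
    rw [← h.natDegree_eq, ← natDegree_sub_C (a := b), h0, natDegree_zero])
  obtain ⟨s, -, hs⟩ := (isCompact_closedBall (0 : ℂ) K).ultrafilter_le_nhds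
    (𝒰.map fun x => t x j) (le_principal_iff.2 (h𝒰 (by
      filter_upwards [hK] with x hx
      simpa using hx)))
  have hs : Tendsto (fun x => t x j) 𝒰 (𝓝 s) := hs
  have h1 : Tendsto (fun x => P.eval (t x j)) 𝒰 (𝓝 b) := by
    have h0 : Tendsto (fun x : ℂ => x) 𝒰 (𝓝 b) := h𝒰.trans nhdsWithin_le_nhds
    refine h0.congr' ?_
    filter_upwards [h𝒰 hB] with x hx using (h.eval_t hx j).symm
  have h2 : P.eval s = b :=
    tendsto_nhds_unique ((P.continuous.tendsto s).comp hs) h1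
  have h3 : Tendsto (fun x => t x j) 𝒰 (𝓝[≠] s) := by
    refine tendsto_nhdsWithin_iff.2 ⟨hs, ?_⟩
    filter_upwards [h𝒰 hB, h𝒰 self_mem_nhdsWithin] with x hx hxb e
    rw [Set.mem_singleton_iff] at e
    have := h.eval_t hx j
    rw [e, h2] at this
    exact hxb this.symm
  have h4 := (tendsto_eval_div_derivative hP (s := s) (by simp [h2])).comp h3
  refine h4.congr' ?_
  filter_upwards [h𝒰 hB] with x hx
  simp [h.eval_t hx j]

theorem exists_primitive (h : S.IsParam P c t) [ContractibleSpace S.Curve] :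
    ∃ (f : ℂ → ℂ → ℂ) (d : ℂ), (Continuous fun z : S.Curve => f z.1.1 z.1.2) ∧
      ∀ x ∉ S.B, ∀ j, f x (S.Y x j) = t x j + d := by
  have hW : S.NoForms := S.noForms_of_contractible
  have hw := h.inv_derivative_mem_W hW
  obtain ⟨ω, f, hω, hf, hfc⟩ := S.exists_W_prim hw
  obtain ⟨Q, hQ⟩ := h.exists_polynomial hW (IsPrim.mem_lam hw hω hf hfc)
  obtain ⟨θ, hθ, hθt⟩ := S.exists_value h.mem
  have hder : (Q - X).derivative = 0 := h.eq_zero_of_eval fun x hx j => by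
    obtain ⟨s, hs, hsx⟩ := S.exists_germ hx (S.evalEval_Y x j)
    have hB : ∀ᶠ x' in 𝓝 x, x' ∉ S.B :=
      S.B.finite_toSet.isClosed.isOpen_compl.mem_nhds (by simpa)
    have hτ := (hθ x hx s hs).hasDerivAt
    set τ' := deriv (fun x' => θ x' (s x')) x with hτ'
    have hval : ∀ᶠ x' in 𝓝 x, ∃ k, s x' = S.Y x' k := hs.mono fun x' h' =>
      S.evalEval_eq_zero_iff.1 h'.2
    have hτx : θ x (s x) = t x j := by rw [hsx, hθt x hx]
    have h1 : P.derivative.eval (t x j) * τ' = 1 := by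
      have h2 := (P.hasDerivAt (θ x (s x))).comp x hτ
      rw [hτx] at h2
      refine h2.unique ((hasDerivAt_id x).congr_of_eventuallyEq ?_)
      filter_upwards [hval, hB] with x' ⟨k, hk⟩ hx'
      simp [hk, hθt x' hx', h.eval_t hx']
    have h3 : Q.derivative.eval (t x j) * τ' = (P.derivative.eval (t x j))⁻¹ := by
      have h2 := (Q.hasDerivAt (θ x (s x))).comp x hτ
      have h4 := hf x trivial hx s hs
      rw [hsx, hω x hx] at h4
      rw [hτx] at h2
      refine h2.unique (h4.congr_of_eventuallyEq ?_)
      filter_upwards [hval, hB] with x' ⟨k, hk⟩ hx'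
      simp [hk, hθt x' hx', hQ x' hx']
    have h5 : τ' = (P.derivative.eval (t x j))⁻¹ := eq_inv_of_mul_eq_one_right h1
    rw [← h5] at h3
    have h6 : τ' ≠ 0 := right_ne_zero_of_mul_eq_one h1
    rw [derivative_sub, derivative_X, eval_sub, eval_one, sub_eq_zero]
    exact mul_right_cancel₀ h6 (h3.trans (one_mul _).symm)
  have hconst := eq_C_of_natDegree_eq_zero (Polynomial.derivative_eq_zero.1 hder)
  refine ⟨f, (Q - X).coeff 0, hfc, fun x hx j => ?_⟩
  have h1 := congrArg (eval (t x j)) hconst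
  rw [eval_sub, eval_X, eval_C] at h1
  rw [hQ x hx j, ← h1]; ring

end IsParam
end Branches

namespace Branches
variable {n : ℕ} (S : Branches n)

theorem dense_proj_notMem : Dense {z : S.Curve | z.1.1 ∉ S.B} := by
  rintro ⟨⟨b, y⟩, hz⟩
  rw [Metric.mem_closure_iff]
  intro ε hε
  have hc : Continuous fun x => S.F.evalEval x y :=
    (continuous_evalEval S.F).comp (by fun_prop : Continuous fun x : ℂ => (x, y))
  have h1 : ∀ᶠ x in 𝓝[≠] b, ‖S.F.evalEval x y‖ < (ε / 2) ^ n := by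
    have h2 := (hc.norm.tendsto b).mono_left (nhdsWithin_le_nhds (s := {b}ᶜ))
    rw [show S.F.evalEval b y = 0 from hz, norm_zero] at h2
    exact h2.eventually_lt_const (by positivity)
  have h3 : ∀ᶠ x in 𝓝[≠] b, dist b x < ε := nhdsWithin_le_nhds (by
    filter_upwards [Metric.ball_mem_nhds b hε] with x hx
    rwa [dist_comm])
  obtain ⟨x, ⟨hx1, hx2⟩, hx3⟩ :=
    ((h1.and (eventually_notMem_nhdsNE S.B b)).and h3).exists
  obtain ⟨j, hj⟩ : ∃ j, ‖y - S.Y x j‖ < ε := by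
    by_contra! hall
    rw [S.evalEval_eq_prod, norm_prod] at hx1
    have h4 : (ε / 2) ^ n ≤ ∏ j, ‖y - S.Y x j‖ := by
      have := Finset.prod_le_prod (s := Finset.univ) (f := fun _ : Fin n => ε / 2)
        (g := fun j => ‖y - S.Y x j‖) (fun _ _ => by positivity) fun j _ => by
          linarith [hall j]
      rwa [Finset.prod_const, Finset.card_univ, Fintype.card_fin] at this
    linarith
  refine ⟨⟨(x, S.Y x j), S.evalEval_Y x j⟩, hx2, ?_⟩
  rw [Subtype.dist_eq, Prod.dist_eq]
  exact max_lt hx3 (by rwa [dist_eq_norm])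

variable {S} in
theorem IsParam.exists_homeomorph {P : ℂ[X]} {c : ℂ} {t : ℂ → Fin n → ℂ} (h : S.IsParam P c t)
    [ContractibleSpace S.Curve] :
    ∃ (p q : ℂ[X]) (e : ℂ ≃ₜ S.Curve), ∀ s, (e s : ℂ × ℂ) = (p.eval s, q.eval s) := by
  have hW : S.NoForms := S.noForms_of_contractible
  obtain ⟨q, hq⟩ := h.exists_polynomial hW S.Y_mem_Lam
  obtain ⟨f, d, hfc, hf⟩ := h.exists_primitive
  have hdense : Dense {s | P.eval s ∉ S.B} := by
    have hfin : {s | P.eval s ∈ S.B}.Finite := by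
      have : {s | P.eval s ∈ S.B} ⊆ ⋃ b ∈ S.B, {s | (P - C b).IsRoot s} := fun s hs => by
        simp only [Set.mem_iUnion]
        exact ⟨_, hs, by simp [IsRoot]⟩
      refine Set.Finite.subset (S.B.finite_toSet.biUnion fun b _ => ?_) this
      exact finite_setOfPred_isRoot fun h0 => S.n_pos.ne' (by
        rw [← h.natDegree_eq, ← natDegree_sub_C (a := b), h0, natDegree_zero])
    exact hfin.countable.dense_compl ℂ
  have hY : ∀ s, P.eval s ∉ S.B → ∃ j, q.eval s = S.Y (P.eval s) j ∧ s = t (P.eval s) j := by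
    intro s hs
    obtain ⟨j, hj⟩ := h.exists_eq_t hs
    exact ⟨j, by rw [hq _ hs, ← hj], hj⟩
  have hcurve : ∀ s, S.F.evalEval (P.eval s) (q.eval s) = 0 := fun s => by
    have hc : Continuous fun s => S.F.evalEval (P.eval s) (q.eval s) :=
      (continuous_evalEval S.F).comp (P.continuous.prodMk q.continuous)
    refine congrFun (hc.ext_on hdense continuous_const fun s hs => ?_) s
    obtain ⟨j, hj, -⟩ := hY s hs
    simp only [hj, S.evalEval_Y]
  let φ : ℂ → S.Curve := fun s => ⟨(P.eval s, q.eval s), hcurve s⟩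
  have hφ : Continuous φ := (P.continuous.prodMk q.continuous).subtype_mk _
  let ψ : S.Curve → ℂ := fun z => f z.1.1 z.1.2 - d
  have hψ : Continuous ψ := hfc.sub continuous_const
  refine ⟨P, q, ⟨⟨φ, ψ, fun s => ?_, fun z => ?_⟩, hφ, hψ⟩, fun s => rfl⟩
  · refine congrFun ((hψ.comp hφ).ext_on hdense continuous_id fun s hs => ?_) s
    obtain ⟨j, hj, hj'⟩ := hY s hs
    change f (P.eval s) (q.eval s) - d = s
    rw [hj, hf _ hs, ← hj', add_sub_cancel_right]
  · refine congrFun ((hφ.comp hψ).ext_on S.dense_proj_notMem continuous_id ?_) z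
    rintro ⟨⟨x, y⟩, hz⟩ hx
    obtain ⟨j, hj⟩ := S.evalEval_eq_zero_iff.1 hz
    obtain rfl : y = S.Y x j := hj
    have hψt : ψ ⟨(x, S.Y x j), hz⟩ = t x j := by
      change f x (S.Y x j) - d = _
      rw [hf x hx, add_sub_cancel_right]
    simp only [Function.comp_apply, id, hψt]
    exact Subtype.ext (Prod.ext (h.eval_t hx j) (hq x hx j).symm)

theorem exists_homeomorph [ContractibleSpace S.Curve] :
    ∃ (p q : ℂ[X]) (e : ℂ ≃ₜ S.Curve), ∀ s, (e s : ℂ × ℂ) = (p.eval s, q.eval s) := by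
  obtain ⟨x₀, -, P, c, t, ht, hc, h⟩ := S.exists_parameter S.noForms_of_contractible
  have hcon : ContractibleSpace (S.exclude x₀).Curve := ‹ContractibleSpace S.Curve›
  exact IsParam.exists_homeomorph (S := S.exclude x₀) ⟨ht, hc, h⟩

end Branches

theorem exists_fin_roots {p : ℂ[X]} {n : ℕ} (hp : p.Monic) (hn : p.natDegree = n) :
    ∃ y : Fin n → ℂ, p = ∏ j, (X - C (y j)) := by
  have hs := IsAlgClosed.splits p
  have h1 := hs.eq_prod_roots_of_monic hp
  have h2 := hs.natDegree_eq_card_roots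
  obtain ⟨l, hl⟩ := Quot.exists_rep p.roots
  rw [← hl] at h1 h2
  have h3 : l.length = n := by rw [← hn, h2]; rfl
  subst h3
  refine ⟨fun j => l[j], h1.trans ?_⟩
  exact (Fin.prod_univ_fun_getElem l fun y => X - C y).symm

theorem exists_bezout {F : ℂ[X][X]} (hm : F.Monic) (hF : Irreducible F) :
    ∃ (a b : ℂ[X][X]) (r : ℂ[X]), r ≠ 0 ∧ a * F + b * F.derivative = C r := by
  set K := FractionRing ℂ[X]
  have hirr : Irreducible (F.map (algebraMap ℂ[X] K)) :=
    (hm.irreducible_iff_irreducible_map_fraction_map).1 hF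
  obtain ⟨a, b, hab⟩ := hirr.separable
  obtain ⟨c, hcm, hc⟩ := IsLocalization.integerNormalization_spec (nonZeroDivisors ℂ[X]) a
  obtain ⟨d, hdm, hd⟩ := IsLocalization.integerNormalization_spec (nonZeroDivisors ℂ[X]) b
  set a' := IsLocalization.integerNormalization (nonZeroDivisors ℂ[X]) a
  set b' := IsLocalization.integerNormalization (nonZeroDivisors ℂ[X]) b
  refine ⟨C d * a', C c * b', c * d,
    mul_ne_zero (nonZeroDivisors.ne_zero hcm) (nonZeroDivisors.ne_zero hdm), ?_⟩
  refine map_injective (algebraMap ℂ[X] K) (IsFractionRing.injective _ _) ?_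
  have hc' : a'.map (algebraMap ℂ[X] K) = C (algebraMap ℂ[X] K c) * a := by
    rw [hc, ← smul_eq_C_mul, algebraMap_smul]
  have hd' : b'.map (algebraMap ℂ[X] K) = C (algebraMap ℂ[X] K d) * b := by
    rw [hd, ← smul_eq_C_mul, algebraMap_smul]
  rw [derivative_map] at hab
  simp only [Polynomial.map_add, Polynomial.map_mul, map_C, hc', hd', map_mul]
  linear_combination (C (algebraMap ℂ[X] K c) * C (algebraMap ℂ[X] K d)) * hab

theorem exists_branches {F : ℂ[X][X]} (hm : F.Monic) (hF : Irreducible F) :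
    ∃ (n : ℕ) (S : Branches n), S.F = F := by
  obtain ⟨a, b, r, hr, hab⟩ := exists_bezout hm hF
  choose Y hY using fun x => exists_fin_roots (hm.map (evalRingHom x))
    (hm.natDegree_map (evalRingHom x))
  refine ⟨F.natDegree, ⟨F, hm, hF.prime, Y, hY, insert 0 r.roots.toFinset,
    Finset.mem_insert_self _ _, fun x hx => ?_⟩, rfl⟩
  have hrx : r.eval x ≠ 0 := fun h => hx (Finset.mem_insert_of_mem (by simp [hr, h]))
  rw [← separable_prod_X_sub_C_iff, ← hY]
  have h1 := congrArg (Polynomial.map (evalRingHom x)) hab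
  simp only [Polynomial.map_add, Polynomial.map_mul, map_C, ← derivative_map,
    coe_evalRingHom] at h1
  refine ⟨C (r.eval x)⁻¹ * a.map (evalRingHom x), C (r.eval x)⁻¹ * b.map (evalRingHom x), ?_⟩
  have h2 : C (r.eval x)⁻¹ * C (r.eval x) = (1 : ℂ[X]) := by
    rw [← C_mul, inv_mul_cancel₀ hrx, C_1]
  linear_combination C (r.eval x)⁻¹ * h1 + h2

/-- The substitution `(X, Y) ↦ (X + cY, Y)`, with values in polynomials in `Y` over `ℂ[X]`. -/
noncomputable def shear (c : ℂ) : MvPolynomial (Fin 2) ℂ →ₐ[ℂ] ℂ[X][X] :=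
  MvPolynomial.aeval ![C X + C (C c) * X, X]

theorem evalEval_shear (c : ℂ) (f : MvPolynomial (Fin 2) ℂ) (x y : ℂ) :
    (shear c f).evalEval x y = MvPolynomial.eval ![x + c * y, y] f := by
  induction f using MvPolynomial.induction_on with
  | C a => simp [shear, evalEval]
  | add p q hp hq => rw [map_add, evalEval_add, hp, hq, map_add]
  | mul_X p i hp =>
    rw [map_mul, evalEval_mul, hp, map_mul]
    congr 1
    fin_cases i <;> simp [shear, evalEval]

theorem irreducible_shear (c : ℂ) {f : MvPolynomial (Fin 2) ℂ} (hf : Irreducible f) :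
    Irreducible (shear c f) :=
  (MulEquiv.irreducible_iff (AlgEquiv.ofAlgHom (shear c)
    (aevalAeval (MvPolynomial.X 0 - MvPolynomial.C c * MvPolynomial.X 1) (MvPolynomial.X 1))
    (by ext <;> simp [shear]) (by ext i; fin_cases i <;> simp [shear]))).2 hf

theorem natDegree_shear_le (c : ℂ) (f : MvPolynomial (Fin 2) ℂ) :
    (shear c f).natDegree ≤ f.totalDegree ∧ (shear c f).coeff f.totalDegree =
      C (MvPolynomial.eval ![c, 1] (MvPolynomial.homogeneousComponent f.totalDegree f)) := by
  have hlin : (C X + C (C c) * X : ℂ[X][X]).natDegree ≤ 1 := by compute_degree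
  have hmon : ∀ m a, shear c (MvPolynomial.monomial m a) =
      C (C a) * ((C X + C (C c) * X) ^ m 0 * X ^ m 1) := fun m a => by
    rw [shear, MvPolynomial.aeval_monomial, Finsupp.prod_fintype _ _ fun i => pow_zero _,
      Fin.prod_univ_two]
    rfl
  have hdeg : ∀ m : Fin 2 →₀ ℕ, m.degree = m 0 + m 1 := fun m => by
    rw [Finsupp.degree_eq_sum, Fin.sum_univ_two]
  have hd : ∀ m a, (shear c (MvPolynomial.monomial m a)).natDegree ≤ m.degree := fun m a => by
    rw [hmon, hdeg]
    refine (natDegree_C_mul_le _ _).trans (natDegree_mul_le_of_le ?_ (natDegree_X_pow_le _))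
    simpa using natDegree_pow_le_of_le (m 0) hlin
  have hcoeff : ∀ m a, (shear c (MvPolynomial.monomial m a)).coeff m.degree =
      C (MvPolynomial.eval ![c, 1] (MvPolynomial.monomial m a)) := fun m a => by
    have h1 : ((C X + C (C c) * X : ℂ[X][X]) ^ m 0).coeff (m 0) = C c ^ m 0 := by
      have := coeff_pow_of_natDegree_le (m := m 0) hlin
      rw [mul_one] at this
      rw [this]; simp [coeff_C]
    rw [hmon, hdeg, coeff_C_mul, coeff_mul_X_pow, h1, MvPolynomial.eval_monomial,
      Finsupp.prod_fintype _ _ fun i => pow_zero _, Fin.prod_univ_two]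
    simp
  have hsum : shear c f = ∑ m ∈ f.support, shear c (MvPolynomial.monomial m (f.coeff m)) := by
    conv_lhs => rw [f.as_sum, map_sum]
  have hle : ∀ m ∈ f.support, m.degree ≤ f.totalDegree := fun m hm => by
    rw [Finsupp.degree_eq_sum]
    simpa [Finsupp.sum_fintype] using MvPolynomial.le_totalDegree hm
  refine ⟨?_, ?_⟩
  · rw [hsum]
    exact natDegree_sum_le_of_forall_le _ _ fun m hm => (hd m _).trans (hle m hm)
  · rw [hsum, finsetSum_coeff, MvPolynomial.homogeneousComponent_apply, map_sum, map_sum,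
      Finset.sum_filter]
    refine Finset.sum_congr rfl fun m hm => ?_
    split_ifs with hmd
    · rw [← hmd, hcoeff]
    · exact coeff_eq_zero_of_natDegree_lt
        ((hd m _).trans_lt (lt_of_le_of_ne (hle m hm) hmd))

theorem exists_eval_ne_zero {f : MvPolynomial (Fin 2) ℂ} {d : ℕ} (hf : f.IsHomogeneous d)
    (h0 : f ≠ 0) : ∃ c, MvPolynomial.eval ![c, 1] f ≠ 0 := by
  by_contra! hc
  have h1 : f * MvPolynomial.X 1 = 0 := MvPolynomial.funext fun z => by
    rw [map_mul, map_zero, MvPolynomial.eval_X]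
    by_cases hz : z 1 = 0
    · rw [hz, mul_zero]
    · have h2 : MvPolynomial.eval z f = z 1 ^ d * MvPolynomial.eval ![z 0 / z 1, 1] f := by
        rw [MvPolynomial.eval_eq', MvPolynomial.eval_eq', Finset.mul_sum]
        refine Finset.sum_congr rfl fun m hm => ?_
        have h3 : m 0 + m 1 = d := by
          have := hf (MvPolynomial.mem_support_iff.1 hm)
          rwa [show (1 : Fin 2 → ℕ) = fun _ => 1 from rfl,
            ← DFunLike.congr_fun Finsupp.degree_eq_weight_one m, Finsupp.degree_eq_sum, Fin.sum_univ_two] at this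
        rw [Fin.prod_univ_two, Fin.prod_univ_two, ← h3, pow_add]
        simp only [Matrix.cons_val_zero, Matrix.cons_val_one, one_pow, div_pow]
        field_simp
      rw [h2, hc, mul_zero, zero_mul]
  exact (mul_ne_zero h0 (MvPolynomial.X_ne_zero 1)) h1

theorem exists_parametrization (f : MvPolynomial (Fin 2) ℂ) (hf : Irreducible f)
    (hcontr : ContractibleSpace {z : ℂ × ℂ // MvPolynomial.eval ![z.1, z.2] f = 0}) :
    ∃ (p q : ℂ[X]) (e : ℂ ≃ₜ {z : ℂ × ℂ // MvPolynomial.eval ![z.1, z.2] f = 0}),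
      ∀ t : ℂ, (e t : ℂ × ℂ) = (p.eval t, q.eval t) := by
  have htop : MvPolynomial.homogeneousComponent f.totalDegree f ≠ 0 := by
    obtain ⟨m, hm, hmd⟩ := Finset.exists_mem_eq_sup f.support
      (MvPolynomial.support_nonempty.2 hf.ne_zero) fun s => s.sum fun _ e => e
    intro h0
    have h1 := congrArg (MvPolynomial.coeff m) h0
    rw [MvPolynomial.coeff_homogeneousComponent, if_pos, MvPolynomial.coeff_zero] at h1
    · exact MvPolynomial.mem_support_iff.1 hm h1
    · rw [MvPolynomial.totalDegree, hmd]; rfl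
  obtain ⟨c, hc⟩ := exists_eval_ne_zero
    (MvPolynomial.homogeneousComponent_isHomogeneous f.totalDegree f) htop
  obtain ⟨hdeg, hcoeff⟩ := natDegree_shear_le c f
  set u := MvPolynomial.eval ![c, 1] (MvPolynomial.homogeneousComponent f.totalDegree f)
  have hu : IsUnit (C (C u⁻¹) : ℂ[X][X]) :=
    isUnit_C.2 (isUnit_C.2 (inv_ne_zero hc).isUnit)
  obtain ⟨n, S, hS⟩ := exists_branches (F := C (C u⁻¹) * shear c f)
    (monic_of_natDegree_le_of_coeff_eq_one f.totalDegree ((natDegree_C_mul_le _ _).trans hdeg)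
      (by rw [coeff_C_mul, hcoeff, ← C_mul, inv_mul_cancel₀ hc, C_1]))
    ((irreducible_isUnit_mul hu).2 (irreducible_shear c hf))
  have hSF : ∀ x y, S.F.evalEval x y = 0 ↔ MvPolynomial.eval ![x + c * y, y] f = 0 := by
    intro x y
    rw [hS, evalEval_mul, evalEval_shear, evalEval_C, eval_C, mul_eq_zero]
    exact or_iff_right (inv_ne_zero hc)
  let φ : S.Curve ≃ₜ {z : ℂ × ℂ // MvPolynomial.eval ![z.1, z.2] f = 0} :=
    { toFun := fun z => ⟨(z.1.1 + c * z.1.2, z.1.2), (hSF _ _).1 z.2⟩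
      invFun := fun z => ⟨(z.1.1 - c * z.1.2, z.1.2), (hSF _ _).2 (by
        rw [sub_add_cancel]; exact z.2)⟩
      left_inv := fun z => Subtype.ext (Prod.ext (add_sub_cancel_right _ _) rfl)
      right_inv := fun z => Subtype.ext (Prod.ext (sub_add_cancel _ _) rfl)
      continuous_toFun := by fun_prop
      continuous_invFun := by fun_prop }
  have hS' : ContractibleSpace S.Curve := φ.contractibleSpace
  obtain ⟨p, q, e, he⟩ := S.exists_homeomorph
  refine ⟨p + C c * q, q, e.trans φ, fun t => ?_⟩
  change ((e t).1.1 + c * (e t).1.2, (e t).1.2) = _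
  rw [he]
  simp

end PlaneCurve

open MvPolynomial

/-- **Corollary of Theorem A: polynomial parametrization.**
If `f ∈ ℂ[X,Y]` is irreducible and its zero set `Z(f) ⊆ ℂ²` is contractible in the
Euclidean topology, then there are one-variable polynomials `p, q ∈ ℂ[t]` such that
`t ↦ (p(t), q(t))` is a homeomorphism of `ℂ` onto `Z(f)`; in particular, every
contractible irreducible algebraic curve in `ℂ²` is homeomorphic to `ℂ`. -/
theorem contractible_curve_polynomial_parametrization
    (f : MvPolynomial (Fin 2) ℂ) (hf : Irreducible f)
    (hcontr : ContractibleSpace {z : ℂ × ℂ // MvPolynomial.eval ![z.1, z.2] f = 0}) :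
    ∃ (p q : Polynomial ℂ)
      (e : ℂ ≃ₜ {z : ℂ × ℂ // MvPolynomial.eval ![z.1, z.2] f = 0}),
      ∀ t : ℂ, (e t : ℂ × ℂ) = (p.eval t, q.eval t) :=
  PlaneCurve.exists_parametrization f hf hcontr
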